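/- Let p, q, r ∈ (2, ∞) be exponents satisfying 1/p + 1/q + 1/r = 1, and let r' = r/(r−1). Then there exists a constant C = C(p,q,r) such that for all Schwartz functions f, g on ℝ, ‖ ( Σ_{n∈ℤ} |S_n(f,g)|² )^{1/2} ‖_{L^{r'}(ℝ)} ≤ C ‖f‖_{L^p(ℝ)} ‖g‖_{L^q(ℝ)}. -/

import Mathlib

open MeasureTheory Real Set
open scoped ENNReal

/-- `φ_n(y) = ∫_n^{n+1} e^{2πi y ξ} dξ`, whose Fourier transform is `1_{[n,n+1]}`. -/
noncomputable def phi (n : ℤ) (y : ℝ) : ℂ :=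
  ∫ ξ in (n : ℝ)..((n : ℝ) + 1), Complex.exp (((2 * Real.pi * y * ξ : ℝ) : ℂ) * Complex.I)

/-- The bilinear operator `S_n(f,g)(x) = ∫ f(x+y) g(x-y) φ_n(y) dy`. -/
noncomputable def S (n : ℤ) (f g : ℝ → ℂ) (x : ℝ) : ℂ :=
  ∫ y : ℝ, f (x + y) * g (x - y) * phi n y


section

open scoped SchwartzMap FourierTransform Convolution BoundedContinuousFunction

/-- The spatial decay profile `(1 + |x| / t)⁻¹` at scale `t`. -/
noncomputable def decay (t x : ℝ) : ℝ := (1 + |x| / t)⁻¹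

lemma decay_pos {t : ℝ} (ht : 0 < t) (x : ℝ) : 0 < decay t x := by
  unfold decay; positivity

lemma decay_le_one {t : ℝ} (ht : 0 < t) (x : ℝ) : decay t x ≤ 1 := by
  unfold decay
  exact inv_le_one_of_one_le₀ (by have : 0 ≤ |x| / t := by positivity
                                  linarith)

lemma decay_sub_comm (t x y : ℝ) : decay t (x - y) = decay t (y - x) := by
  simp [decay, abs_sub_comm]

lemma decay_mul_decay_le {t t' : ℝ} (ht' : 0 < t') (htt : t' ≤ t) (x y : ℝ) :
    decay t x * decay t' y ≤ decay t (x + y) := by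
  have ht : 0 < t := ht'.trans_le htt
  unfold decay
  rw [← mul_inv]
  apply inv_anti₀ (by positivity)
  have h1 : |x + y| / t ≤ |x| / t + |y| / t' := by
    calc |x + y| / t ≤ (|x| + |y|) / t := by gcongr; exact abs_add_le x y
      _ = |x| / t + |y| / t := add_div _ _ _
      _ ≤ |x| / t + |y| / t' := by gcongr
  have h2 : 0 ≤ |x| / t * (|y| / t') := by positivity
  nlinarith

/-- Moving the argument by at most `t` costs a factor `2`. -/
lemma decay_le_two_mul {t : ℝ} (ht : 0 < t) {x y : ℝ} (h : |x - y| ≤ t) :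
    decay t x ≤ 2 * decay t y := by
  unfold decay
  rw [← div_eq_mul_inv, ← one_div, div_le_div_iff₀ (by positivity) (by positivity)]
  have h1 : |y| ≤ |x| + t := by
    have := abs_sub_abs_le_abs_sub y x
    rw [abs_sub_comm] at this; linarith
  have : |y| / t ≤ |x| / t + 1 := by
    rw [div_add_one ht.ne']; gcongr
  have h3 : 0 ≤ |x| / t := by positivity
  linarith

private lemma sum_range_inv_sq_le {t : ℝ} (ht : 1 ≤ t) (N : ℕ) :
    ∑ d ∈ Finset.range N, (1 + (d : ℝ) / t)⁻¹ ^ 2 ≤ 2 * t := by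
  have ht0 : 0 < t := by linarith
  have key : ∀ N : ℕ, ∑ d ∈ Finset.range (N + 1), (1 + (d : ℝ) / t)⁻¹ ^ 2 ≤
      2 * t - t ^ 2 / (t + N) := by
    intro N
    induction N with
    | zero => simp; field_simp; linarith
    | succ N ih =>
      rw [Finset.sum_range_succ]
      have : (1 + ((N + 1 : ℕ) : ℝ) / t)⁻¹ ^ 2 ≤ t ^ 2 / (t + N) - t ^ 2 / (t + (N + 1 : ℕ)) := by
        push_cast
        have h1 : (1 + ((N : ℝ) + 1) / t)⁻¹ = t / (t + (N + 1)) := by field_simp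
        rw [h1, div_sub_div _ _ (by positivity) (by positivity), div_pow,
          div_le_div_iff₀ (by positivity) (by positivity)]
        have hN : (0 : ℝ) ≤ N := by positivity
        have : t ^ 2 * (t + (↑N + 1)) - (t + ↑N) * t ^ 2 = t ^ 2 := by ring
        rw [this]
        have : (t + N) ≤ (t + (N + 1)) := by linarith
        have h5 : (t + ↑N) * (t + (↑N + 1)) ≤ (t + (↑N + 1)) ^ 2 := by nlinarith
        nlinarith [sq_nonneg t]
      linarith
  rcases N with _ | N
  · simp; linarith
  · have := key N
    have h : 0 ≤ t ^ 2 / (t + N) := by positivity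
    linarith

lemma sum_decay_sq_le {t : ℝ} (ht : 1 ≤ t) (y : ℝ) (X : Finset ℤ) :
    ∑ x ∈ X, decay t (x - y) ^ 2 ≤ 16 * t := by
  have ht0 : 0 < t := by linarith
  have h1 : ∀ x ∈ X, decay t (x - y) ^ 2 ≤ 4 * (1 + ((x - ⌊y⌋).natAbs : ℝ) / t)⁻¹ ^ 2 := by
    intro x _
    have : decay t (x - y) ≤ 2 * decay t (x - ⌊y⌋) := by
      apply decay_le_two_mul ht0
      have := Int.floor_le y
      have := Int.lt_floor_add_one y
      rw [abs_le]; constructor <;> linarith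
    have h2 : decay t (x - ⌊y⌋) = (1 + ((x - ⌊y⌋).natAbs : ℝ) / t)⁻¹ := by
      unfold decay
      rw [Nat.cast_natAbs]; push_cast; rfl
    rw [h2] at this
    have h0 := (decay_pos ht0 (x - y)).le
    calc decay t (x - y) ^ 2 ≤ (2 * (1 + ((x - ⌊y⌋).natAbs : ℝ) / t)⁻¹) ^ 2 := by gcongr
      _ = _ := by ring
  have h2 : ∑ x ∈ X, (1 + ((x - ⌊y⌋).natAbs : ℝ) / t)⁻¹ ^ 2 ≤ 2 * (2 * t) := by
    set g : ℕ → ℝ := fun d => (1 + (d : ℝ) / t)⁻¹ ^ 2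
    have hg : ∀ d, 0 ≤ g d := fun d => by positivity
    have : ∀ Y : Finset ℤ, (Set.InjOn (fun x : ℤ => (x - ⌊y⌋).natAbs) Y) →
        ∑ x ∈ Y, g (x - ⌊y⌋).natAbs ≤ 2 * t := by
      intro Y hY
      rw [← Finset.sum_image (f := g) (g := fun x : ℤ => (x - ⌊y⌋).natAbs) hY]
      obtain ⟨N, hN⟩ := (Y.image (fun x : ℤ => (x - ⌊y⌋).natAbs)).exists_nat_subset_range
      exact (Finset.sum_le_sum_of_subset_of_nonneg hN (fun _ _ _ => hg _)).trans
        (sum_range_inv_sq_le ht N)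
    rw [← Finset.sum_filter_add_sum_filter_not X (fun x => ⌊y⌋ ≤ x)]
    have a := this (X.filter (fun x => ⌊y⌋ ≤ x)) (by
      intro a ha b hb hab
      simp only [Finset.coe_filter, Set.mem_ofPred_eq] at ha hb
      dsimp only at hab; omega)
    have b := this (X.filter (fun x => ¬ ⌊y⌋ ≤ x)) (by
      intro a ha b hb hab
      simp only [Finset.coe_filter, Set.mem_ofPred_eq] at ha hb
      dsimp only at hab; omega)
    linarith
  calc _ ≤ ∑ x ∈ X, 4 * (1 + ((x - ⌊y⌋).natAbs : ℝ) / t)⁻¹ ^ 2 := Finset.sum_le_sum h1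
    _ = 4 * ∑ x ∈ X, (1 + ((x - ⌊y⌋).natAbs : ℝ) / t)⁻¹ ^ 2 := by rw [Finset.mul_sum]
    _ ≤ _ := by linarith

lemma sum_decay_pow_le {t : ℝ} (ht : 1 ≤ t) (y : ℝ) (X : Finset ℤ) {k : ℕ} (hk : 2 ≤ k) :
    ∑ x ∈ X, decay t (x - y) ^ k ≤ 16 * t := by
  have ht0 : 0 < t := by linarith
  refine (Finset.sum_le_sum fun x _ => ?_).trans (sum_decay_sq_le ht y X)
  exact pow_le_pow_of_le_one (decay_pos ht0 _).le (decay_le_one ht0 _) hk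

lemma summable_decay_pow {t : ℝ} (ht : 1 ≤ t) (y : ℝ) {k : ℕ} (hk : 2 ≤ k) :
    Summable fun x : ℤ => decay t (x - y) ^ k :=
  summable_of_sum_le (fun x => by have := decay_pos (t := t) (by linarith) (x - y); positivity)
    (fun X => sum_decay_pow_le ht y X hk)

lemma tsum_decay_pow_le {t : ℝ} (ht : 1 ≤ t) (y : ℝ) {k : ℕ} (hk : 2 ≤ k) :
    ∑' x : ℤ, decay t (x - y) ^ k ≤ 16 * t :=
  (summable_decay_pow ht y hk).tsum_le_of_sum_le (fun X => sum_decay_pow_le ht y X hk)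

/-- The dyadic interval `[m 2^k, (m+1) 2^k)` of integers. -/
noncomputable def dyadic (k : ℕ) (m : ℤ) : Finset ℤ := Finset.Ico (m * 2 ^ k) ((m + 1) * 2 ^ k)

lemma mem_dyadic {k : ℕ} {m x : ℤ} : x ∈ dyadic k m ↔ m * 2 ^ k ≤ x ∧ x < (m + 1) * 2 ^ k := by
  simp [dyadic]

lemma card_dyadic (k : ℕ) (m : ℤ) : (dyadic k m).card = 2 ^ k := by
  simp only [dyadic, Int.card_Ico]
  have : (m + 1) * 2 ^ k - m * 2 ^ k = ((2 ^ k : ℕ) : ℤ) := by push_cast; ring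
  rw [this, Int.toNat_natCast]

lemma mem_dyadic_iff_ediv {k : ℕ} {m x : ℤ} : x ∈ dyadic k m ↔ x / 2 ^ k = m := by
  rw [mem_dyadic]
  have h : (0 : ℤ) < 2 ^ k := by positivity
  constructor
  · rintro ⟨h1, h2⟩
    apply le_antisymm
    · exact Int.lt_add_one_iff.mp (Int.ediv_lt_of_lt_mul h h2)
    · exact (Int.le_ediv_iff_mul_le h).mpr h1
  · rintro rfl
    exact ⟨Int.ediv_mul_le x h.ne', Int.lt_ediv_add_one_mul_self x h⟩

lemma dyadic_subset_or_disjoint {j k : ℕ} (h : j ≤ k) (n m : ℤ) :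
    dyadic j n ⊆ dyadic k m ∨ Disjoint (dyadic j n) (dyadic k m) := by
  obtain ⟨i, rfl⟩ := Nat.exists_eq_add_of_le h
  have key : ∀ x ∈ dyadic j n, x / 2 ^ (j + i) = n / 2 ^ i := by
    intro x hx
    rw [mem_dyadic_iff_ediv] at hx
    rw [pow_add, ← hx, Int.ediv_ediv_of_nonneg (by positivity)]
  by_cases hm : n / 2 ^ i = m
  · left
    intro x hx
    rw [mem_dyadic_iff_ediv, key x hx, hm]
  · right
    rw [Finset.disjoint_left]
    intro x hx hx'
    rw [mem_dyadic_iff_ediv, key x hx] at hx'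
    exact hm hx'

/-- A family of time-frequency tiles: the tile `P` occupies the dyadic interval of length
`2 ^ scale P` at position `pos P`, and frequencies near `freq P * 2 ^ (-scale P)`. -/
structure TileSystem (ι : Type*) where
  scale : ι → ℕ
  pos : ι → ℤ
  freq : ι → ℤ
  inj : ∀ P Q, scale P = scale Q → pos P = pos Q → freq P = freq Q → P = Q

/-- The top of a tree: a dyadic interval and a frequency. -/
structure TreeTop where
  scale : ℕ
  pos : ℤ
  freq : ℝ

namespace TileSystem

variable {ι κ : Type*} (𝒯 : TileSystem ι)

/-- The tile system with reflected frequencies. -/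
def reflect : TileSystem ι where
  scale := 𝒯.scale
  pos := 𝒯.pos
  freq P := -𝒯.freq P
  inj P Q h1 h2 h3 := 𝒯.inj P Q h1 h2 (neg_injective h3)

/-- The spatial interval of a tile. -/
noncomputable def interval (P : ι) : Finset ℤ := dyadic (𝒯.scale P) (𝒯.pos P)

/-- The left endpoint of the spatial interval of a tile. -/
noncomputable def left (P : ι) : ℝ := 𝒯.pos P * 2 ^ 𝒯.scale P

/-- Membership of a tile in the tree with top `T`. -/
def InTree (D : ℝ) (T : TreeTop) (P : ι) : Prop :=
  𝒯.scale P ≤ T.scale ∧ 𝒯.interval P ⊆ dyadic T.scale T.pos ∧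
    |T.freq * 2 ^ 𝒯.scale P - 𝒯.freq P| ≤ D

/-- Tiles of a tree whose frequency window `freq P + [lo, hi]` lies to the left of the frequency
of the top. -/
def Lacunary (D hi : ℝ) (T : TreeTop) (P : ι) : Prop :=
  𝒯.InTree D T P ∧ hi + 1 ≤ T.freq * 2 ^ 𝒯.scale P - 𝒯.freq P

/-- The frequency windows of two tiles intersect. -/
def Overlap (lo hi : ℝ) (P Q : ι) : Prop :=
  ∃ w : ℝ, w * 2 ^ 𝒯.scale P - 𝒯.freq P ∈ Icc lo hi ∧ w * 2 ^ 𝒯.scale Q - 𝒯.freq Q ∈ Icc lo hi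

/-- Distinct scales differ by at least `M`. -/
def Sparse (M : ℕ) (𝒬 : Finset ι) : Prop :=
  ∀ P ∈ 𝒬, ∀ Q ∈ 𝒬, 𝒯.scale P < 𝒯.scale Q → 𝒯.scale P + M ≤ 𝒯.scale Q

/-- A strongly disjoint family of lacunary trees. -/
structure IsForest (D hi : ℝ) (F : Finset κ) (top : κ → TreeTop) (R : κ → Finset ι) : Prop where
  lacunary : ∀ T ∈ F, ∀ P ∈ R T, 𝒯.Lacunary D hi (top T) P
  disjoint : ∀ T ∈ F, ∀ T' ∈ F, T ≠ T' → Disjoint (R T) (R T')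
  separated : ∀ T ∈ F, ∀ T' ∈ F, (top T).freq < (top T').freq →
    ∀ Q ∈ R T', ¬ 𝒯.InTree D (top T) Q

variable {𝒯} {D lo hi : ℝ} {M : ℕ}

lemma abs_freq_sub_le_of_overlap {P Q : ι} (hs : 𝒯.scale P = 𝒯.scale Q)
    (h : 𝒯.Overlap lo hi P Q) : |(𝒯.freq P : ℝ) - 𝒯.freq Q| ≤ hi - lo := by
  obtain ⟨w, h1, h2⟩ := h
  rw [← hs] at h2
  rw [abs_le]
  constructor <;> linarith [h1.1, h1.2, h2.1, h2.2]

lemma freq_lt_and_inTree_of_near_overlap (hlo : 1 - D ≤ lo) (hlh : lo ≤ hi) (hhi : hi + 1 ≤ D)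
    (hM : 4 * D < 2 ^ M) {T T' : TreeTop} {P Q : ι} (hP : 𝒯.Lacunary D hi T P)
    (hQ : 𝒯.Lacunary D hi T' Q) (hs : 𝒯.scale Q + M ≤ 𝒯.scale P) {w w' : ℝ}
    (hw : w * 2 ^ 𝒯.scale P - 𝒯.freq P ∈ Icc lo hi)
    (hw' : w' * 2 ^ 𝒯.scale Q - 𝒯.freq Q ∈ Icc lo hi)
    (hww : |w - w'| * 2 ^ 𝒯.scale P ≤ hi - lo) :
    T.freq < T'.freq ∧ |T.freq * 2 ^ 𝒯.scale Q - 𝒯.freq Q| ≤ D := by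
  obtain ⟨⟨-, -, hP3⟩, hP4⟩ := hP
  obtain ⟨⟨-, -, hQ3⟩, hQ4⟩ := hQ
  obtain ⟨i, hi'⟩ := Nat.exists_eq_add_of_le hs
  set a : ℝ := 2 ^ 𝒯.scale P with ha
  set b : ℝ := 2 ^ 𝒯.scale Q with hb
  have hb0 : 0 < b := by positivity
  have ha0 : 0 < a := by positivity
  have hab : 4 * D * b < a := by
    have h1 : a = b * 2 ^ M * 2 ^ i := by rw [ha, hi', pow_add, pow_add]
    have h2 : (1 : ℝ) ≤ 2 ^ i := one_le_pow₀ (by norm_num)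
    have h3 : 0 < b * 2 ^ M := by positivity
    nlinarith
  have hD : 1 ≤ D := by linarith
  rw [abs_le] at hP3 hQ3
  have hww1 : (w - w') * a ≤ hi - lo :=
    (mul_le_mul_of_nonneg_right (le_abs_self _) ha0.le).trans hww
  have hww2 : -(hi - lo) ≤ (w - w') * a := by
    have := mul_le_mul_of_nonneg_right (neg_abs_le (w - w')) ha0.le
    linarith
  have e1 : (T.freq - w') * a < 4 * D := by nlinarith [hP3.2, hw.1]
  have e2 : -(4 * D) < (T.freq - w') * a := by nlinarith [hP4, hw.2]
  have e3 : (T.freq - w') * b < 1 := by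
    by_contra hcon
    push Not at hcon
    have hpos : 0 < T.freq - w' := by
      by_contra h; push Not at h; nlinarith
    nlinarith
  have e4 : -1 < (T.freq - w') * b := by
    by_contra hcon
    push Not at hcon
    have hpos : T.freq - w' < 0 := by
      by_contra h; push Not at h; nlinarith
    nlinarith
  constructor
  · have : 1 ≤ (T'.freq - w') * b := by nlinarith [hw'.2]
    by_contra hcon
    push Not at hcon
    nlinarith
  · rw [abs_le]
    constructor <;> nlinarith [hw'.1, hw'.2]

lemma IsForest.disjoint_of_near_overlap (hlo : 1 - D ≤ lo) (hlh : lo ≤ hi) (hhi : hi + 1 ≤ D)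
    (hM : 4 * D < 2 ^ M) {F : Finset κ} {top : κ → TreeTop} {R : κ → Finset ι}
    (hF : 𝒯.IsForest D hi F top R) {T T' : κ} (hT : T ∈ F) (hT' : T' ∈ F) {P Q : ι}
    (hP : P ∈ R T) (hQ : Q ∈ R T') (hs : 𝒯.scale Q + M ≤ 𝒯.scale P) {w w' : ℝ}
    (hw : w * 2 ^ 𝒯.scale P - 𝒯.freq P ∈ Icc lo hi)
    (hw' : w' * 2 ^ 𝒯.scale Q - 𝒯.freq Q ∈ Icc lo hi)
    (hww : |w - w'| * 2 ^ 𝒯.scale P ≤ hi - lo) :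
    Disjoint (𝒯.interval Q) (dyadic (top T).scale (top T).pos) := by
  obtain ⟨h1, h2⟩ := freq_lt_and_inTree_of_near_overlap hlo hlh hhi hM
    (hF.lacunary T hT P hP) (hF.lacunary T' hT' Q hQ) hs hw hw' hww
  have h3 := hF.separated T hT T' hT' h1 Q hQ
  have hle : 𝒯.scale Q ≤ (top T).scale := by
    have := (hF.lacunary T hT P hP).1.1
    omega
  rcases dyadic_subset_or_disjoint hle (𝒯.pos Q) (top T).pos with h | h
  · exact absurd ⟨hle, h, h2⟩ h3
  · exact h

lemma not_overlap_of_lacunary (hlo : 1 - D ≤ lo) (hlh : lo ≤ hi) (hhi : hi + 1 ≤ D)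
    (hM : 4 * D < 2 ^ M) {T : TreeTop} {P Q : ι} (hP : 𝒯.Lacunary D hi T P)
    (hQ : 𝒯.Lacunary D hi T Q) (hs : 𝒯.scale Q + M ≤ 𝒯.scale P) :
    ¬ 𝒯.Overlap lo hi P Q := by
  rintro ⟨w, h1, h2⟩
  exact lt_irrefl _ (freq_lt_and_inTree_of_near_overlap hlo hlh hhi hM hP hQ hs h1 h2
    (by simpa using hlh)).1

open Classical in
/-- Greedy selection of trees, smallest top frequency first. -/
theorem exists_forest (𝒯 : TileSystem ι) (D hi : ℝ) (Ξ : Finset ℝ) (a : ι → ℝ) {μ : ℝ} (hμ : 0 < μ)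
    (𝒬 : Finset ι) : ∃ F : Finset (TreeTop × Finset ι),
      𝒯.IsForest D hi F Prod.fst Prod.snd ∧
      (∀ T ∈ F, T.1.freq ∈ Ξ ∧ T.2 ⊆ 𝒬 ∧ μ ^ 2 * 2 ^ T.1.scale < ∑ P ∈ T.2, a P ^ 2) ∧
      ∀ T : TreeTop, T.freq ∈ Ξ →
        ∑ P ∈ 𝒬 with (∀ T' ∈ F, ¬ 𝒯.InTree D T'.1 P) ∧ 𝒯.Lacunary D hi T P, a P ^ 2 ≤
          μ ^ 2 * 2 ^ T.scale := by
  induction h : 𝒬.card using Nat.strong_induction_on generalizing 𝒬 with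
  | _ N ih =>
  set V := Ξ.filter (fun ξ => ∃ T : TreeTop, T.freq = ξ ∧
    μ ^ 2 * 2 ^ T.scale < ∑ P ∈ 𝒬 with 𝒯.Lacunary D hi T P, a P ^ 2) with hV
  by_cases hne : V.Nonempty
  · obtain ⟨ξ, hξV, hξmin⟩ := V.exists_min_image id hne
    obtain ⟨hξ, T, hTξ, hT⟩ := Finset.mem_filter.mp hξV
    set R := 𝒬.filter (fun P => 𝒯.Lacunary D hi T P) with hR
    set 𝒬' := 𝒬.filter (fun P => ¬ 𝒯.InTree D T P) with h𝒬'
    have hRne : R.Nonempty := by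
      rw [Finset.nonempty_iff_ne_empty]
      intro h0
      rw [h0, Finset.sum_empty] at hT
      exact absurd hT (not_lt.mpr (by positivity))
    have hcard : 𝒬'.card < N := by
      rw [← h]
      apply Finset.card_lt_card
      refine ⟨Finset.filter_subset _ _, fun hsub => ?_⟩
      obtain ⟨P, hP⟩ := hRne
      have hP' := Finset.mem_filter.mp hP
      exact (Finset.mem_filter.mp (hsub hP'.1)).2 hP'.2.1
    obtain ⟨F, hF, hF2, hF3⟩ := ih _ hcard 𝒬' rfl
    have hnot : ∀ T' ∈ F, ∀ P ∈ T'.2, ¬ 𝒯.InTree D T P := fun T' hT' P hP =>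
      (Finset.mem_filter.mp ((hF2 T' hT').2.1 hP)).2
    have hdis : ∀ T' ∈ F, Disjoint R T'.2 := fun T' hT' => by
      rw [Finset.disjoint_left]
      intro P hP hP'
      exact hnot T' hT' P hP' (Finset.mem_filter.mp hP).2.1
    have hmin : ∀ T' ∈ F, T.freq ≤ T'.1.freq := by
      intro T' hT'
      rw [hTξ]
      apply hξmin
      rw [hV, Finset.mem_filter]
      refine ⟨(hF2 T' hT').1, T'.1, rfl, (hF2 T' hT').2.2.trans_le ?_⟩
      apply Finset.sum_le_sum_of_subset_of_nonneg
      · intro P hP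
        rw [Finset.mem_filter]
        exact ⟨(Finset.mem_filter.mp ((hF2 T' hT').2.1 hP)).1, hF.lacunary T' hT' P hP⟩
      · intros; positivity
    refine ⟨insert (T, R) F, ⟨?_, ?_, ?_⟩, ?_, ?_⟩
    · intro T' hT' P hP
      rcases Finset.mem_insert.mp hT' with rfl | hT'
      · exact (Finset.mem_filter.mp hP).2
      · exact hF.lacunary T' hT' P hP
    · intro T₁ h₁ T₂ h₂ hneq
      rcases Finset.mem_insert.mp h₁ with rfl | h₁ <;> rcases Finset.mem_insert.mp h₂ with rfl | h₂
      · exact absurd rfl hneq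
      · exact hdis _ h₂
      · exact (hdis _ h₁).symm
      · exact hF.disjoint _ h₁ _ h₂ hneq
    · intro T₁ h₁ T₂ h₂ hlt
      rcases Finset.mem_insert.mp h₁ with rfl | h₁ <;> rcases Finset.mem_insert.mp h₂ with rfl | h₂
      · exact absurd hlt (lt_irrefl _)
      · exact hnot _ h₂
      · exact absurd hlt (not_lt.mpr (hmin _ h₁))
      · exact hF.separated _ h₁ _ h₂ hlt
    · intro T' hT'
      rcases Finset.mem_insert.mp hT' with rfl | hT'
      · exact ⟨hTξ ▸ hξ, Finset.filter_subset _ _, hT⟩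
      · exact ⟨(hF2 T' hT').1, (hF2 T' hT').2.1.trans (Finset.filter_subset _ _), (hF2 T' hT').2.2⟩
    · intro T' hT'
      refine le_trans (le_of_eq ?_) (hF3 T' hT')
      apply Finset.sum_congr _ (fun _ _ => rfl)
      ext P
      simp only [h𝒬', Finset.mem_filter, Finset.forall_mem_insert]
      tauto
  · refine ⟨∅, ⟨by simp, by simp, by simp⟩, by simp, fun T hT => ?_⟩
    by_contra hcon
    push Not at hcon
    apply hne
    refine ⟨T.freq, Finset.mem_filter.mpr ⟨hT, T, rfl, ?_⟩⟩
    simpa using hcon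

end TileSystem

lemma card_le_of_pairwise_abs_sub_le {r : ℝ} (hr : 0 ≤ r) (Y : Finset ℤ)
    (h : ∀ a ∈ Y, ∀ b ∈ Y, |(a : ℝ) - b| ≤ r) : (Y.card : ℝ) ≤ 2 * r + 1 := by
  rcases Y.eq_empty_or_nonempty with rfl | ⟨c, hc⟩
  · simp; positivity
  have hsub : Y ⊆ Finset.Icc (c - ⌊r⌋) (c + ⌊r⌋) := by
    intro a ha
    have h1 : |a - c| ≤ ⌊r⌋ := by
      apply Int.le_floor.mpr
      push_cast
      exact h a ha c hc
    rw [abs_le] at h1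
    rw [Finset.mem_Icc]
    constructor <;> linarith [h1.1, h1.2]
  have h0 : 0 ≤ ⌊r⌋ := Int.floor_nonneg.mpr hr
  have h1 := Finset.card_le_card hsub
  rw [Int.card_Icc] at h1
  have h2 : ((c + ⌊r⌋ + 1 - (c - ⌊r⌋)).toNat : ℤ) = 2 * ⌊r⌋ + 1 := by
    rw [Int.toNat_of_nonneg (by linarith)]; ring
  have h3 : (Y.card : ℤ) ≤ 2 * ⌊r⌋ + 1 := by rw [← h2]; exact_mod_cast h1
  have h4 : (Y.card : ℝ) ≤ 2 * (⌊r⌋ : ℝ) + 1 := by exact_mod_cast h3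
  linarith [Int.floor_le r]

namespace TileSystem

variable {ι κ : Type*} {𝒯 : TileSystem ι} {D lo hi : ℝ} {M : ℕ}

lemma card_le_of_freq_near {r : ℝ} (hr : 0 ≤ r) {𝒬 : Finset ι} {k : ℕ} {n : ℤ}
    (hs : ∀ Q ∈ 𝒬, 𝒯.scale Q = k) (hn : ∀ Q ∈ 𝒬, 𝒯.pos Q = n)
    (hf : ∀ Q ∈ 𝒬, ∀ Q' ∈ 𝒬, |(𝒯.freq Q : ℝ) - 𝒯.freq Q'| ≤ r) :
    (𝒬.card : ℝ) ≤ 2 * r + 1 := by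
  classical
  rw [← Finset.card_image_of_injOn (f := 𝒯.freq) (s := 𝒬)]
  · apply card_le_of_pairwise_abs_sub_le hr
    intro a ha b hb
    obtain ⟨Q, hQ, rfl⟩ := Finset.mem_image.mp ha
    obtain ⟨Q', hQ', rfl⟩ := Finset.mem_image.mp hb
    exact hf Q hQ Q' hQ'
  · intro Q hQ Q' hQ' h
    exact 𝒯.inj Q Q' ((hs Q hQ).trans (hs Q' hQ').symm) ((hn Q hQ).trans (hn Q' hQ').symm) h

open Classical in
lemma sum_pos_le_of_scale_eq {r : ℝ} (hr : 0 ≤ r) {𝒬 : Finset ι} {k : ℕ}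
    (hs : ∀ Q ∈ 𝒬, 𝒯.scale Q = k)
    (hf : ∀ Q ∈ 𝒬, ∀ Q' ∈ 𝒬, 𝒯.pos Q = 𝒯.pos Q' → |(𝒯.freq Q : ℝ) - 𝒯.freq Q'| ≤ r)
    {g : ℤ → ℝ} (hg : ∀ n, 0 ≤ g n) :
    ∑ Q ∈ 𝒬, g (𝒯.pos Q) ≤ (2 * r + 1) * ∑ n ∈ 𝒬.image 𝒯.pos, g n := by
  rw [← Finset.sum_fiberwise_of_maps_to (t := 𝒬.image 𝒯.pos) (g := 𝒯.pos)
    (fun Q hQ => Finset.mem_image_of_mem _ hQ), Finset.mul_sum]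
  refine Finset.sum_le_sum fun n _ => ?_
  rw [Finset.sum_congr rfl (g := fun _ => g n) (fun Q hQ => by rw [(Finset.mem_filter.mp hQ).2]),
    Finset.sum_const, nsmul_eq_mul]
  refine mul_le_mul_of_nonneg_right ?_ (hg n)
  apply card_le_of_freq_near hr (𝒯 := 𝒯) (k := k) (n := n)
  · exact fun Q hQ => hs Q (Finset.mem_filter.mp hQ).1
  · exact fun Q hQ => (Finset.mem_filter.mp hQ).2
  · intro Q hQ Q' hQ'
    rw [Finset.mem_filter] at hQ hQ'
    exact hf Q hQ.1 Q' hQ'.1 (hQ.2.trans hQ'.2.symm)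

variable (𝒯) in
/-- Functions `φ P` on `ℤ` adapted in space to the interval of the tile `P`, and orthogonal
when the frequency windows are disjoint. -/
structure IsPacketFamily (lo hi K : ℝ) (φ : ι → ℤ → ℂ) : Prop where
  bound : ∀ P x, ‖φ P x‖ ≤
    K * (√(2 ^ 𝒯.scale P))⁻¹ * decay (2 ^ 𝒯.scale P) (x - 𝒯.left P) ^ 6
  orthogonal : ∀ P Q, ¬ 𝒯.Overlap lo hi P Q →
    ∑' x : ℤ, φ P x * (starRingEnd ℂ) (φ Q x) = 0

/-- The Gram matrix of a family of functions on `ℤ`. -/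
noncomputable def gram (φ : ι → ℤ → ℂ) (P Q : ι) : ℂ := ∑' x : ℤ, φ P x * (starRingEnd ℂ) (φ Q x)

variable {K : ℝ} {φ : ι → ℤ → ℂ}

lemma one_le_two_pow_real (k : ℕ) : (1 : ℝ) ≤ 2 ^ k := one_le_pow₀ (by norm_num)

lemma IsPacketFamily.nonneg (h : 𝒯.IsPacketFamily lo hi K φ) [Nonempty ι] : 0 ≤ K := by
  obtain ⟨P⟩ := ‹Nonempty ι›
  have h1 := (norm_nonneg _).trans (h.bound P 0)
  have h2 : 0 < (√(2 ^ 𝒯.scale P))⁻¹ * decay (2 ^ 𝒯.scale P) (((0 : ℤ) : ℝ) - 𝒯.left P) ^ 6 := by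
    have := decay_pos (t := 2 ^ 𝒯.scale P) (by positivity) (((0 : ℤ) : ℝ) - 𝒯.left P)
    positivity
  rw [mul_assoc] at h1
  exact nonneg_of_mul_nonneg_left h1 h2

lemma IsPacketFamily.norm_mul_le (h : 𝒯.IsPacketFamily lo hi K φ) {P Q : ι}
    (hs : 𝒯.scale Q ≤ 𝒯.scale P) (x : ℤ) :
    ‖φ P x * (starRingEnd ℂ) (φ Q x)‖ ≤
      K ^ 2 * (√(2 ^ 𝒯.scale P))⁻¹ * (√(2 ^ 𝒯.scale Q))⁻¹ *
        decay (2 ^ 𝒯.scale P) (𝒯.left P - 𝒯.left Q) ^ 4 *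
          decay (2 ^ 𝒯.scale Q) (x - 𝒯.left Q) ^ 2 := by
  have : Nonempty ι := ⟨P⟩
  have hK := h.nonneg
  rw [norm_mul, RCLike.norm_conj]
  set a : ℝ := 2 ^ 𝒯.scale P
  set b : ℝ := 2 ^ 𝒯.scale Q
  have hb : 0 < b := by positivity
  have hba : b ≤ a := pow_le_pow_right₀ (by norm_num) hs
  have ha : 0 < a := by positivity
  set u := decay a (x - 𝒯.left P)
  set v := decay b (x - 𝒯.left Q)
  have hu := decay_pos ha (x - 𝒯.left P)
  have hv := decay_pos hb (x - 𝒯.left Q)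
  have huv : u * v ≤ decay a (𝒯.left P - 𝒯.left Q) := by
    have := decay_mul_decay_le hb hba (𝒯.left P - x) (x - 𝒯.left Q)
    rwa [sub_add_sub_cancel, decay_sub_comm a] at this
  have hu6 : u ^ 6 ≤ u ^ 4 := pow_le_pow_of_le_one hu.le (decay_le_one ha _) (by norm_num)
  calc ‖φ P x‖ * ‖φ Q x‖ ≤ (K * (√a)⁻¹ * u ^ 6) * (K * (√b)⁻¹ * v ^ 6) := by
        gcongr
        · exact h.bound P x
        · exact h.bound Q x
    _ ≤ (K * (√a)⁻¹ * u ^ 4) * (K * (√b)⁻¹ * v ^ 6) := by gcongr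
    _ = K ^ 2 * (√a)⁻¹ * (√b)⁻¹ * (u * v) ^ 4 * v ^ 2 := by ring
    _ ≤ _ := by gcongr

lemma IsPacketFamily.summable_of_le (h : 𝒯.IsPacketFamily lo hi K φ) {P Q : ι}
    (hs : 𝒯.scale Q ≤ 𝒯.scale P) : Summable fun x : ℤ => φ P x * (starRingEnd ℂ) (φ Q x) := by
  refine Summable.of_norm_bounded ?_ (h.norm_mul_le hs)
  exact (summable_decay_pow (one_le_two_pow_real _) _ le_rfl).mul_left _

lemma IsPacketFamily.summable (h : 𝒯.IsPacketFamily lo hi K φ) (P Q : ι) :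
    Summable fun x : ℤ => φ P x * (starRingEnd ℂ) (φ Q x) := by
  rcases le_total (𝒯.scale Q) (𝒯.scale P) with hs | hs
  · exact h.summable_of_le hs
  · have := (h.summable_of_le hs).star
    refine this.congr fun x => ?_
    simp [mul_comm]

lemma norm_gram_comm (P Q : ι) : ‖gram φ P Q‖ = ‖gram φ Q P‖ := by
  unfold gram
  rw [← norm_star, tsum_star]
  simp [mul_comm]

lemma IsPacketFamily.norm_gram_le (h : 𝒯.IsPacketFamily lo hi K φ) {P Q : ι}
    (hs : 𝒯.scale Q ≤ 𝒯.scale P) :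
    ‖gram φ P Q‖ ≤ 16 * K ^ 2 * (√(2 ^ 𝒯.scale Q) / √(2 ^ 𝒯.scale P)) *
      decay (2 ^ 𝒯.scale P) (𝒯.left P - 𝒯.left Q) ^ 4 := by
  have hsum := (summable_decay_pow (one_le_two_pow_real (𝒯.scale Q)) (𝒯.left Q) le_rfl)
  refine (tsum_of_norm_bounded (hsum.hasSum.mul_left _) (h.norm_mul_le hs)).trans ?_
  have h1 := tsum_decay_pow_le (one_le_two_pow_real (𝒯.scale Q)) (𝒯.left Q) le_rfl
  set a : ℝ := 2 ^ 𝒯.scale P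
  set b : ℝ := 2 ^ 𝒯.scale Q
  have hb : 0 < b := by positivity
  have ha : 0 < a := by positivity
  have hd := decay_pos ha (𝒯.left P - 𝒯.left Q)
  calc _ ≤ K ^ 2 * (√a)⁻¹ * (√b)⁻¹ * decay a (𝒯.left P - 𝒯.left Q) ^ 4 * (16 * b) := by gcongr
    _ = K ^ 2 * (√a)⁻¹ * ((√b)⁻¹ * (√b * √b)) * decay a (𝒯.left P - 𝒯.left Q) ^ 4 * 16 := by
      rw [Real.mul_self_sqrt hb.le]; ring
    _ = _ := by
      have : √b ≠ 0 := by positivity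
      field_simp

section coefficients

variable {H : Type*} [NormedAddCommGroup H] [InnerProductSpace ℂ H]

/-- The coefficient of the vector-valued sequence `A` on `X` against `φ P`. -/
noncomputable def coef (φ : ι → ℤ → ℂ) (X : Finset ℤ) (A : ℤ → H) (P : ι) : H :=
  ∑ x ∈ X, φ P x • A x

lemma norm_sq_sum_smul (𝒬 : Finset ι) (c : ι → ℂ) (v : ι → H) :
    ((‖∑ P ∈ 𝒬, (starRingEnd ℂ) (c P) • v P‖ ^ 2 : ℝ) : ℂ) =
      ∑ P ∈ 𝒬, ∑ Q ∈ 𝒬, (c P * (starRingEnd ℂ) (c Q)) * inner ℂ (v P) (v Q) := by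
  have := inner_self_eq_norm_sq_to_K (𝕜 := ℂ) (∑ P ∈ 𝒬, (starRingEnd ℂ) (c P) • v P)
  push_cast
  rw [← Complex.coe_algebraMap] at *
  rw [← this, sum_inner]
  refine Finset.sum_congr rfl fun P _ => ?_
  rw [inner_sum]
  refine Finset.sum_congr rfl fun Q _ => ?_
  rw [inner_smul_left, inner_smul_right]
  simp; ring

/-- Duality: a bound for the Gram form gives a Bessel inequality. -/
theorem IsPacketFamily.sum_coef_sq_le (h : 𝒯.IsPacketFamily lo hi K φ) (𝒬 : Finset ι)
    (X : Finset ℤ) (A : ℤ → H) {B : ℝ} (hB0 : 0 ≤ B)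
    (hB : ∑ P ∈ 𝒬, ∑ Q ∈ 𝒬, ‖coef φ X A P‖ * ‖coef φ X A Q‖ * ‖gram φ P Q‖ ≤
      B * ∑ P ∈ 𝒬, ‖coef φ X A P‖ ^ 2) :
    ∑ P ∈ 𝒬, ‖coef φ X A P‖ ^ 2 ≤ B * ∑ x ∈ X, ‖A x‖ ^ 2 := by
  set v := coef φ X A with hv
  set S := ∑ P ∈ 𝒬, ‖v P‖ ^ 2 with hS
  set G : ℤ → H := fun x => ∑ P ∈ 𝒬, (starRingEnd ℂ) (φ P x) • v P with hG
  have hS0 : 0 ≤ S := Finset.sum_nonneg fun _ _ => by positivity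
  have h1 : (S : ℂ) = ∑ x ∈ X, inner ℂ (G x) (A x) := by
    simp only [hG, sum_inner, inner_smul_left, Complex.conj_conj]
    rw [Finset.sum_comm, hS]
    push_cast
    refine Finset.sum_congr rfl fun P _ => ?_
    have := inner_self_eq_norm_sq_to_K (𝕜 := ℂ) (v P)
    rw [← Complex.coe_algebraMap] at *
    rw [← this]
    conv_lhs => rw [hv]; unfold coef
    rw [inner_sum]
    refine Finset.sum_congr rfl fun x _ => ?_
    rw [inner_smul_right]
    rfl
  have h2 : S ≤ ∑ x ∈ X, ‖G x‖ * ‖A x‖ := by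
    have : S = ‖(S : ℂ)‖ := by simp [abs_of_nonneg hS0]
    rw [this, h1]
    exact (norm_sum_le _ _).trans (Finset.sum_le_sum fun x _ => norm_inner_le_norm _ _)
  have h3 : S ^ 2 ≤ (∑ x ∈ X, ‖G x‖ ^ 2) * ∑ x ∈ X, ‖A x‖ ^ 2 :=
    (pow_le_pow_left₀ hS0 h2 2).trans (Finset.sum_mul_sq_le_sq_mul_sq X _ _)
  have hsumG : HasSum (fun x => ((‖G x‖ ^ 2 : ℝ) : ℂ))
      (∑ P ∈ 𝒬, ∑ Q ∈ 𝒬, gram φ P Q * inner ℂ (v P) (v Q)) := by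
    simp only [hG, norm_sq_sum_smul]
    refine hasSum_sum fun P _ => hasSum_sum fun Q _ => ?_
    exact (h.summable P Q).hasSum.mul_right _
  have hsumG' : Summable fun x => ‖G x‖ ^ 2 := by
    have := hsumG.summable
    exact_mod_cast this
  have h4 : ∑ x ∈ X, ‖G x‖ ^ 2 ≤ B * S := by
    calc ∑ x ∈ X, ‖G x‖ ^ 2 ≤ ∑' x, ‖G x‖ ^ 2 :=
          hsumG'.sum_le_tsum X (fun _ _ => by positivity)
      _ ≤ ‖((∑' x, ‖G x‖ ^ 2 : ℝ) : ℂ)‖ := by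
          rw [Complex.norm_real]; exact le_abs_self _
      _ = ‖∑ P ∈ 𝒬, ∑ Q ∈ 𝒬, gram φ P Q * inner ℂ (v P) (v Q)‖ := by
          rw [Complex.ofReal_tsum, hsumG.tsum_eq]
      _ ≤ ∑ P ∈ 𝒬, ∑ Q ∈ 𝒬, ‖v P‖ * ‖v Q‖ * ‖gram φ P Q‖ := by
          refine (norm_sum_le _ _).trans (Finset.sum_le_sum fun P _ => ?_)
          refine (norm_sum_le _ _).trans (Finset.sum_le_sum fun Q _ => ?_)
          rw [norm_mul, mul_comm]
          exact mul_le_mul_of_nonneg_right (norm_inner_le_norm _ _) (norm_nonneg _)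
      _ ≤ B * S := hB
  have hE : 0 ≤ ∑ x ∈ X, ‖A x‖ ^ 2 := Finset.sum_nonneg fun _ _ => by positivity
  have h5 : S * S ≤ S * (B * ∑ x ∈ X, ‖A x‖ ^ 2) := by nlinarith
  rcases hS0.eq_or_lt with h0 | h0
  · rw [← h0]; positivity
  · exact le_of_mul_le_mul_left h5 h0

end coefficients

end TileSystem

lemma decay_mul_self {t : ℝ} (ht : 0 < t) (x : ℝ) : decay t (x * t) = decay 1 x := by
  unfold decay
  rw [abs_mul, abs_of_pos ht, mul_div_assoc, div_self ht.ne', mul_one, div_one]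

lemma decay_anti {t : ℝ} (ht : 0 < t) {x y : ℝ} (h : |x| ≤ |y|) : decay t y ≤ decay t x := by
  unfold decay
  gcongr

lemma decay_pow_four_le {t : ℝ} (ht : 0 < t) {x y z : ℝ} (h1 : |x| ≤ |z|) (h2 : |y| ≤ |z|) :
    decay t z ^ 4 ≤ decay t x ^ 2 * decay t y ^ 2 := by
  have hz := (decay_pos ht z).le
  calc decay t z ^ 4 = decay t z ^ 2 * decay t z ^ 2 := by ring
    _ ≤ _ := by
      gcongr
      · exact decay_anti ht h1
      · exact decay_anti ht h2

lemma sum_decay_one_sq_le (k : ℕ) (a : ℝ) (Y : Finset ℤ) :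
    ∑ n ∈ Y, decay (2 ^ k) (a - n * 2 ^ k) ^ 2 ≤ 16 := by
  have h := sum_decay_sq_le (t := 1) le_rfl (a / 2 ^ k) Y
  rw [mul_one] at h
  refine le_trans (Finset.sum_le_sum fun n _ => ?_) h
  rw [decay_sub_comm, ← decay_mul_self (t := 2 ^ k) (by positivity), sub_mul,
    div_mul_cancel₀ _ (by positivity)]

lemma sum_decay_outside_le (k : ℕ) {a b : ℝ} {X Y : Finset ℤ}
    (hX : ∀ x ∈ X, (x : ℝ) ≤ a ∨ b ≤ x) (hY : ∀ n ∈ Y, a ≤ (n : ℝ) * 2 ^ k ∧ (n : ℝ) * 2 ^ k ≤ b) :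
    ∑ n ∈ Y, ∑ x ∈ X, decay (2 ^ k) (x - n * 2 ^ k) ^ 4 ≤ 512 * 2 ^ k := by
  set t : ℝ := 2 ^ k
  have ht : 0 < t := by positivity
  have key : ∀ n ∈ Y, ∀ x ∈ X, decay t (x - n * t) ^ 4 ≤
      decay t (x - a) ^ 2 * decay t (a - n * t) ^ 2 +
        decay t (x - b) ^ 2 * decay t (b - n * t) ^ 2 := by
    intro n hn x hx
    obtain ⟨h1, h2⟩ := hY n hn
    rcases hX x hx with h | h
    · refine le_add_of_le_of_nonneg (decay_pow_four_le ht ?_ ?_) (by positivity)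
      · rw [abs_of_nonpos (by linarith), abs_of_nonpos (by linarith)]; linarith
      · rw [abs_of_nonpos (by linarith), abs_of_nonpos (by linarith)]; linarith
    · refine le_add_of_nonneg_of_le (by positivity) (decay_pow_four_le ht ?_ ?_)
      · rw [abs_of_nonneg (by linarith), abs_of_nonneg (by linarith)]; linarith
      · rw [abs_of_nonneg (by linarith), abs_of_nonneg (by linarith)]; linarith
  have hprod : ∀ c : ℝ, ∑ n ∈ Y, ∑ x ∈ X, decay t (x - c) ^ 2 * decay t (c - n * t) ^ 2 ≤
      256 * t := by
    intro c
    have h1 := sum_decay_sq_le (t := t) (TileSystem.one_le_two_pow_real k) c X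
    have h2 := sum_decay_one_sq_le k c Y
    calc _ = (∑ x ∈ X, decay t (x - c) ^ 2) * ∑ n ∈ Y, decay t (c - n * t) ^ 2 := by
          rw [Finset.sum_mul_sum, Finset.sum_comm]
      _ ≤ (16 * t) * 16 := by gcongr
      _ = _ := by ring
  calc _ ≤ ∑ n ∈ Y, ∑ x ∈ X, (decay t (x - a) ^ 2 * decay t (a - n * t) ^ 2 +
        decay t (x - b) ^ 2 * decay t (b - n * t) ^ 2) :=
        Finset.sum_le_sum fun n hn => Finset.sum_le_sum fun x hx => key n hn x hx
    _ ≤ 256 * t + 256 * t := by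
      simp only [Finset.sum_add_distrib]
      exact add_le_add (hprod a) (hprod b)
    _ = _ := by ring

namespace TileSystem

variable {ι κ : Type*} {𝒯 : TileSystem ι} {D lo hi : ℝ} {M : ℕ} {K : ℝ} {φ : ι → ℤ → ℂ}

lemma left_mem_interval (P : ι) : 𝒯.pos P * 2 ^ 𝒯.scale P ∈ 𝒯.interval P := by
  rw [interval, mem_dyadic]
  refine ⟨le_rfl, ?_⟩
  have : (0 : ℤ) < 2 ^ 𝒯.scale P := by positivity
  linarith

lemma sum_two_pow_le {S : Finset ℕ} {N : ℕ} (h : ∀ k ∈ S, k ≤ N) :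
    ∑ k ∈ S, (2 : ℝ) ^ k ≤ 2 * 2 ^ N := by
  calc ∑ k ∈ S, (2 : ℝ) ^ k ≤ ∑ k ∈ Finset.range (N + 1), (2 : ℝ) ^ k :=
        Finset.sum_le_sum_of_subset_of_nonneg
          (fun k hk => Finset.mem_range.mpr (by have := h k hk; omega)) (fun _ _ _ => by positivity)
    _ = 2 * 2 ^ N - 1 := by rw [geom_sum_eq (by norm_num)]; ring
    _ ≤ _ := by linarith

open Classical in
/-- Grouping the tiles of a tree by scale. -/
lemma sum_tree_le {T : TreeTop} {𝒬 : Finset ι} (hD : 0 ≤ D) (h : ∀ P ∈ 𝒬, 𝒯.InTree D T P)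
    {g : ℕ → ℤ → ℝ} (hg : ∀ k n, 0 ≤ g k n) {c : ℝ} (hc : 0 ≤ c)
    (hsum : ∀ k : ℕ, ∀ Y : Finset ℤ, (∀ n ∈ Y, k ≤ T.scale ∧ dyadic k n ⊆ dyadic T.scale T.pos) →
      ∑ n ∈ Y, g k n ≤ c * 2 ^ k) :
    ∑ P ∈ 𝒬, g (𝒯.scale P) (𝒯.pos P) ≤ (4 * D + 1) * c * (2 * 2 ^ T.scale) := by
  rw [← Finset.sum_fiberwise_of_maps_to (t := 𝒬.image 𝒯.scale) (g := 𝒯.scale)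
    (fun Q hQ => Finset.mem_image_of_mem _ hQ)]
  calc _ ≤ ∑ k ∈ 𝒬.image 𝒯.scale, (4 * D + 1) * (c * 2 ^ k) := by
        refine Finset.sum_le_sum fun k _ => ?_
        rw [Finset.sum_congr rfl (g := fun P => g k (𝒯.pos P))
          (fun Q hQ => by rw [(Finset.mem_filter.mp hQ).2])]
        refine (sum_pos_le_of_scale_eq (r := 2 * D) (by linarith) (k := k)
          (fun Q hQ => (Finset.mem_filter.mp hQ).2) ?_ (hg k)).trans ?_
        · intro Q hQ Q' hQ' _
          rw [Finset.mem_filter] at hQ hQ'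
          have h1 := (h Q hQ.1).2.2
          have h2 := (h Q' hQ'.1).2.2
          rw [hQ.2] at h1
          rw [hQ'.2] at h2
          rw [abs_le] at *
          constructor <;> linarith [h1.1, h1.2, h2.1, h2.2]
        · rw [show 2 * (2 * D) + 1 = 4 * D + 1 by ring]
          refine mul_le_mul_of_nonneg_left (hsum k _ ?_) (by linarith)
          intro n hn
          obtain ⟨P, hP, rfl⟩ := Finset.mem_image.mp hn
          rw [Finset.mem_filter] at hP
          obtain ⟨hP, rfl⟩ := hP
          exact ⟨(h P hP).1, (h P hP).2.1⟩
    _ = (4 * D + 1) * c * ∑ k ∈ 𝒬.image 𝒯.scale, 2 ^ k := by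
        rw [Finset.mul_sum]; exact Finset.sum_congr rfl fun _ _ => by ring
    _ ≤ _ := by
        refine mul_le_mul_of_nonneg_left (sum_two_pow_le ?_) (by positivity)
        intro k hk
        obtain ⟨P, hP, rfl⟩ := Finset.mem_image.mp hk
        exact (h P hP).1

lemma sum_tree_decay_le {T : TreeTop} {𝒬 : Finset ι} (hD : 0 ≤ D)
    (h : ∀ P ∈ 𝒬, 𝒯.InTree D T P) {X : Finset ℤ} (hX : Disjoint X (dyadic T.scale T.pos)) :
    ∑ P ∈ 𝒬, ∑ x ∈ X, decay (2 ^ 𝒯.scale P) (x - 𝒯.left P) ^ 4 ≤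
      (4 * D + 1) * 512 * (2 * 2 ^ T.scale) := by
  refine sum_tree_le hD h (g := fun k n => ∑ x ∈ X, decay (2 ^ k) (x - n * 2 ^ k) ^ 4)
    (fun k n => Finset.sum_nonneg fun _ _ => by positivity) (by norm_num) ?_
  intro k Y hY
  refine sum_decay_outside_le k (a := (T.pos * 2 ^ T.scale : ℤ))
    (b := ((T.pos + 1) * 2 ^ T.scale : ℤ)) ?_ ?_
  · intro x hx
    have := Finset.disjoint_left.mp hX hx
    rw [mem_dyadic] at this
    rw [Int.cast_le, Int.cast_le]
    omega
  · intro n hn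
    have h1 : n * 2 ^ k ∈ dyadic k n := by
      rw [mem_dyadic]
      have : (0 : ℤ) < 2 ^ k := by positivity
      exact ⟨le_rfl, by linarith⟩
    have h2 := (hY n hn).2 h1
    rw [mem_dyadic] at h2
    norm_cast
    exact ⟨h2.1, h2.2.le⟩

lemma two_pow_mul_decay_le {P Q : ι} (hs : 𝒯.scale Q ≤ 𝒯.scale P) :
    2 ^ 𝒯.scale Q * decay (2 ^ 𝒯.scale P) (𝒯.left P - 𝒯.left Q) ^ 4 ≤
      16 * ∑ x ∈ 𝒯.interval Q, decay (2 ^ 𝒯.scale P) (x - 𝒯.left P) ^ 4 := by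
  have hcard : (2 : ℝ) ^ 𝒯.scale Q = (𝒯.interval Q).card := by
    rw [interval, card_dyadic]; push_cast; rfl
  rw [hcard, ← nsmul_eq_mul, ← Finset.sum_const, Finset.mul_sum]
  refine Finset.sum_le_sum fun x hx => ?_
  rw [interval, mem_dyadic] at hx
  have ht : (0 : ℝ) < 2 ^ 𝒯.scale P := by positivity
  have hle : (2 : ℝ) ^ 𝒯.scale Q ≤ 2 ^ 𝒯.scale P := pow_le_pow_right₀ (by norm_num) hs
  have h1 : 𝒯.left Q ≤ x := by unfold left; exact_mod_cast hx.1
  have h2 : (x : ℝ) < 𝒯.left Q + 2 ^ 𝒯.scale Q := by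
    have : (x : ℝ) < (𝒯.pos Q + 1) * 2 ^ 𝒯.scale Q := by exact_mod_cast hx.2
    unfold left; linarith
  have := decay_le_two_mul ht (x := 𝒯.left P - 𝒯.left Q) (y := 𝒯.left P - x)
    (by rw [abs_le]; constructor <;> linarith)
  rw [decay_sub_comm _ (𝒯.left P) x] at this
  calc _ ≤ (2 * decay (2 ^ 𝒯.scale P) (x - 𝒯.left P)) ^ 4 := by
        gcongr; exact (decay_pos ht _).le
    _ = _ := by ring

open Classical in
lemma IsForest.sum_interval_le (hlo : 1 - D ≤ lo) (hlh : lo ≤ hi) (hhi : hi + 1 ≤ D)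
    (hM : 4 * D < 2 ^ M) {F : Finset κ} {top : κ → TreeTop} {R : κ → Finset ι}
    (hF : 𝒯.IsForest D hi F top R) (hsp : 𝒯.Sparse M (F.biUnion R)) {P : ι} {𝒰 : Finset ι}
    (h𝒰 : ∀ Q ∈ 𝒰, Q ∈ F.biUnion R ∧ 𝒯.scale Q ≤ 𝒯.scale P ∧ 𝒯.Overlap lo hi P Q)
    {h : ℤ → ℝ} (hh : ∀ x, 0 ≤ h x) :
    ∑ Q ∈ 𝒰, ∑ x ∈ 𝒯.interval Q, h x ≤
      (4 * (hi - lo) + 1) * ∑ x ∈ 𝒰.biUnion 𝒯.interval, h x := by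
  set X := 𝒰.biUnion 𝒯.interval with hX
  have h1 : ∑ Q ∈ 𝒰, ∑ x ∈ 𝒯.interval Q, h x =
      ∑ x ∈ X, ((𝒰.filter (fun Q => x ∈ 𝒯.interval Q)).card : ℝ) * h x := by
    calc _ = ∑ Q ∈ 𝒰, ∑ x ∈ X, if x ∈ 𝒯.interval Q then h x else 0 := by
          refine Finset.sum_congr rfl fun Q hQ => ?_
          rw [← Finset.sum_filter]
          refine Finset.sum_congr ?_ fun _ _ => rfl
          ext x
          simp only [hX, Finset.mem_filter, Finset.mem_biUnion]
          exact ⟨fun hx => ⟨⟨Q, hQ, hx⟩, hx⟩, fun hx => hx.2⟩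
      _ = _ := by
          rw [Finset.sum_comm]
          refine Finset.sum_congr rfl fun x _ => ?_
          rw [← Finset.sum_filter, Finset.sum_const, nsmul_eq_mul]
  rw [h1, Finset.mul_sum]
  refine Finset.sum_le_sum fun x hx => mul_le_mul_of_nonneg_right ?_ (hh x)
  set 𝒱 := 𝒰.filter (fun Q => x ∈ 𝒯.interval Q) with h𝒱
  rcases 𝒱.eq_empty_or_nonempty with h0 | ⟨Q₀, hQ₀⟩
  · rw [h0]; simp; linarith
  have near : ∀ Q ∈ 𝒱, ∀ Q' ∈ 𝒱, ∃ w w' : ℝ, w * 2 ^ 𝒯.scale Q - 𝒯.freq Q ∈ Icc lo hi ∧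
      w' * 2 ^ 𝒯.scale Q' - 𝒯.freq Q' ∈ Icc lo hi ∧ |w - w'| * 2 ^ 𝒯.scale Q ≤ hi - lo := by
    intro Q hQ Q' hQ'
    obtain ⟨-, hs, w, hw1, hw2⟩ := h𝒰 Q (Finset.mem_filter.mp hQ).1
    obtain ⟨-, -, w', hw1', hw2'⟩ := h𝒰 Q' (Finset.mem_filter.mp hQ').1
    refine ⟨w, w', hw2, hw2', ?_⟩
    calc |w - w'| * 2 ^ 𝒯.scale Q ≤ |w - w'| * 2 ^ 𝒯.scale P := by gcongr; norm_num
      _ = |w * 2 ^ 𝒯.scale P - w' * 2 ^ 𝒯.scale P| := by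
        rw [← sub_mul, abs_mul, abs_of_pos (a := (2 : ℝ) ^ 𝒯.scale P) (by positivity)]
      _ ≤ hi - lo := by
        rw [abs_le]; constructor <;> linarith [hw1.1, hw1.2, hw1'.1, hw1'.2]
  have not_lt' : ∀ Q ∈ 𝒱, ∀ Q' ∈ 𝒱, ¬ 𝒯.scale Q' < 𝒯.scale Q := by
    intro Q hQ Q' hQ' hlt
    obtain ⟨w, w', h1, h2, h3⟩ := near Q hQ Q' hQ'
    rw [h𝒱, Finset.mem_filter] at hQ hQ'
    have hm := (h𝒰 Q hQ.1).1
    have hm' := (h𝒰 Q' hQ'.1).1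
    have hs := hsp Q' hm' Q hm hlt
    obtain ⟨T, hT, hQT⟩ := Finset.mem_biUnion.mp hm
    obtain ⟨T', hT', hQT'⟩ := Finset.mem_biUnion.mp hm'
    have hd := hF.disjoint_of_near_overlap hlo hlh hhi hM hT hT' hQT hQT' hs h1 h2 h3
    exact Finset.disjoint_left.mp hd hQ'.2 ((hF.lacunary T hT Q hQT).1.2.1 hQ.2)
  have scale_eq : ∀ Q ∈ 𝒱, 𝒯.scale Q = 𝒯.scale Q₀ := fun Q hQ =>
    le_antisymm (not_lt.1 (not_lt' Q hQ Q₀ hQ₀)) (not_lt.1 (not_lt' Q₀ hQ₀ Q hQ))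
  refine (card_le_of_freq_near (𝒯 := 𝒯) (r := 2 * (hi - lo)) (by linarith)
    (k := 𝒯.scale Q₀) (n := 𝒯.pos Q₀) ?_ ?_ ?_).trans (by linarith)
  · exact scale_eq
  · intro Q hQ
    have h1 := (Finset.mem_filter.mp hQ).2
    have h2 := (Finset.mem_filter.mp hQ₀).2
    rw [interval, mem_dyadic_iff_ediv] at h1 h2
    rw [scale_eq Q hQ] at h1
    exact h1.symm.trans h2
  · intro Q hQ Q' hQ'
    obtain ⟨w, w', h1, h2, h3⟩ := near Q hQ Q' hQ'
    rw [scale_eq Q' hQ', ← scale_eq Q hQ] at h2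
    have h4 : |w * 2 ^ 𝒯.scale Q - w' * 2 ^ 𝒯.scale Q| ≤ hi - lo := by
      rwa [← sub_mul, abs_mul, abs_of_pos (a := (2 : ℝ) ^ 𝒯.scale Q) (by positivity)]
    rw [abs_le] at *
    constructor <;> linarith [h1.1, h1.2, h2.1, h2.2, h4.1, h4.2]

end TileSystem

namespace TileSystem

variable {ι κ : Type*} {𝒯 : TileSystem ι} {D lo hi : ℝ} {M : ℕ} {K : ℝ} {φ : ι → ℤ → ℂ}

/-- Row sums of the Gram matrix within one scale. -/
lemma IsPacketFamily.sum_norm_gram_scale_eq_le (h : 𝒯.IsPacketFamily lo hi K φ) (hlh : lo ≤ hi)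
    (𝒬 : Finset ι) (P : ι) :
    ∑ Q ∈ 𝒬 with 𝒯.scale Q = 𝒯.scale P, ‖gram φ P Q‖ ≤
      256 * K ^ 2 * (4 * (hi - lo) + 1) := by
  classical
  set 𝒰 := 𝒬.filter (fun Q => 𝒯.scale Q = 𝒯.scale P ∧ 𝒯.Overlap lo hi P Q) with h𝒰
  have h1 : ∑ Q ∈ 𝒬 with 𝒯.scale Q = 𝒯.scale P, ‖gram φ P Q‖ = ∑ Q ∈ 𝒰, ‖gram φ P Q‖ := by
    symm
    apply Finset.sum_subset
    · intro Q hQ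
      rw [h𝒰, Finset.mem_filter] at hQ
      exact Finset.mem_filter.mpr ⟨hQ.1, hQ.2.1⟩
    · intro Q hQ hQ'
      rw [Finset.mem_filter] at hQ
      have : ¬ 𝒯.Overlap lo hi P Q := fun ho => hQ' (Finset.mem_filter.mpr ⟨hQ.1, hQ.2, ho⟩)
      rw [gram, h.orthogonal P Q this, norm_zero]
  rw [h1]
  calc ∑ Q ∈ 𝒰, ‖gram φ P Q‖
      ≤ ∑ Q ∈ 𝒰, 16 * K ^ 2 * decay 1 ((𝒯.pos Q : ℝ) - 𝒯.pos P) ^ 4 := by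
        refine Finset.sum_le_sum fun Q hQ => ?_
        have hs := (Finset.mem_filter.mp hQ).2.1
        refine (h.norm_gram_le hs.le).trans (le_of_eq ?_)
        rw [hs, div_self (by positivity), mul_one, decay_sub_comm]
        unfold left
        rw [hs, ← sub_mul, decay_mul_self (by positivity)]
    _ ≤ (2 * (2 * (hi - lo)) + 1) * ∑ n ∈ 𝒰.image 𝒯.pos,
          16 * K ^ 2 * decay 1 ((n : ℝ) - 𝒯.pos P) ^ 4 := by
        refine sum_pos_le_of_scale_eq (r := 2 * (hi - lo)) (by linarith) (k := 𝒯.scale P)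
          (fun Q hQ => (Finset.mem_filter.mp hQ).2.1) ?_ (fun n => by positivity)
          (g := fun n : ℤ => 16 * K ^ 2 * decay 1 ((n : ℝ) - 𝒯.pos P) ^ 4)
        intro Q hQ Q' hQ' _
        rw [h𝒰, Finset.mem_filter] at hQ hQ'
        have h1 := abs_freq_sub_le_of_overlap hQ.2.1.symm hQ.2.2
        have h2 := abs_freq_sub_le_of_overlap hQ'.2.1.symm hQ'.2.2
        rw [abs_le] at *
        constructor <;> linarith [h1.1, h1.2, h2.1, h2.2]
    _ ≤ (2 * (2 * (hi - lo)) + 1) * (16 * K ^ 2 * (16 * 1)) := by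
        rw [← Finset.mul_sum]
        have := sum_decay_pow_le (t := 1) le_rfl (𝒯.pos P) (𝒰.image 𝒯.pos) (k := 4) (by norm_num)
        have h0 : 0 ≤ 2 * (2 * (hi - lo)) + 1 := by linarith
        gcongr
    _ = _ := by ring

lemma sum_sum_mul_le_of_row_sum {𝒬 : Finset ι} {v : ι → ℝ} {g : ι → ι → ℝ} {C : ℝ}
    (hg : ∀ P Q, 0 ≤ g P Q) (hsymm : ∀ P Q, g P Q = g Q P) (hC : ∀ P ∈ 𝒬, ∑ Q ∈ 𝒬, g P Q ≤ C) :
    ∑ P ∈ 𝒬, ∑ Q ∈ 𝒬, v P * v Q * g P Q ≤ C * ∑ P ∈ 𝒬, v P ^ 2 := by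
  have h1 : ∑ P ∈ 𝒬, ∑ Q ∈ 𝒬, v P ^ 2 * g P Q ≤ C * ∑ P ∈ 𝒬, v P ^ 2 := by
    rw [Finset.mul_sum]
    refine Finset.sum_le_sum fun P hP => ?_
    rw [← Finset.mul_sum, mul_comm C]
    exact mul_le_mul_of_nonneg_left (hC P hP) (by positivity)
  have h2 : ∑ P ∈ 𝒬, ∑ Q ∈ 𝒬, v Q ^ 2 * g P Q = ∑ P ∈ 𝒬, ∑ Q ∈ 𝒬, v P ^ 2 * g P Q := by
    rw [Finset.sum_comm]
    exact Finset.sum_congr rfl fun P _ => Finset.sum_congr rfl fun Q _ => by rw [hsymm]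
  calc _ ≤ ∑ P ∈ 𝒬, ∑ Q ∈ 𝒬, (v P ^ 2 * g P Q + v Q ^ 2 * g P Q) / 2 := by
        refine Finset.sum_le_sum fun P _ => Finset.sum_le_sum fun Q _ => ?_
        nlinarith [mul_nonneg (sq_nonneg (v P - v Q)) (hg P Q)]
    _ = (∑ P ∈ 𝒬, ∑ Q ∈ 𝒬, v P ^ 2 * g P Q + ∑ P ∈ 𝒬, ∑ Q ∈ 𝒬, v Q ^ 2 * g P Q) / 2 := by
        simp only [← Finset.sum_div, Finset.sum_add_distrib]
    _ ≤ _ := by rw [h2]; linarith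

/-- The Gram form restricted to pairs of tiles of the same scale. -/
lemma IsPacketFamily.sum_gram_scale_eq_le (h : 𝒯.IsPacketFamily lo hi K φ) (hlh : lo ≤ hi)
    (𝒬 : Finset ι) (v : ι → ℝ) :
    ∑ P ∈ 𝒬, ∑ Q ∈ 𝒬 with 𝒯.scale Q = 𝒯.scale P, v P * v Q * ‖gram φ P Q‖ ≤
      256 * K ^ 2 * (4 * (hi - lo) + 1) * ∑ P ∈ 𝒬, v P ^ 2 := by
  refine le_trans (le_of_eq ?_) (sum_sum_mul_le_of_row_sum (𝒬 := 𝒬) (v := v)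
    (g := fun P Q => if 𝒯.scale Q = 𝒯.scale P then ‖gram φ P Q‖ else 0) ?_ ?_ ?_)
  · refine Finset.sum_congr rfl fun P _ => ?_
    rw [Finset.sum_filter]
    refine Finset.sum_congr rfl fun Q _ => ?_
    split_ifs <;> simp
  · intro P Q; positivity
  · intro P Q
    simp only [eq_comm (a := 𝒯.scale Q), norm_gram_comm P Q]
  · intro P _
    rw [← Finset.sum_filter]
    exact h.sum_norm_gram_scale_eq_le hlh 𝒬 P

lemma sum_gram_eq (𝒬 : Finset ι) (v : ι → ℝ) :
    ∑ P ∈ 𝒬, ∑ Q ∈ 𝒬, v P * v Q * ‖gram φ P Q‖ =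
      ∑ P ∈ 𝒬, (∑ Q ∈ 𝒬 with 𝒯.scale Q = 𝒯.scale P, v P * v Q * ‖gram φ P Q‖) +
      2 * ∑ P ∈ 𝒬, (∑ Q ∈ 𝒬 with 𝒯.scale Q < 𝒯.scale P, v P * v Q * ‖gram φ P Q‖) := by
  have h1 : ∑ P ∈ 𝒬, (∑ Q ∈ 𝒬 with 𝒯.scale P < 𝒯.scale Q, v P * v Q * ‖gram φ P Q‖) =
      ∑ P ∈ 𝒬, (∑ Q ∈ 𝒬 with 𝒯.scale Q < 𝒯.scale P, v P * v Q * ‖gram φ P Q‖) := by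
    simp only [Finset.sum_filter]
    rw [Finset.sum_comm]
    refine Finset.sum_congr rfl fun P _ => Finset.sum_congr rfl fun Q _ => ?_
    rw [norm_gram_comm, mul_comm (v Q)]
  rw [two_mul]
  nth_rewrite 1 [← h1]
  simp only [Finset.sum_filter, ← Finset.sum_add_distrib]
  refine Finset.sum_congr rfl fun P _ => Finset.sum_congr rfl fun Q _ => ?_
  rcases lt_trichotomy (𝒯.scale Q) (𝒯.scale P) with h | h | h
  · simp [h, h.ne, h.not_gt]
  · simp [h]
  · simp [h, h.ne', h.not_gt]

open Classical in
/-- Interactions of one tree of a forest with all tiles of smaller scale. -/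
lemma IsForest.sum_gram_scale_lt_le (h : 𝒯.IsPacketFamily lo hi K φ) (hlo : 1 - D ≤ lo)
    (hlh : lo ≤ hi) (hhi : hi + 1 ≤ D) (hM : 4 * D < 2 ^ M) {F : Finset κ} {top : κ → TreeTop}
    {R : κ → Finset ι} (hF : 𝒯.IsForest D hi F top R) (hsp : 𝒯.Sparse M (F.biUnion R))
    {v : ι → ℝ} {b : ℝ} (hb : 0 ≤ b)
    (hv0 : ∀ P, 0 ≤ v P)
    (hv : ∀ P ∈ F.biUnion R, v P ≤ b * √(2 ^ 𝒯.scale P)) {T : κ} (hT : T ∈ F) :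
    ∑ P ∈ R T, ∑ Q ∈ F.biUnion R with 𝒯.scale Q < 𝒯.scale P, v P * v Q * ‖gram φ P Q‖ ≤
      b ^ 2 * (16 ^ 2 * K ^ 2 * (4 * (hi - lo) + 1) * ((4 * D + 1) * 1024)) * 2 ^ (top T).scale := by
  set 𝒬 := F.biUnion R with h𝒬
  set 𝒰 : ι → Finset ι := fun P =>
    𝒬.filter (fun Q => 𝒯.scale Q < 𝒯.scale P ∧ 𝒯.Overlap lo hi P Q) with h𝒰
  set X : Finset ℤ := (R T).biUnion fun P => (𝒰 P).biUnion 𝒯.interval with hX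
  have hsub : R T ⊆ 𝒬 := Finset.subset_biUnion_of_mem R hT
  have hdisj : Disjoint X (dyadic (top T).scale (top T).pos) := by
    rw [hX, Finset.disjoint_biUnion_left]
    intro P hP
    rw [Finset.disjoint_biUnion_left]
    intro Q hQ
    obtain ⟨hQ, hlt, w, h1, h2⟩ := Finset.mem_filter.mp hQ
    obtain ⟨T', hT', hQT'⟩ := Finset.mem_biUnion.mp hQ
    exact hF.disjoint_of_near_overlap hlo hlh hhi hM hT hT' hP hQT'
      (hsp Q hQ P (hsub hP) hlt) h1 h2 (by simpa using hlh)
  have hW : 0 ≤ 4 * (hi - lo) + 1 := by linarith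
  have hrow : ∀ P ∈ R T, ∑ Q ∈ 𝒬 with 𝒯.scale Q < 𝒯.scale P, v P * v Q * ‖gram φ P Q‖ ≤
      b ^ 2 * (16 ^ 2 * K ^ 2 * (4 * (hi - lo) + 1)) *
        ∑ x ∈ X, decay (2 ^ 𝒯.scale P) (x - 𝒯.left P) ^ 4 := by
    intro P hP
    have h1 : ∑ Q ∈ 𝒬 with 𝒯.scale Q < 𝒯.scale P, v P * v Q * ‖gram φ P Q‖ =
        ∑ Q ∈ 𝒰 P, v P * v Q * ‖gram φ P Q‖ := by
      symm
      apply Finset.sum_subset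
      · intro Q hQ
        obtain ⟨h1, h2, -⟩ := Finset.mem_filter.mp hQ
        exact Finset.mem_filter.mpr ⟨h1, h2⟩
      · intro Q hQ hQ'
        rw [Finset.mem_filter] at hQ
        have : ¬ 𝒯.Overlap lo hi P Q := fun ho => hQ' (Finset.mem_filter.mpr ⟨hQ.1, hQ.2, ho⟩)
        rw [gram, h.orthogonal P Q this, norm_zero, mul_zero]
    rw [h1]
    calc ∑ Q ∈ 𝒰 P, v P * v Q * ‖gram φ P Q‖
        ≤ ∑ Q ∈ 𝒰 P, b ^ 2 * (16 ^ 2 * K ^ 2) *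
            ∑ x ∈ 𝒯.interval Q, decay (2 ^ 𝒯.scale P) (x - 𝒯.left P) ^ 4 := by
          refine Finset.sum_le_sum fun Q hQ => ?_
          obtain ⟨hQ1, hQ2, -⟩ := Finset.mem_filter.mp hQ
          have hg := h.norm_gram_le hQ2.le
          have hd := two_pow_mul_decay_le (𝒯 := 𝒯) hQ2.le
          have hvP := hv P (hsub hP)
          have hvQ := hv Q hQ1
          have ha : (0 : ℝ) < √(2 ^ 𝒯.scale P) := by positivity
          have hc : (2 : ℝ) ^ 𝒯.scale Q = √(2 ^ 𝒯.scale Q) * √(2 ^ 𝒯.scale Q) :=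
            (Real.mul_self_sqrt (by positivity)).symm
          calc v P * v Q * ‖gram φ P Q‖
              ≤ (b * √(2 ^ 𝒯.scale P)) * (b * √(2 ^ 𝒯.scale Q)) *
                (16 * K ^ 2 * (√(2 ^ 𝒯.scale Q) / √(2 ^ 𝒯.scale P)) *
                  decay (2 ^ 𝒯.scale P) (𝒯.left P - 𝒯.left Q) ^ 4) := by
                have := hv0 P
                have := hv0 Q
                gcongr
            _ = b ^ 2 * (16 * K ^ 2) * (2 ^ 𝒯.scale Q *
                  decay (2 ^ 𝒯.scale P) (𝒯.left P - 𝒯.left Q) ^ 4) := by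
                rw [show 2 ^ 𝒯.scale Q * decay (2 ^ 𝒯.scale P) (𝒯.left P - 𝒯.left Q) ^ 4 =
                  √(2 ^ 𝒯.scale Q) * √(2 ^ 𝒯.scale Q) *
                    decay (2 ^ 𝒯.scale P) (𝒯.left P - 𝒯.left Q) ^ 4 by rw [← hc]]
                field_simp
            _ ≤ b ^ 2 * (16 * K ^ 2) *
                (16 * ∑ x ∈ 𝒯.interval Q, decay (2 ^ 𝒯.scale P) (x - 𝒯.left P) ^ 4) := by
                gcongr
            _ = _ := by ring
      _ = b ^ 2 * (16 ^ 2 * K ^ 2) * ∑ Q ∈ 𝒰 P,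
            ∑ x ∈ 𝒯.interval Q, decay (2 ^ 𝒯.scale P) (x - 𝒯.left P) ^ 4 := by
          rw [Finset.mul_sum]
      _ ≤ b ^ 2 * (16 ^ 2 * K ^ 2) * ((4 * (hi - lo) + 1) *
            ∑ x ∈ (𝒰 P).biUnion 𝒯.interval, decay (2 ^ 𝒯.scale P) (x - 𝒯.left P) ^ 4) := by
          refine mul_le_mul_of_nonneg_left ?_ (by positivity)
          refine hF.sum_interval_le hlo hlh hhi hM hsp (P := P) (fun Q hQ => ?_)
            (h := fun x => decay (2 ^ 𝒯.scale P) (x - 𝒯.left P) ^ 4) (fun x => by positivity)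
          obtain ⟨hQ1, hQ2, hQ3⟩ := Finset.mem_filter.mp hQ
          exact ⟨hQ1, hQ2.le, hQ3⟩
      _ ≤ b ^ 2 * (16 ^ 2 * K ^ 2) * ((4 * (hi - lo) + 1) *
            ∑ x ∈ X, decay (2 ^ 𝒯.scale P) (x - 𝒯.left P) ^ 4) := by
          gcongr
          exact Finset.subset_biUnion_of_mem (fun P => (𝒰 P).biUnion 𝒯.interval) hP
      _ = _ := by ring
  calc _ ≤ ∑ P ∈ R T, b ^ 2 * (16 ^ 2 * K ^ 2 * (4 * (hi - lo) + 1)) *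
        ∑ x ∈ X, decay (2 ^ 𝒯.scale P) (x - 𝒯.left P) ^ 4 := Finset.sum_le_sum hrow
    _ ≤ b ^ 2 * (16 ^ 2 * K ^ 2 * (4 * (hi - lo) + 1)) *
        ((4 * D + 1) * 512 * (2 * 2 ^ (top T).scale)) := by
      rw [← Finset.mul_sum]
      refine mul_le_mul_of_nonneg_left ?_ (by positivity)
      exact sum_tree_decay_le (by linarith) (fun P hP => (hF.lacunary T hT P hP).1) hdisj
    _ = _ := by ring

variable {H : Type*} [NormedAddCommGroup H] [InnerProductSpace ℂ H]

/-- The constant of the energy estimate. -/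
noncomputable def energyConst (D lo hi K : ℝ) : ℝ :=
  4 * (256 * K ^ 2 * (4 * (hi - lo) + 1) +
    72 * (16 ^ 2 * K ^ 2 * (4 * (hi - lo) + 1) * ((4 * D + 1) * 1024)))

open Classical in
/-- The energy estimate for a forest of trees of large and comparable density. -/
theorem IsForest.energy_le (h : 𝒯.IsPacketFamily lo hi K φ) (hlo : 1 - D ≤ lo)
    (hlh : lo ≤ hi) (hhi : hi + 1 ≤ D) (hM : 4 * D < 2 ^ M) {F : Finset κ} {top : κ → TreeTop}
    {R : κ → Finset ι} (hF : 𝒯.IsForest D hi F top R) (hsp : 𝒯.Sparse M (F.biUnion R))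
    (X : Finset ℤ) (A : ℤ → H) {μ : ℝ} (hμ : 0 ≤ μ)
    (hv : ∀ P ∈ F.biUnion R, ‖coef φ X A P‖ ^ 2 ≤ 9 * μ ^ 2 * 2 ^ 𝒯.scale P)
    (hbig : ∀ T ∈ F, μ ^ 2 * 2 ^ (top T).scale ≤ 4 * ∑ P ∈ R T, ‖coef φ X A P‖ ^ 2) :
    μ ^ 2 * ∑ T ∈ F, (2 : ℝ) ^ (top T).scale ≤ energyConst D lo hi K * ∑ x ∈ X, ‖A x‖ ^ 2 := by
  set v : ι → ℝ := fun P => ‖coef φ X A P‖ with hvdef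
  set 𝒬 := F.biUnion R with h𝒬
  have hpd : (F : Set κ).PairwiseDisjoint R := fun T hT T' hT' hne => hF.disjoint T hT T' hT' hne
  have hW : 0 ≤ 4 * (hi - lo) + 1 := by linarith
  have hD : 0 ≤ 4 * D + 1 := by linarith
  set C₁ := 256 * K ^ 2 * (4 * (hi - lo) + 1) with hC₁
  set C₂ := 16 ^ 2 * K ^ 2 * (4 * (hi - lo) + 1) * ((4 * D + 1) * 1024) with hC₂
  have hC₁0 : 0 ≤ C₁ := by positivity
  have hC₂0 : 0 ≤ C₂ := by positivity
  have hS : μ ^ 2 * ∑ T ∈ F, (2 : ℝ) ^ (top T).scale ≤ 4 * ∑ P ∈ 𝒬, v P ^ 2 := by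
    rw [h𝒬, Finset.sum_biUnion hpd, Finset.mul_sum, Finset.mul_sum]
    exact Finset.sum_le_sum hbig
  have hcross : ∑ P ∈ 𝒬, (∑ Q ∈ 𝒬 with 𝒯.scale Q < 𝒯.scale P, v P * v Q * ‖gram φ P Q‖) ≤
      9 * C₂ * (μ ^ 2 * ∑ T ∈ F, (2 : ℝ) ^ (top T).scale) := by
    conv_lhs => rw [h𝒬, Finset.sum_biUnion hpd]
    rw [← mul_assoc, Finset.mul_sum]
    refine Finset.sum_le_sum fun T hT => ?_
    have := hF.sum_gram_scale_lt_le h hlo hlh hhi hM hsp (v := v) (b := 3 * μ) (by positivity)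
      (fun P => norm_nonneg _) (fun P hP => ?_) hT
    · refine this.trans (le_of_eq ?_)
      ring
    · refine (le_abs_self _).trans (abs_le_of_sq_le_sq ?_ (by positivity))
      rw [mul_pow, Real.sq_sqrt (by positivity)]
      refine (hv P hP).trans (le_of_eq (by ring))
  have hgram : ∑ P ∈ 𝒬, ∑ Q ∈ 𝒬, v P * v Q * ‖gram φ P Q‖ ≤
      (C₁ + 72 * C₂) * ∑ P ∈ 𝒬, v P ^ 2 := by
    rw [sum_gram_eq (𝒯 := 𝒯)]
    have h1 := h.sum_gram_scale_eq_le hlh 𝒬 v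
    nlinarith
  have := h.sum_coef_sq_le 𝒬 X A (by positivity) hgram
  calc _ ≤ 4 * ∑ P ∈ 𝒬, v P ^ 2 := hS
    _ ≤ 4 * ((C₁ + 72 * C₂) * ∑ x ∈ X, ‖A x‖ ^ 2) := by gcongr
    _ = _ := by rw [energyConst]; ring

end TileSystem

lemma decay_le_div {t d x : ℝ} (ht : 0 < t) (hd : 0 < d) (h : d ≤ |x|) : decay t x ≤ t / d := by
  unfold decay
  rw [← inv_div d t]
  apply inv_anti₀ (by positivity)
  calc d / t ≤ |x| / t := by gcongr
    _ ≤ _ := by linarith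

lemma norm_add_sq_le_two_mul {E : Type*} [NormedAddCommGroup E] (a b : E) : ‖a + b‖ ^ 2 ≤ 2 * ‖a‖ ^ 2 + 2 * ‖b‖ ^ 2 := by
  have := norm_add_le a b
  nlinarith [norm_nonneg (a + b), norm_nonneg a, norm_nonneg b, sq_nonneg (‖a‖ - ‖b‖)]

namespace TileSystem

variable {ι κ : Type*} {𝒯 : TileSystem ι} {D lo hi : ℝ} {M : ℕ} {K : ℝ} {φ : ι → ℤ → ℂ}
variable {H : Type*} [NormedAddCommGroup H] [InnerProductSpace ℂ H]

lemma coef_filter_add (X : Finset ℤ) (A : ℤ → H) (p : ℤ → Prop) [DecidablePred p] (P : ι) :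
    coef φ X A P = coef φ (X.filter p) A P + coef φ (X.filter fun x => ¬ p x) A P :=
  (Finset.sum_filter_add_sum_filter_not X p _).symm

lemma sum_one_near_le (k : ℕ) (y : ℝ) {X : Finset ℤ}
    (hX : ∀ x ∈ X, |(x : ℝ) - y| ≤ 2 * 2 ^ k) : (X.card : ℝ) ≤ 144 * 2 ^ k := by
  have ht : (0 : ℝ) < 2 ^ k := by positivity
  have h := sum_decay_sq_le (one_le_two_pow_real k) y X
  have h1 : (X.card : ℝ) * 1 ≤ ∑ x ∈ X, 9 * decay (2 ^ k) (x - y) ^ 2 := by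
    rw [← nsmul_eq_mul, ← Finset.sum_const]
    refine Finset.sum_le_sum fun x hx => ?_
    have : 1 ≤ 3 * decay (2 ^ k) (x - y) := by
      unfold decay
      rw [← div_eq_mul_inv, one_le_div (by positivity)]
      have := (div_le_iff₀ ht).mpr (hX x hx)
      linarith
    nlinarith
  rw [← Finset.mul_sum] at h1
  linarith

lemma IsPacketFamily.norm_coef_far_le (h : 𝒯.IsPacketFamily lo hi K φ) (P : ι) {X : Finset ℤ}
    {A : ℤ → H} {μ d : ℝ} (hμ : 0 ≤ μ) (hd : 0 < d) (hA : ∀ x ∈ X, ‖A x‖ ≤ μ)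
    (hX : ∀ x ∈ X, d ≤ |(x : ℝ) - 𝒯.left P|) :
    ‖coef φ X A P‖ ≤ 16 * K * μ * √(2 ^ 𝒯.scale P) * (2 ^ 𝒯.scale P / d) := by
  have : Nonempty ι := ⟨P⟩
  have hK := h.nonneg
  have ht : (0 : ℝ) < 2 ^ 𝒯.scale P := by positivity
  have hs := sum_decay_sq_le (one_le_two_pow_real (𝒯.scale P)) (𝒯.left P) X
  set t : ℝ := 2 ^ 𝒯.scale P with htdef
  calc ‖coef φ X A P‖ ≤ ∑ x ∈ X, ‖φ P x • A x‖ := norm_sum_le _ _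
    _ ≤ ∑ x ∈ X, K * (√t)⁻¹ * μ * (t / d) * decay t (x - 𝒯.left P) ^ 2 := by
      refine Finset.sum_le_sum fun x hx => ?_
      rw [norm_smul]
      have h1 := decay_le_div ht hd (hX x hx)
      have h2 := decay_le_one ht (x - 𝒯.left P)
      have h3 := decay_pos ht (x - 𝒯.left P)
      have h4 : decay t (x - 𝒯.left P) ^ 6 ≤ (t / d) * decay t (x - 𝒯.left P) ^ 2 := by
        calc decay t (x - 𝒯.left P) ^ 6 ≤ decay t (x - 𝒯.left P) ^ 3 :=
              pow_le_pow_of_le_one h3.le h2 (by norm_num)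
          _ = decay t (x - 𝒯.left P) * decay t (x - 𝒯.left P) ^ 2 := by ring
          _ ≤ _ := by gcongr
      calc ‖φ P x‖ * ‖A x‖ ≤ (K * (√t)⁻¹ * decay t (x - 𝒯.left P) ^ 6) * μ := by
            gcongr
            · exact h.bound P x
            · exact hA x hx
        _ ≤ (K * (√t)⁻¹ * ((t / d) * decay t (x - 𝒯.left P) ^ 2)) * μ := by gcongr
        _ = _ := by ring
    _ ≤ K * (√t)⁻¹ * μ * (t / d) * (16 * t) := by
      rw [← Finset.mul_sum]
      gcongr
    _ = 16 * K * μ * ((√t)⁻¹ * (√t * √t)) * (t / d) := by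
      rw [Real.mul_self_sqrt ht.le]; ring
    _ = _ := by
      have : √t ≠ 0 := by positivity
      field_simp

lemma card_mul_two_pow_le {T : TreeTop} {k : ℕ} {Y : Finset ℤ}
    (hY : ∀ n ∈ Y, k ≤ T.scale ∧ dyadic k n ⊆ dyadic T.scale T.pos) :
    (Y.card : ℝ) * 2 ^ k ≤ 2 ^ T.scale := by
  rcases Y.eq_empty_or_nonempty with rfl | ⟨n₀, h₀⟩
  · simp
  obtain ⟨i, hi⟩ := Nat.exists_eq_add_of_le (hY n₀ h₀).1
  have hk : (0 : ℤ) < 2 ^ k := by positivity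
  have hsub : Y ⊆ dyadic i T.pos := by
    intro n hn
    have h1 : n * 2 ^ k ∈ dyadic k n := by
      rw [mem_dyadic]; exact ⟨le_rfl, by linarith⟩
    have h2 := (hY n hn).2 h1
    rw [hi, mem_dyadic_iff_ediv, pow_add, ← Int.ediv_ediv_of_nonneg hk.le,
      Int.mul_ediv_cancel _ hk.ne'] at h2
    rwa [mem_dyadic_iff_ediv]
  have hc := Finset.card_le_card hsub
  rw [card_dyadic] at hc
  have hc' : (Y.card : ℝ) ≤ 2 ^ i := by exact_mod_cast hc
  rw [hi, pow_add, mul_comm]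
  gcongr

/-- The constant of the estimate for bounded sequences on a tree. -/
noncomputable def boundConst (D lo hi K : ℝ) : ℝ :=
  2 * (256 * K ^ 2 * (4 * (hi - lo) + 1)) * 144 + 2 * ((4 * D + 1) * (256 * K ^ 2) * 2)

/-- Coefficients of a bounded sequence along a lacunary tree. -/
theorem IsPacketFamily.sum_coef_sq_le_of_bounded (h : 𝒯.IsPacketFamily lo hi K φ)
    (hlo : 1 - D ≤ lo) (hlh : lo ≤ hi) (hhi : hi + 1 ≤ D) (hM : 4 * D < 2 ^ M) {T : TreeTop}
    {R : Finset ι} (hR : ∀ P ∈ R, 𝒯.Lacunary D hi T P) (hsp : 𝒯.Sparse M R)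
    {X : Finset ℤ} {A : ℤ → H} {μ : ℝ} (hμ : 0 ≤ μ) (hA : ∀ x ∈ X, ‖A x‖ ≤ μ) :
    ∑ P ∈ R, ‖coef φ X A P‖ ^ 2 ≤ boundConst D lo hi K * μ ^ 2 * 2 ^ T.scale := by
  classical
  set t : ℝ := 2 ^ T.scale with htdef
  have ht : 0 < t := by positivity
  have hD : 0 ≤ D := by linarith
  have hW : 0 ≤ 4 * (hi - lo) + 1 := by linarith
  set p : ℤ → Prop := fun x => |(x : ℝ) - T.pos * t| ≤ 2 * t
  set X₁ := X.filter p
  set X₂ := X.filter fun x => ¬ p x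
  have near : ∑ P ∈ R, ‖coef φ X₁ A P‖ ^ 2 ≤
      256 * K ^ 2 * (4 * (hi - lo) + 1) * (μ ^ 2 * (144 * t)) := by
    have hgram : ∑ P ∈ R, ∑ Q ∈ R, ‖coef φ X₁ A P‖ * ‖coef φ X₁ A Q‖ * ‖gram φ P Q‖ ≤
        256 * K ^ 2 * (4 * (hi - lo) + 1) * ∑ P ∈ R, ‖coef φ X₁ A P‖ ^ 2 := by
      rw [sum_gram_eq (𝒯 := 𝒯) R (fun P => ‖coef φ X₁ A P‖)]
      have h0 : ∑ P ∈ R, (∑ Q ∈ R with 𝒯.scale Q < 𝒯.scale P,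
          ‖coef φ X₁ A P‖ * ‖coef φ X₁ A Q‖ * ‖gram φ P Q‖) = 0 := by
        refine Finset.sum_eq_zero fun P hP => Finset.sum_eq_zero fun Q hQ => ?_
        rw [Finset.mem_filter] at hQ
        have := not_overlap_of_lacunary hlo hlh hhi hM (hR P hP) (hR Q hQ.1)
          (hsp Q hQ.1 P hP hQ.2)
        rw [gram, h.orthogonal P Q this, norm_zero, mul_zero]
      rw [h0, mul_zero, add_zero]
      exact h.sum_gram_scale_eq_le hlh R _
    refine (h.sum_coef_sq_le R X₁ A (by positivity) hgram).trans ?_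
    gcongr
    calc ∑ x ∈ X₁, ‖A x‖ ^ 2 ≤ ∑ x ∈ X₁, μ ^ 2 := by
          refine Finset.sum_le_sum fun x hx => ?_
          have := hA x (Finset.mem_filter.mp hx).1
          gcongr
      _ = μ ^ 2 * X₁.card := by rw [Finset.sum_const, nsmul_eq_mul, mul_comm]
      _ ≤ _ := by
          gcongr
          exact sum_one_near_le T.scale (T.pos * t) fun x hx => (Finset.mem_filter.mp hx).2
  have far : ∑ P ∈ R, ‖coef φ X₂ A P‖ ^ 2 ≤ (4 * D + 1) * (256 * K ^ 2 * μ ^ 2) * (2 * t) := by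
    have hpt : ∀ P ∈ R, ‖coef φ X₂ A P‖ ^ 2 ≤
        256 * K ^ 2 * μ ^ 2 * (2 ^ 𝒯.scale P * (2 ^ 𝒯.scale P / t) ^ 2) := by
      intro P hP
      have hin := (hR P hP).1.2.1 (left_mem_interval P)
      rw [mem_dyadic] at hin
      have h1 : T.pos * t ≤ 𝒯.left P := by
        have : (T.pos * 2 ^ T.scale : ℝ) ≤ 𝒯.pos P * 2 ^ 𝒯.scale P := by exact_mod_cast hin.1
        unfold left; linarith
      have h2 : 𝒯.left P < T.pos * t + t := by
        have : (𝒯.pos P * 2 ^ 𝒯.scale P : ℝ) < (T.pos + 1) * 2 ^ T.scale := by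
          exact_mod_cast hin.2
        unfold left; linarith
      have := h.norm_coef_far_le P (X := X₂) (A := A) hμ ht
        (fun x hx => hA x (Finset.mem_filter.mp hx).1) (fun x hx => ?_)
      · calc ‖coef φ X₂ A P‖ ^ 2 ≤
            (16 * K * μ * √(2 ^ 𝒯.scale P) * (2 ^ 𝒯.scale P / t)) ^ 2 := by gcongr
          _ = 256 * K ^ 2 * μ ^ 2 * (√(2 ^ 𝒯.scale P) ^ 2 * (2 ^ 𝒯.scale P / t) ^ 2) := by ring
          _ = _ := by rw [Real.sq_sqrt (by positivity)]
      · have hx := (Finset.mem_filter.mp hx).2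
        simp only [p, not_le] at hx
        have h3 := abs_sub_le (x : ℝ) (𝒯.left P) (T.pos * t)
        have h4 : |𝒯.left P - T.pos * t| ≤ t := by rw [abs_le]; constructor <;> linarith
        linarith
    refine (Finset.sum_le_sum hpt).trans ?_
    refine sum_tree_le hD (fun P hP => (hR P hP).1)
      (g := fun k _ => 256 * K ^ 2 * μ ^ 2 * (2 ^ k * (2 ^ k / t) ^ 2))
      (fun k n => by positivity) (by positivity) ?_
    intro k Y hY
    rw [Finset.sum_const, nsmul_eq_mul]
    rcases Y.eq_empty_or_nonempty with rfl | ⟨n₀, h₀⟩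
    · simp; positivity
    have hle : (2 : ℝ) ^ k ≤ t := pow_le_pow_right₀ (by norm_num) (hY n₀ h₀).1
    have hr : (2 : ℝ) ^ k / t ≤ 1 := (div_le_one ht).mpr hle
    calc (Y.card : ℝ) * (256 * K ^ 2 * μ ^ 2 * (2 ^ k * (2 ^ k / t) ^ 2))
        = 256 * K ^ 2 * μ ^ 2 * ((Y.card * 2 ^ k) * (2 ^ k / t) * (2 ^ k / t)) := by ring
      _ ≤ 256 * K ^ 2 * μ ^ 2 * (t * (2 ^ k / t) * 1) := by
          have := card_mul_two_pow_le hY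
          gcongr
      _ = _ := by field_simp
  calc ∑ P ∈ R, ‖coef φ X A P‖ ^ 2
      ≤ ∑ P ∈ R, (2 * ‖coef φ X₁ A P‖ ^ 2 + 2 * ‖coef φ X₂ A P‖ ^ 2) := by
        refine Finset.sum_le_sum fun P _ => ?_
        rw [coef_filter_add X A p P]
        exact norm_add_sq_le_two_mul _ _
    _ = 2 * ∑ P ∈ R, ‖coef φ X₁ A P‖ ^ 2 + 2 * ∑ P ∈ R, ‖coef φ X₂ A P‖ ^ 2 := by
        rw [Finset.sum_add_distrib, Finset.mul_sum, Finset.mul_sum]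
    _ ≤ 2 * (256 * K ^ 2 * (4 * (hi - lo) + 1) * (μ ^ 2 * (144 * t))) +
        2 * ((4 * D + 1) * (256 * K ^ 2 * μ ^ 2) * (2 * t)) := by gcongr
    _ = _ := by rw [boundConst]; ring

lemma boundConst_nonneg (hlo : 1 - D ≤ lo) (hlh : lo ≤ hi) (hhi : hi + 1 ≤ D) :
    0 ≤ boundConst D lo hi K := by
  have hD : 0 ≤ D := by linarith
  have hW : 0 ≤ 4 * (hi - lo) + 1 := by linarith
  unfold boundConst
  positivity

lemma energyConst_nonneg (hlo : 1 - D ≤ lo) (hlh : lo ≤ hi) (hhi : hi + 1 ≤ D) :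
    0 ≤ energyConst D lo hi K := by
  have hD : 0 ≤ D := by linarith
  have hW : 0 ≤ 4 * (hi - lo) + 1 := by linarith
  unfold energyConst
  positivity

/-- A lacunary tile is lacunary with respect to the single-tile top of the same frequency. -/
lemma Lacunary.self {T : TreeTop} {P : ι} (h : 𝒯.Lacunary D hi T P) :
    𝒯.Lacunary D hi ⟨𝒯.scale P, 𝒯.pos P, T.freq⟩ P :=
  ⟨⟨le_rfl, subset_rfl, h.1.2.2⟩, h.2⟩

open Classical in
/-- The counting estimate for a forest, in terms of the large values of the sequence only. -/
theorem IsForest.counting_le (h : 𝒯.IsPacketFamily lo hi K φ) (hlo : 1 - D ≤ lo)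
    (hlh : lo ≤ hi) (hhi : hi + 1 ≤ D) (hM : 4 * D < 2 ^ M) {F : Finset κ} {top : κ → TreeTop}
    {R : κ → Finset ι} (hF : 𝒯.IsForest D hi F top R) (hsp : 𝒯.Sparse M (F.biUnion R))
    {X : Finset ℤ} {A : ℤ → H} {μ c : ℝ} (hμ : 0 ≤ μ) (hc : 0 ≤ c)
    (hc' : 4 * boundConst D lo hi K * c ^ 2 ≤ 1)
    (hv : ∀ P ∈ F.biUnion R, ‖coef φ X A P‖ ^ 2 ≤ 4 * μ ^ 2 * 2 ^ 𝒯.scale P)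
    (hbig : ∀ T ∈ F, μ ^ 2 * 2 ^ (top T).scale ≤ ∑ P ∈ R T, ‖coef φ X A P‖ ^ 2) :
    μ ^ 2 * ∑ T ∈ F, (2 : ℝ) ^ (top T).scale ≤
      energyConst D lo hi K * ∑ x ∈ X with c * μ < ‖A x‖, ‖A x‖ ^ 2 := by
  set p : ℤ → Prop := fun x => c * μ < ‖A x‖
  set X₁ := X.filter p
  set X₂ := X.filter fun x => ¬ p x
  have hA₂ : ∀ x ∈ X₂, ‖A x‖ ≤ c * μ := fun x hx => not_lt.mp (Finset.mem_filter.mp hx).2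
  have small : ∀ (T : TreeTop) (R' : Finset ι), R' ⊆ F.biUnion R →
      (∀ P ∈ R', 𝒯.Lacunary D hi T P) →
      4 * ∑ P ∈ R', ‖coef φ X₂ A P‖ ^ 2 ≤ μ ^ 2 * 2 ^ T.scale := by
    intro T R' hR' hlac
    have := h.sum_coef_sq_le_of_bounded hlo hlh hhi hM hlac
      (fun P hP Q hQ hlt => hsp P (hR' hP) Q (hR' hQ) hlt) (by positivity) hA₂
    calc 4 * ∑ P ∈ R', ‖coef φ X₂ A P‖ ^ 2
        ≤ 4 * (boundConst D lo hi K * (c * μ) ^ 2 * 2 ^ T.scale) := by gcongr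
      _ = (4 * boundConst D lo hi K * c ^ 2) * (μ ^ 2 * 2 ^ T.scale) := by ring
      _ ≤ 1 * (μ ^ 2 * 2 ^ T.scale) := by gcongr
      _ = _ := one_mul _
  have hsplit : ∀ P, coef φ X A P = coef φ X₁ A P + coef φ X₂ A P := coef_filter_add X A p
  refine hF.energy_le h hlo hlh hhi hM hsp X₁ A hμ ?_ ?_
  · intro P hP
    obtain ⟨T, hT, hPT⟩ := Finset.mem_biUnion.mp hP
    have h1 := small _ {P} (by simpa using ⟨T, hT, hPT⟩)
      (fun Q hQ => by rw [Finset.mem_singleton] at hQ; subst hQ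
                      exact (hF.lacunary T hT Q hPT).self)
    rw [Finset.sum_singleton] at h1
    have h2 := norm_add_sq_le_two_mul (coef φ X A P) (-coef φ X₂ A P)
    rw [← sub_eq_add_neg, norm_neg, hsplit, add_sub_cancel_right, ← hsplit] at h2
    have := hv P hP
    simp only at h1
    linarith [show 0 ≤ μ ^ 2 * 2 ^ 𝒯.scale P by positivity]
  · intro T hT
    have h1 := small (top T) (R T) (Finset.subset_biUnion_of_mem R hT) (hF.lacunary T hT)
    have h2 : ∑ P ∈ R T, ‖coef φ X A P‖ ^ 2 ≤
        2 * ∑ P ∈ R T, ‖coef φ X₁ A P‖ ^ 2 + 2 * ∑ P ∈ R T, ‖coef φ X₂ A P‖ ^ 2 := by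
      rw [Finset.mul_sum, Finset.mul_sum, ← Finset.sum_add_distrib]
      refine Finset.sum_le_sum fun P _ => ?_
      rw [hsplit]
      exact norm_add_sq_le_two_mul _ _
    have := hbig T hT
    linarith

end TileSystem

/-- The top with reflected frequency. -/
def TreeTop.reflect (T : TreeTop) : TreeTop := ⟨T.scale, T.pos, -T.freq⟩

lemma TreeTop.reflect_reflect (T : TreeTop) : T.reflect.reflect = T := by
  simp [TreeTop.reflect]

namespace TileSystem

variable {ι : Type*} {𝒯 : TileSystem ι} {D lo hi : ℝ} {M : ℕ} {K : ℝ} {φ : ι → ℤ → ℂ}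
variable {H : Type*} [NormedAddCommGroup H] [InnerProductSpace ℂ H]

lemma inTree_reflect {T : TreeTop} {P : ι} : 𝒯.reflect.InTree D T.reflect P ↔ 𝒯.InTree D T P := by
  unfold InTree interval
  simp only [reflect, TreeTop.reflect]
  refine and_congr Iff.rfl (and_congr Iff.rfl ?_)
  rw [← abs_neg]
  push_cast
  ring_nf

lemma IsPacketFamily.reflect (h : 𝒯.IsPacketFamily lo hi K φ) :
    𝒯.reflect.IsPacketFamily (-hi) (-lo) K φ where
  bound := h.bound
  orthogonal P Q hPQ := by
    refine h.orthogonal P Q fun ⟨w, h1, h2⟩ => hPQ ⟨-w, ?_, ?_⟩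
    all_goals
      simp only [TileSystem.reflect, mem_Icc] at *
      push_cast
      constructor <;> linarith [h1.1, h1.2, h2.1, h2.2]

variable (𝒯) in
/-- Tiles of a tree whose frequency window lies to the right of the frequency of the top. -/
def LacunaryRight (D lo : ℝ) (T : TreeTop) (P : ι) : Prop :=
  𝒯.InTree D T P ∧ T.freq * 2 ^ 𝒯.scale P - 𝒯.freq P ≤ lo - 1

lemma lacunary_reflect {T : TreeTop} {P : ι} :
    𝒯.reflect.Lacunary D (-lo) T.reflect P ↔ 𝒯.LacunaryRight D lo T P := by
  unfold Lacunary LacunaryRight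
  rw [inTree_reflect]
  refine and_congr Iff.rfl ?_
  simp only [reflect, TreeTop.reflect]
  push_cast
  constructor <;> intro h <;> linarith

open Classical in
variable (𝒯) in
/-- The size of the coefficients `a` over the tiles in `𝒬` is at most `μ`. -/
def SizeLE (D lo hi : ℝ) (Ξ : Finset ℝ) (a : ι → ℝ) (μ : ℝ) (𝒬 : Finset ι) : Prop :=
  ∀ T : TreeTop, T.freq ∈ Ξ →
    ∑ P ∈ 𝒬 with 𝒯.Lacunary D hi T P, a P ^ 2 ≤ μ ^ 2 * 2 ^ T.scale ∧
    ∑ P ∈ 𝒬 with 𝒯.LacunaryRight D lo T P, a P ^ 2 ≤ μ ^ 2 * 2 ^ T.scale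

open Classical in
lemma SizeLE.mono {Ξ : Finset ℝ} {a : ι → ℝ} {μ ν : ℝ} {𝒬 𝒬' : Finset ι}
    (h : 𝒯.SizeLE D lo hi Ξ a μ 𝒬) (hs : 𝒬' ⊆ 𝒬) (h0 : 0 ≤ μ) (hμ : μ ≤ ν) :
    𝒯.SizeLE D lo hi Ξ a ν 𝒬' := by
  intro T hT
  have hle : μ ^ 2 * 2 ^ T.scale ≤ ν ^ 2 * 2 ^ T.scale := by gcongr
  refine ⟨le_trans ?_ ((h T hT).1.trans hle), le_trans ?_ ((h T hT).2.trans hle)⟩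
  all_goals
    refine Finset.sum_le_sum_of_subset_of_nonneg ?_ fun _ _ _ => by positivity
    exact Finset.filter_subset_filter _ hs

open Classical in
/-- Removing trees until one-sided lacunary trees have density at most `μ`. -/
lemma IsPacketFamily.exists_tops (h : 𝒯.IsPacketFamily lo hi K φ) (hlo : 1 - D ≤ lo)
    (hlh : lo ≤ hi) (hhi : hi + 1 ≤ D) (hM : 4 * D < 2 ^ M) {𝒬 : Finset ι} (hsp : 𝒯.Sparse M 𝒬)
    {X : Finset ℤ} {A : ℤ → H} {μ c : ℝ} (hμ : 0 < μ) (hc : 0 ≤ c)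
    (hc' : 4 * boundConst D lo hi K * c ^ 2 ≤ 1) (Ξ : Finset ℝ)
    (hsize : ∀ T : TreeTop, T.freq ∈ Ξ → ∑ P ∈ 𝒬 with 𝒯.Lacunary D hi T P, ‖coef φ X A P‖ ^ 2 ≤
      (2 * μ) ^ 2 * 2 ^ T.scale) :
    ∃ F : Finset TreeTop, (∀ T ∈ F, T.freq ∈ Ξ) ∧
      μ ^ 2 * ∑ T ∈ F, (2 : ℝ) ^ T.scale ≤
        energyConst D lo hi K * ∑ x ∈ X with c * μ < ‖A x‖, ‖A x‖ ^ 2 ∧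
      ∀ T : TreeTop, T.freq ∈ Ξ → ∑ P ∈ 𝒬 with (∀ T' ∈ F, ¬ 𝒯.InTree D T' P) ∧
        𝒯.Lacunary D hi T P, ‖coef φ X A P‖ ^ 2 ≤ μ ^ 2 * 2 ^ T.scale := by
  obtain ⟨F, hF, hF1, hF2⟩ := exists_forest 𝒯 D hi Ξ (fun P => ‖coef φ X A P‖) hμ 𝒬
  refine ⟨F.image Prod.fst, ?_, ?_, ?_⟩
  · intro T hT
    obtain ⟨T', hT', rfl⟩ := Finset.mem_image.mp hT
    exact (hF1 T' hT').1
  · have hsub : F.biUnion Prod.snd ⊆ 𝒬 := Finset.biUnion_subset.mpr fun T hT => (hF1 T hT).2.1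
    have := hF.counting_le h hlo hlh hhi hM
      (fun P hP Q hQ hlt => hsp P (hsub hP) Q (hsub hQ) hlt) (X := X) (A := A) hμ.le hc hc' ?_
      (fun T hT => (hF1 T hT).2.2.le)
    · refine le_trans ?_ this
      gcongr
      rw [← Finset.sum_fiberwise_of_maps_to (s := F) (t := F.image Prod.fst) (g := Prod.fst)
        (fun T hT => Finset.mem_image_of_mem _ hT)]
      refine Finset.sum_le_sum fun T hT => ?_
      obtain ⟨T', hT', rfl⟩ := Finset.mem_image.mp hT
      exact Finset.single_le_sum (f := fun T : TreeTop × Finset ι => (2 : ℝ) ^ T.1.scale)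
        (fun _ _ => by positivity) (Finset.mem_filter.mpr ⟨hT', rfl⟩)
    · intro P hP
      obtain ⟨T, hT, hPT⟩ := Finset.mem_biUnion.mp hP
      have h1 := (hF.lacunary T hT P hPT).self
      have h2 := hsize ⟨𝒯.scale P, 𝒯.pos P, T.1.freq⟩ (hF1 T hT).1
      have h3 := Finset.single_le_sum (f := fun P => ‖coef φ X A P‖ ^ 2)
        (fun _ _ => by positivity) (Finset.mem_filter.mpr ⟨hsub hP, h1⟩)
      refine h3.trans (h2.trans (le_of_eq (by ring)))
  · intro T hT
    refine le_trans (le_of_eq ?_) (hF2 T hT)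
    simp only [Finset.forall_mem_image]

open Classical in
/-- Removing trees until all lacunary trees have density at most `μ`. -/
theorem IsPacketFamily.exists_tops_sizeLE (h : 𝒯.IsPacketFamily lo hi K φ) (hlo : 1 - D ≤ lo)
    (hlh : lo ≤ hi) (hhi : hi + 1 ≤ D) (hM : 4 * D < 2 ^ M) {𝒬 : Finset ι} (hsp : 𝒯.Sparse M 𝒬)
    {X : Finset ℤ} {A : ℤ → H} {μ c : ℝ} (hμ : 0 < μ) (hc : 0 ≤ c)
    (hc' : 4 * boundConst D lo hi K * c ^ 2 ≤ 1) (Ξ : Finset ℝ)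
    (hsize : 𝒯.SizeLE D lo hi Ξ (fun P => ‖coef φ X A P‖) (2 * μ) 𝒬) :
    ∃ F : Finset TreeTop, (∀ T ∈ F, T.freq ∈ Ξ) ∧
      μ ^ 2 * ∑ T ∈ F, (2 : ℝ) ^ T.scale ≤
        2 * energyConst D lo hi K * ∑ x ∈ X with c * μ < ‖A x‖, ‖A x‖ ^ 2 ∧
      𝒯.SizeLE D lo hi Ξ (fun P => ‖coef φ X A P‖) μ
        (𝒬.filter fun P => ∀ T ∈ F, ¬ 𝒯.InTree D T P) := by
  obtain ⟨F₁, h11, h12, h13⟩ := h.exists_tops hlo hlh hhi hM hsp hμ hc hc' Ξ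
    (fun T hT => (hsize T hT).1)
  have hcr : 4 * boundConst D (-hi) (-lo) K * c ^ 2 ≤ 1 := by
    rwa [boundConst, show -lo - -hi = hi - lo by ring]
  obtain ⟨F₂, h21, h22, h23⟩ := h.reflect.exists_tops (by linarith) (by linarith) (by linarith) hM
    (𝒬 := 𝒬) hsp (X := X) (A := A) hμ hc hcr (Ξ.image Neg.neg) (fun T hT => by
      obtain ⟨ξ, hξ, hξT⟩ := Finset.mem_image.mp hT
      have := (hsize T.reflect (by rw [TreeTop.reflect]; simp only [← hξT, neg_neg]; exact hξ)).2
      simp only [← lacunary_reflect, TreeTop.reflect_reflect] at this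
      exact this)
  have hneg : ∀ T ∈ F₂.image TreeTop.reflect, T.reflect ∈ F₂ := by
    intro T hT
    obtain ⟨T', hT', rfl⟩ := Finset.mem_image.mp hT
    rwa [TreeTop.reflect_reflect]
  refine ⟨F₁ ∪ F₂.image TreeTop.reflect, ?_, ?_, ?_⟩
  · intro T hT
    rcases Finset.mem_union.mp hT with hT | hT
    · exact h11 T hT
    · obtain ⟨ξ, hξ, hξT⟩ := Finset.mem_image.mp (h21 _ (hneg T hT))
      simp only [TreeTop.reflect, neg_inj] at hξT
      rwa [← hξT]
  · have e1 : energyConst D (-hi) (-lo) K = energyConst D lo hi K := by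
      rw [energyConst, energyConst, show -lo - -hi = hi - lo by ring]
    rw [e1] at h22
    have h3 : ∑ T ∈ F₁ ∪ F₂.image TreeTop.reflect, (2 : ℝ) ^ T.scale ≤
        ∑ T ∈ F₁, (2 : ℝ) ^ T.scale + ∑ T ∈ F₂, (2 : ℝ) ^ T.scale := by
      have hi2 : ∑ T ∈ F₂.image TreeTop.reflect, (2 : ℝ) ^ T.scale =
          ∑ T ∈ F₂, (2 : ℝ) ^ T.scale := by
        rw [Finset.sum_image]
        · rfl
        · intro T _ T' _ hTT
          rw [← T.reflect_reflect, hTT, T'.reflect_reflect]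
      rw [← hi2, ← Finset.sum_union_inter]
      exact le_add_of_nonneg_right (Finset.sum_nonneg fun _ _ => by positivity)
    nlinarith [mul_le_mul_of_nonneg_left h3 (sq_nonneg μ)]
  · intro T hT
    constructor
    · refine le_trans (Finset.sum_le_sum_of_subset_of_nonneg ?_ fun _ _ _ => by positivity)
        (h13 T hT)
      intro P hP
      rw [Finset.filter_filter, Finset.mem_filter] at hP
      exact Finset.mem_filter.mpr ⟨hP.1, fun T' hT' => hP.2.1 T' (Finset.mem_union_left _ hT'),
        hP.2.2⟩
    · refine le_trans (Finset.sum_le_sum_of_subset_of_nonneg ?_ fun _ _ _ => by positivity)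
        (h23 T.reflect (Finset.mem_image_of_mem _ hT))
      intro P hP
      rw [Finset.filter_filter, Finset.mem_filter] at hP
      refine Finset.mem_filter.mpr ⟨hP.1, fun T' hT' => ?_, lacunary_reflect.mpr hP.2.2⟩
      rw [← T'.reflect_reflect, inTree_reflect]
      exact hP.2.1 _ (Finset.mem_union_right _ (Finset.mem_image_of_mem _ hT'))

lemma SizeLE.le_mul_sqrt {Ξ : Finset ℝ} {a : ι → ℝ} {μ : ℝ} {𝒬 : Finset ι} (hμ : 0 ≤ μ)
    (h : 𝒯.SizeLE D lo hi Ξ a μ 𝒬) {P : ι} (hP : P ∈ 𝒬)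
    (hΞ : ∃ T : TreeTop, T.freq ∈ Ξ ∧ 𝒯.Lacunary D hi T P) :
    a P ≤ μ * √(2 ^ 𝒯.scale P) := by
  classical
  obtain ⟨T, hT, hPT⟩ := hΞ
  have h2 := (h ⟨𝒯.scale P, 𝒯.pos P, T.freq⟩ hT).1
  have h3 := Finset.single_le_sum (f := fun P => a P ^ 2)
    (fun _ _ => by positivity) (Finset.mem_filter.mpr ⟨hP, hPT.self⟩)
  refine (le_abs_self _).trans (abs_le_of_sq_le_sq ?_ (by positivity))
  rw [mul_pow, Real.sq_sqrt (by positivity)]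
  exact h3.trans h2

open Classical in
/-- The tree estimate: all but one of the three families are lacunary at each tile. -/
theorem sum_tree_prod_le {lo hi : Fin 3 → ℝ} {Ξ : Finset ℝ} {a : Fin 3 → ι → ℝ} {μ : Fin 3 → ℝ}
    {𝒬 : Finset ι} (hsep : ∀ i j, i ≠ j → hi i + 1 ≤ lo j - 1 ∨ hi j + 1 ≤ lo i - 1)
    (ha : ∀ j P, 0 ≤ a j P) (hμ : ∀ j, 0 < μ j) (h : ∀ j, 𝒯.SizeLE D (lo j) (hi j) Ξ (a j) (μ j) 𝒬)
    (hΞ : ∀ P ∈ 𝒬, ∀ j, ∃ T : TreeTop, T.freq ∈ Ξ ∧ 𝒯.Lacunary D (hi j) T P)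
    {T : TreeTop} (hT : T.freq ∈ Ξ) :
    ∑ P ∈ 𝒬 with 𝒯.InTree D T P, (√(2 ^ 𝒯.scale P))⁻¹ * ∏ j, a j P ≤
      6 * (∏ j, μ j) * 2 ^ T.scale := by
  set lac : Fin 3 → ι → Prop := fun j P =>
    𝒯.Lacunary D (hi j) T P ∨ 𝒯.LacunaryRight D (lo j) T P
  set b : Fin 3 → ι → ℝ := fun j P => if lac j P then (a j P / μ j) ^ 2 else 0 with hb
  have hb0 : ∀ j P, 0 ≤ b j P := fun j P => by simp only [hb]; positivity
  have hsum : ∀ j, ∑ P ∈ 𝒬, b j P ≤ 2 * 2 ^ T.scale := by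
    intro j
    have hm := hμ j
    have h1 := (h j T hT).1
    have h2 := (h j T hT).2
    have h3 : ∑ P ∈ 𝒬, b j P ≤ (μ j ^ 2)⁻¹ *
        (∑ P ∈ 𝒬 with 𝒯.Lacunary D (hi j) T P, a j P ^ 2 +
          ∑ P ∈ 𝒬 with 𝒯.LacunaryRight D (lo j) T P, a j P ^ 2) := by
      rw [Finset.sum_filter, Finset.sum_filter, ← Finset.sum_add_distrib, Finset.mul_sum]
      refine Finset.sum_le_sum fun P _ => ?_
      have h4 : (a j P / μ j) ^ 2 = (μ j ^ 2)⁻¹ * a j P ^ 2 := by field_simp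
      have h5 : 0 ≤ (μ j ^ 2)⁻¹ * a j P ^ 2 := by positivity
      simp only [hb, lac, h4]
      by_cases c1 : 𝒯.Lacunary D (hi j) T P <;> by_cases c2 : 𝒯.LacunaryRight D (lo j) T P <;>
        simp only [c1, c2, or_true, true_or, or_self, if_true, if_false] <;> linarith
    calc _ ≤ _ := h3
      _ ≤ (μ j ^ 2)⁻¹ * (μ j ^ 2 * 2 ^ T.scale + μ j ^ 2 * 2 ^ T.scale) := by gcongr
      _ = _ := by field_simp; ring
  have hprod0 : 0 < ∏ j, μ j := Finset.prod_pos fun j _ => hμ j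
  have hpt : ∀ P ∈ 𝒬.filter (fun P => 𝒯.InTree D T P),
      (√(2 ^ 𝒯.scale P))⁻¹ * ∏ j, a j P ≤ (∏ j, μ j) * ∑ j, b j P := by
    intro P hP
    obtain ⟨hP, hin⟩ := Finset.mem_filter.mp hP
    set t := √(2 ^ 𝒯.scale P) with ht
    have ht0 : 0 < t := by positivity
    have hlac : ∀ j, ¬ lac j P → lo j - 1 < T.freq * 2 ^ 𝒯.scale P - 𝒯.freq P ∧
        T.freq * 2 ^ 𝒯.scale P - 𝒯.freq P < hi j + 1 := by
      intro j hj
      simp only [lac, Lacunary, LacunaryRight, hin, true_and, not_or, not_le] at hj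
      exact ⟨hj.2, hj.1⟩
    have htwo : ∀ i j, i ≠ j → lac i P ∨ lac j P := by
      intro i j hij
      by_contra hcon
      rw [not_or] at hcon
      have h1 := hlac i hcon.1
      have h2 := hlac j hcon.2
      rcases hsep i j hij with h3 | h3 <;> linarith [h1.1, h1.2, h2.1, h2.2]
    set u : Fin 3 → ℝ := fun j => a j P / μ j with hu
    have hu0 : ∀ j, 0 ≤ u j := fun j => div_nonneg (ha j P) (hμ j).le
    have hut : ∀ j, u j ≤ t := fun j => by
      rw [hu, div_le_iff₀ (hμ j), mul_comm]
      exact (h j).le_mul_sqrt (hμ j).le hP (hΞ P hP j)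
    have hau : ∀ j, a j P = μ j * u j := fun j => by
      have := (hμ j).ne'
      simp only [hu]; field_simp
    have key : ∀ i j m, lac i P → lac j P → u i * u j * u m ≤ t * (b i P + b j P) := by
      intro i j m hi' hj'
      have e1 : b i P = u i ^ 2 := by simp only [hb, hi', if_true, hu]
      have e2 : b j P = u j ^ 2 := by simp only [hb, hj', if_true, hu]
      rw [e1, e2]
      calc u i * u j * u m ≤ u i * u j * t :=
            mul_le_mul_of_nonneg_left (hut m) (mul_nonneg (hu0 i) (hu0 j))
        _ ≤ (u i ^ 2 + u j ^ 2) * t := by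
            gcongr
            nlinarith [sq_nonneg (u i - u j), sq_nonneg (u i), sq_nonneg (u j)]
        _ = _ := by ring
    have hmain : u 0 * u 1 * u 2 ≤ t * (b 0 P + b 1 P + b 2 P) := by
      have hbt : ∀ j, 0 ≤ t * b j P := fun j => mul_nonneg ht0.le (hb0 j P)
      have hb0' := hbt 0
      have hb1' := hbt 1
      have hb2' := hbt 2
      by_cases c0 : lac 0 P
      · rcases htwo 1 2 (by decide) with c | c
        · have := key 0 1 2 c0 c
          linarith
        · have := key 0 2 1 c0 c
          linarith
      · have c1 := (htwo 0 1 (by decide)).resolve_left c0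
        have c2 := (htwo 0 2 (by decide)).resolve_left c0
        have := key 1 2 0 c1 c2
        linarith
    rw [Fin.prod_univ_three, Fin.prod_univ_three, Fin.sum_univ_three, hau 0, hau 1, hau 2]
    have hm : 0 ≤ μ 0 * μ 1 * μ 2 := by
      have := hμ 0; have := hμ 1; have := hμ 2
      positivity
    calc t⁻¹ * (μ 0 * u 0 * (μ 1 * u 1) * (μ 2 * u 2))
        = (μ 0 * μ 1 * μ 2) * (t⁻¹ * (u 0 * u 1 * u 2)) := by ring
      _ ≤ (μ 0 * μ 1 * μ 2) * (t⁻¹ * (t * (b 0 P + b 1 P + b 2 P))) := by gcongr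
      _ = _ := by rw [inv_mul_cancel_left₀ ht0.ne']
  calc _ ≤ ∑ P ∈ 𝒬 with 𝒯.InTree D T P, (∏ j, μ j) * ∑ j, b j P := Finset.sum_le_sum hpt
    _ ≤ ∑ P ∈ 𝒬, (∏ j, μ j) * ∑ j, b j P :=
      Finset.sum_le_sum_of_subset_of_nonneg (Finset.filter_subset _ _) fun P _ _ =>
        mul_nonneg hprod0.le (Finset.sum_nonneg fun j _ => hb0 j P)
    _ = (∏ j, μ j) * ∑ j, ∑ P ∈ 𝒬, b j P := by rw [← Finset.mul_sum, Finset.sum_comm]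
    _ ≤ (∏ j, μ j) * ∑ j : Fin 3, 2 * 2 ^ T.scale := by
      gcongr with j
      exact hsum j
    _ = _ := by rw [Fin.sum_univ_three]; ring

end TileSystem

lemma sum_biUnion_le_sum {α β : Type*} [DecidableEq β] (s : Finset α) (t : α → Finset β)
    {f : β → ℝ} (hf : ∀ x, 0 ≤ f x) : ∑ x ∈ s.biUnion t, f x ≤ ∑ i ∈ s, ∑ x ∈ t i, f x := by
  classical
  induction s using Finset.induction_on with
  | empty => simp
  | insert a s ha ih =>
    rw [Finset.biUnion_insert, Finset.sum_insert ha]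
    have h1 := Finset.sum_union_inter (s₁ := t a) (s₂ := s.biUnion t) (f := f)
    have h2 : 0 ≤ ∑ x ∈ t a ∩ s.biUnion t, f x := Finset.sum_nonneg fun x _ => hf x
    linarith

lemma sum_zpow_le {σ : ℝ} (hσ : 1 < σ) {N : ℤ} {S : Finset ℤ} (hS : ∀ n ∈ S, n ≤ N) :
    ∑ n ∈ S, σ ^ n ≤ σ ^ N * (σ / (σ - 1)) := by
  have h0 : 0 < σ := by linarith
  have h1 : σ⁻¹ < 1 := inv_lt_one_of_one_lt₀ hσ
  have h2 : 0 ≤ σ⁻¹ := by positivity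
  have hinj : Set.InjOn (fun n : ℤ => (N - n).toNat) S := by
    intro a ha b hb hab
    have := hS a ha
    have := hS b hb
    simp only at hab
    omega
  calc ∑ n ∈ S, σ ^ n = ∑ n ∈ S, σ ^ N * σ⁻¹ ^ ((N - n).toNat) := by
        refine Finset.sum_congr rfl fun n hn => ?_
        have : ((N - n).toNat : ℤ) = N - n := Int.toNat_of_nonneg (by linarith [hS n hn])
        rw [← zpow_natCast, this, inv_zpow', ← zpow_add₀ h0.ne']
        congr 1
        ring
    _ = σ ^ N * ∑ i ∈ S.image (fun n => (N - n).toNat), σ⁻¹ ^ i := by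
        rw [Finset.sum_image hinj, Finset.mul_sum]
    _ ≤ σ ^ N * ∑' i : ℕ, σ⁻¹ ^ i := by
        gcongr
        exact (summable_geometric_of_lt_one h2 h1).sum_le_tsum _ (fun _ _ => by positivity)
    _ = _ := by
        rw [tsum_geometric_of_lt_one h2 h1]
        have : σ - 1 ≠ 0 := by linarith
        congr 1
        field_simp

lemma sum_zpow_lt_le {ρ p : ℝ} (hρ : 1 < ρ) (hσ : 1 < 4 / ρ ^ 2) (hp : 2 < p)
    (hρp : ρ ^ p = 4) {y : ℝ} (hy : 0 ≤ y) (S : Finset ℤ) :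
    ∑ n ∈ S with ρ ^ n < y, (4 / ρ ^ 2) ^ n ≤
      (4 / ρ ^ 2) / (4 / ρ ^ 2 - 1) * y ^ (p - 2) := by
  have h0 : 0 < ρ := by linarith
  have hσ1 : 0 < 4 / ρ ^ 2 - 1 := by linarith
  rcases (S.filter fun n : ℤ => ρ ^ n < y).eq_empty_or_nonempty with h | h
  · rw [h, Finset.sum_empty]; positivity
  · set N := (S.filter fun n : ℤ => ρ ^ n < y).max' h
    have hN : ρ ^ N < y := (Finset.mem_filter.mp (Finset.max'_mem _ h)).2
    refine (sum_zpow_le hσ (N := N) fun n hn => Finset.le_max' _ n hn).trans ?_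
    rw [mul_comm]
    gcongr
    have e : 4 / ρ ^ 2 = ρ ^ (p - 2) := by
      rw [Real.rpow_sub h0, hρp, Real.rpow_two]
    rw [e]
    calc (ρ ^ (p - 2)) ^ N = (ρ ^ N) ^ (p - 2) := by
          rw [← Real.rpow_intCast, ← Real.rpow_mul h0.le, mul_comm, Real.rpow_mul h0.le,
            Real.rpow_intCast]
      _ ≤ _ := Real.rpow_le_rpow (by positivity) hN.le (by linarith)

lemma sum_large_values_le {E : Type*} [NormedAddCommGroup E] {ρ p c : ℝ} (hρ : 1 < ρ)
    (hσ : 1 < 4 / ρ ^ 2) (hp : 2 < p) (hρp : ρ ^ p = 4) (hc : 0 < c) (X : Finset ℤ) (A : ℤ → E)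
    (S : Finset ℤ) :
    ∑ n ∈ S, (4 / ρ ^ 2) ^ n * ∑ x ∈ X with c * ρ ^ n < ‖A x‖, ‖A x‖ ^ 2 ≤
      ((4 / ρ ^ 2) / (4 / ρ ^ 2 - 1) * c⁻¹ ^ (p - 2)) * ∑ x ∈ X, ‖A x‖ ^ p := by
  calc _ = ∑ x ∈ X, ‖A x‖ ^ 2 * ∑ n ∈ S with ρ ^ n < c⁻¹ * ‖A x‖, (4 / ρ ^ 2) ^ n := by
        simp only [Finset.mul_sum, Finset.sum_filter]
        rw [Finset.sum_comm]
        refine Finset.sum_congr rfl fun x _ => Finset.sum_congr rfl fun n _ => ?_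
        have : c * ρ ^ n < ‖A x‖ ↔ ρ ^ n < c⁻¹ * ‖A x‖ := by
          rw [inv_mul_eq_div, lt_div_iff₀ hc, mul_comm]
        simp only [this]
        split_ifs
        · ring
        · simp
    _ ≤ ∑ x ∈ X, ‖A x‖ ^ 2 * ((4 / ρ ^ 2) / (4 / ρ ^ 2 - 1) * (c⁻¹ * ‖A x‖) ^ (p - 2)) := by
        refine Finset.sum_le_sum fun x _ => ?_
        gcongr
        exact sum_zpow_lt_le hρ hσ hp hρp (by positivity) S
    _ = _ := by
        rw [Finset.mul_sum]
        refine Finset.sum_congr rfl fun x _ => ?_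
        rw [Real.mul_rpow (by positivity) (norm_nonneg _)]
        rcases (norm_nonneg (A x)).eq_or_lt with h | h
        · rw [← h, Real.zero_rpow (by linarith), Real.zero_rpow (by linarith)]; simp
        · rw [show p = 2 + (p - 2) by ring, Real.rpow_add h, Real.rpow_two]
          ring_nf

namespace TileSystem

variable {ι : Type*} {H : Fin 3 → Type*} [∀ j, NormedAddCommGroup (H j)]
  [∀ j, InnerProductSpace ℂ (H j)]

/-- Three families of wave packets on a common tile system, with separated windows. -/
structure IsModel (𝒯 : TileSystem ι) (D : ℝ) (M : ℕ) (lo hi : Fin 3 → ℝ) (K : ℝ)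
    (φ : Fin 3 → ι → ℤ → ℂ) : Prop where
  packet : ∀ j, 𝒯.IsPacketFamily (lo j) (hi j) K (φ j)
  le_lo : ∀ j, 1 - D ≤ lo j
  lo_le_hi : ∀ j, lo j ≤ hi j
  hi_le : ∀ j, hi j + 1 ≤ D
  lt_two_pow : 4 * D < 2 ^ M
  separated : ∀ i j, i ≠ j → hi i + 1 ≤ lo j - 1 ∨ hi j + 1 ≤ lo i - 1

/-- The contribution of one tile to the model form. -/
noncomputable def weight (𝒯 : TileSystem ι) (φ : Fin 3 → ι → ℤ → ℂ) (X : Finset ℤ)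
    (A : ∀ j, ℤ → H j) (P : ι) : ℝ :=
  (√(2 ^ 𝒯.scale P))⁻¹ * ∏ j, ‖coef (φ j) X (A j) P‖

variable {𝒯 : TileSystem ι} {D K : ℝ} {M : ℕ} {lo hi : Fin 3 → ℝ} {φ : Fin 3 → ι → ℤ → ℂ}
  {X : Finset ℤ} {A : ∀ j, ℤ → H j}

lemma weight_nonneg (P : ι) : 0 ≤ 𝒯.weight φ X A P := by
  unfold weight
  have : 0 ≤ ∏ j, ‖coef (φ j) X (A j) P‖ := Finset.prod_nonneg fun _ _ => norm_nonneg _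
  positivity

/-- One step of the stopping time argument. -/
theorem IsModel.exists_step (h : 𝒯.IsModel D M lo hi K φ) {𝒬 : Finset ι} (hsp : 𝒯.Sparse M 𝒬)
    {Ξ : Finset ℝ} (hΞ : ∀ P ∈ 𝒬, ∀ j, ∃ T : TreeTop, T.freq ∈ Ξ ∧ 𝒯.Lacunary D (hi j) T P)
    {μ ν : Fin 3 → ℝ} (hμ : ∀ j, 0 < μ j) (hμν : ∀ j, μ j ≤ ν j) (hνμ : ∀ j, ν j ≤ 2 * μ j)
    {c : ℝ} (hc : 0 ≤ c) (hc' : ∀ j, 4 * boundConst D (lo j) (hi j) K * c ^ 2 ≤ 1)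
    (hsize : ∀ j, 𝒯.SizeLE D (lo j) (hi j) Ξ (fun P => ‖coef (φ j) X (A j) P‖) (ν j) 𝒬) :
    ∃ 𝒬' ⊆ 𝒬,
      (∀ j, 𝒯.SizeLE D (lo j) (hi j) Ξ (fun P => ‖coef (φ j) X (A j) P‖) (μ j) 𝒬') ∧
      ∑ P ∈ 𝒬, 𝒯.weight φ X A P ≤ ∑ P ∈ 𝒬', 𝒯.weight φ X A P +
        6 * (∏ j, ν j) * ∑ j, (μ j ^ 2)⁻¹ * (2 * energyConst D (lo j) (hi j) K *
          ∑ x ∈ X with c * μ j < ‖A j x‖, ‖A j x‖ ^ 2) := by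
  classical
  have hν : ∀ j, 0 < ν j := fun j => (hμ j).trans_le (hμν j)
  have hsel := fun j => (h.packet j).exists_tops_sizeLE (h.le_lo j) (h.lo_le_hi j) (h.hi_le j)
    h.lt_two_pow hsp (X := X) (A := A j) (hμ j) hc (hc' j) Ξ
    ((hsize j).mono subset_rfl (hν j).le (hνμ j))
  choose F hF1 hF2 hF3 using hsel
  refine ⟨𝒬.filter fun P => ∀ j, ∀ T ∈ F j, ¬ 𝒯.InTree D T P, Finset.filter_subset _ _, ?_, ?_⟩
  · intro j
    refine (hF3 j).mono ?_ (hμ j).le le_rfl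
    intro P hP
    rw [Finset.mem_filter] at *
    exact ⟨hP.1, hP.2 j⟩
  · rw [← Finset.sum_filter_add_sum_filter_not 𝒬 (fun P => ∀ j, ∀ T ∈ F j, ¬ 𝒯.InTree D T P)]
    gcongr
    have hcover : 𝒬.filter (fun P => ¬ ∀ j, ∀ T ∈ F j, ¬ 𝒯.InTree D T P) ⊆
        Finset.univ.biUnion fun j => (F j).biUnion fun T => 𝒬.filter fun P => 𝒯.InTree D T P := by
      intro P hP
      rw [Finset.mem_filter] at hP
      push Not at hP
      obtain ⟨hP, j, T, hT, hin⟩ := hP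
      simp only [Finset.mem_biUnion, Finset.mem_univ, true_and, Finset.mem_filter]
      exact ⟨j, T, hT, hP, hin⟩
    have hprod : 0 < ∏ j, ν j := Finset.prod_pos fun j _ => hν j
    calc _ ≤ ∑ P ∈ Finset.univ.biUnion fun j => (F j).biUnion fun T =>
            𝒬.filter fun P => 𝒯.InTree D T P, 𝒯.weight φ X A P :=
          Finset.sum_le_sum_of_subset_of_nonneg hcover fun _ _ _ => weight_nonneg _
      _ ≤ ∑ j, ∑ T ∈ F j, ∑ P ∈ 𝒬 with 𝒯.InTree D T P, 𝒯.weight φ X A P := by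
          refine (sum_biUnion_le_sum _ _ fun _ => weight_nonneg _).trans ?_
          exact Finset.sum_le_sum fun j _ => sum_biUnion_le_sum _ _ fun _ => weight_nonneg _
      _ ≤ ∑ j, ∑ T ∈ F j, 6 * (∏ j, ν j) * 2 ^ T.scale := by
          refine Finset.sum_le_sum fun j _ => Finset.sum_le_sum fun T hT => ?_
          exact sum_tree_prod_le h.separated (fun _ _ => norm_nonneg _) hν hsize hΞ (hF1 j T hT)
      _ = 6 * (∏ j, ν j) * ∑ j, ∑ T ∈ F j, (2 : ℝ) ^ T.scale := by
          simp only [Finset.mul_sum]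
      _ ≤ _ := by
          gcongr with j
          have := hμ j
          rw [← div_eq_inv_mul, le_div_iff₀ (by positivity), mul_comm]
          exact hF2 j

lemma exists_sizeLE (D lo hi : ℝ) (Ξ : Finset ℝ) (a : ι → ℝ) (𝒬 : Finset ι) {ρ : ℝ}
    (hρ : 1 < ρ) : ∃ N₀ : ℕ, ∀ N : ℕ, N₀ ≤ N → 𝒯.SizeLE D lo hi Ξ a (ρ ^ (N : ℤ)) 𝒬 := by
  classical
  obtain ⟨N₀, h⟩ := pow_unbounded_of_one_lt (∑ P ∈ 𝒬, a P ^ 2) hρ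
  refine ⟨N₀, fun N hN T _ => ?_⟩
  have h1 : ∑ P ∈ 𝒬, a P ^ 2 ≤ (ρ ^ (N : ℤ)) ^ 2 * 2 ^ T.scale := by
    have h2 : ρ ^ N₀ ≤ ρ ^ N := pow_le_pow_right₀ hρ.le hN
    have h3 : 1 ≤ ρ ^ N := one_le_pow₀ hρ.le
    have h4 := one_le_two_pow_real T.scale
    rw [zpow_natCast]
    nlinarith
  constructor
  all_goals
    refine (Finset.sum_le_sum_of_subset_of_nonneg (Finset.filter_subset _ _)
      fun _ _ _ => by positivity).trans h1

variable (ι H) in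
/-- The bound for the discretized trilinear form. -/
theorem exists_model_bound (D K : ℝ) (M : ℕ) (lo hi : Fin 3 → ℝ) (p : Fin 3 → ℝ)
    (hp : ∀ j, 2 < p j) (hps : ∑ j, 1 / p j = 1) :
    ∃ C : ℝ, 0 ≤ C ∧ ∀ (𝒯 : TileSystem ι) (φ : Fin 3 → ι → ℤ → ℂ), 𝒯.IsModel D M lo hi K φ →
      ∀ (𝒬 : Finset ι), 𝒯.Sparse M 𝒬 → ∀ (X : Finset ℤ) (A : ∀ j, ℤ → H j),
        (∀ j, ∑ x ∈ X, ‖A j x‖ ^ p j ≤ 1) → ∑ P ∈ 𝒬, 𝒯.weight φ X A P ≤ C := by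
  classical
  by_cases hlohi : (∀ j, 1 - D ≤ lo j) ∧ (∀ j, lo j ≤ hi j) ∧ ∀ j, hi j + 1 ≤ D
  swap
  · refine ⟨0, le_rfl, fun 𝒯 φ h => absurd ⟨h.le_lo, h.lo_le_hi, h.hi_le⟩ hlohi⟩
  obtain ⟨hlo, hlh, hhi⟩ := hlohi
  have hbC : ∀ j, 0 ≤ boundConst D (lo j) (hi j) K := fun j =>
    boundConst_nonneg (hlo j) (hlh j) (hhi j)
  have hE : ∀ j, 0 ≤ energyConst D (lo j) (hi j) K := fun j =>
    energyConst_nonneg (hlo j) (hlh j) (hhi j)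
  set B : ℝ := 1 + ∑ j, 4 * boundConst D (lo j) (hi j) K with hB
  have hB1 : ∀ j, 4 * boundConst D (lo j) (hi j) K ≤ B := fun j => by
    have := Finset.single_le_sum (f := fun j => 4 * boundConst D (lo j) (hi j) K)
      (fun j _ => mul_nonneg (by norm_num) (hbC j)) (Finset.mem_univ j)
    linarith
  have hB2 : 1 ≤ B := by
    have := Finset.sum_nonneg (s := Finset.univ) (f := fun j => 4 * boundConst D (lo j) (hi j) K)
      (fun j _ => mul_nonneg (by norm_num) (hbC j))
    linarith
  set c : ℝ := B⁻¹ with hcdef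
  have hc : 0 < c := by positivity
  have hc1 : c ≤ 1 := inv_le_one_of_one_le₀ hB2
  have hc' : ∀ j, 4 * boundConst D (lo j) (hi j) K * c ^ 2 ≤ 1 := fun j => by
    calc _ ≤ B * c ^ 2 := by gcongr; exact hB1 j
      _ = c := by rw [hcdef]; field_simp
      _ ≤ 1 := hc1
  set ρ : Fin 3 → ℝ := fun j => (4 : ℝ) ^ (p j)⁻¹ with hρdef
  have hρp : ∀ j, ρ j ^ p j = 4 := fun j => by
    have := hp j
    exact Real.rpow_inv_rpow (by norm_num) (by linarith)
  have hρ1 : ∀ j, 1 < ρ j := fun j => by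
    have := hp j
    exact Real.one_lt_rpow (by norm_num) (by positivity)
  have hρ2 : ∀ j, ρ j < 2 := fun j => by
    have := hp j
    calc ρ j < (4 : ℝ) ^ (1 / 2 : ℝ) := Real.rpow_lt_rpow_of_exponent_lt (by norm_num)
            (by rw [one_div]; exact inv_strictAnti₀ (by norm_num) this)
      _ = 2 := by
        rw [show (4 : ℝ) = 2 ^ (2 : ℝ) by norm_num, ← Real.rpow_mul (by norm_num)]; norm_num
  have hρprod : ∏ j, ρ j = 4 := by
    simp only [hρdef]
    rw [← Real.rpow_sum_of_pos (by norm_num)]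
    simp only [one_div] at hps
    rw [hps, Real.rpow_one]
  have hσ : ∀ j, 1 < 4 / ρ j ^ 2 := fun j => by
    have := hρ1 j
    rw [one_lt_div (by positivity)]
    nlinarith [hρ2 j]
  set G : Fin 3 → ℝ := fun j => (4 / ρ j ^ 2) / (4 / ρ j ^ 2 - 1) * c⁻¹ ^ (p j - 2) with hG
  have hG0 : ∀ j, 0 ≤ G j := fun j => by
    have := hσ j
    have : 0 < 4 / ρ j ^ 2 - 1 := by linarith
    positivity
  refine ⟨24 * ∑ j, 2 * energyConst D (lo j) (hi j) K * G j, ?_, ?_⟩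
  · have : 0 ≤ ∑ j, 2 * energyConst D (lo j) (hi j) K * G j :=
      Finset.sum_nonneg fun j _ => mul_nonneg (mul_nonneg (by norm_num) (hE j)) (hG0 j)
    positivity
  intro 𝒯 φ h 𝒬 hsp X A hA
  set w := 𝒯.weight φ X A
  set Ξ : Finset ℝ := Finset.univ.biUnion fun j : Fin 3 =>
    𝒬.image fun P => ((𝒯.freq P : ℝ) + hi j + 1) / 2 ^ 𝒯.scale P with hΞdef
  have hΞ : ∀ P ∈ 𝒬, ∀ j, ∃ T : TreeTop, T.freq ∈ Ξ ∧ 𝒯.Lacunary D (hi j) T P := by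
    intro P hP j
    refine ⟨⟨𝒯.scale P, 𝒯.pos P, ((𝒯.freq P : ℝ) + hi j + 1) / 2 ^ 𝒯.scale P⟩, ?_, ?_⟩
    · rw [hΞdef, Finset.mem_biUnion]
      exact ⟨j, Finset.mem_univ _, Finset.mem_image_of_mem _ hP⟩
    · have e : ((𝒯.freq P : ℝ) + hi j + 1) / 2 ^ 𝒯.scale P * 2 ^ 𝒯.scale P - 𝒯.freq P =
          hi j + 1 := by
        rw [div_mul_cancel₀ _ (by positivity)]; ring
      refine ⟨⟨le_rfl, subset_rfl, ?_⟩, ?_⟩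
      · rw [e, abs_le]
        constructor <;> linarith [hlo j, hlh j, hhi j]
      · rw [e]
  set V : Fin 3 → ℤ → ℝ := fun j n => ∑ x ∈ X with c * ρ j ^ n < ‖A j x‖, ‖A j x‖ ^ 2 with hV
  choose N₀ hN₀ using fun j => exists_sizeLE (𝒯 := 𝒯) D (lo j) (hi j) Ξ
    (fun P => ‖coef (φ j) X (A j) P‖) 𝒬 (hρ1 j)
  set N : ℕ := ∑ j, N₀ j with hN
  have hstart : ∀ j, 𝒯.SizeLE D (lo j) (hi j) Ξ (fun P => ‖coef (φ j) X (A j) P‖)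
      (ρ j ^ (N : ℤ)) 𝒬 := fun j => hN₀ j N
    (Finset.single_le_sum (f := N₀) (fun _ _ => Nat.zero_le _) (Finset.mem_univ j))
  have hzprod : ∀ n : ℤ, ∏ j, ρ j ^ n = 4 ^ n := fun n => by
    rw [Finset.prod_zpow, hρprod]
  have iter : ∀ k : ℕ, ∃ 𝒬' ⊆ 𝒬,
      (∀ j, 𝒯.SizeLE D (lo j) (hi j) Ξ (fun P => ‖coef (φ j) X (A j) P‖)
        (ρ j ^ ((N : ℤ) - k)) 𝒬') ∧
      ∑ P ∈ 𝒬, w P ≤ ∑ P ∈ 𝒬', w P + ∑ n ∈ Finset.Ico ((N : ℤ) - k) N,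
        24 * ∑ j, 2 * energyConst D (lo j) (hi j) K * ((4 / ρ j ^ 2) ^ n * V j n) := by
    intro k
    induction k with
    | zero => exact ⟨𝒬, subset_rfl, by simpa using hstart, by simp⟩
    | succ k ih =>
      obtain ⟨𝒬₁, hs1, hsize, hsum⟩ := ih
      set n : ℤ := (N : ℤ) - k - 1 with hn
      have hn1 : (N : ℤ) - k = n + 1 := by omega
      have hn2 : (N : ℤ) - (k + 1 : ℕ) = n := by push_cast; omega
      rw [hn1] at hsize hsum
      have hstep : ∀ j, ρ j ^ (n + 1) = ρ j ^ n * ρ j := fun j =>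
        zpow_add_one₀ (by have := hρ1 j; positivity) n
      have hpos : ∀ j, 0 < ρ j ^ n := fun j => by have := hρ1 j; positivity
      obtain ⟨𝒬₂, hs2, hsize2, hsum2⟩ := h.exists_step (𝒬 := 𝒬₁)
        (fun P hP Q hQ hlt => hsp P (hs1 hP) Q (hs1 hQ) hlt) (fun P hP => hΞ P (hs1 hP))
        (μ := fun j => ρ j ^ n) (ν := fun j => ρ j ^ (n + 1)) hpos
        (fun j => by rw [hstep]; nlinarith [hpos j, hρ1 j])
        (fun j => by rw [hstep]; nlinarith [hpos j, hρ2 j]) hc.le hc' hsize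
      rw [hn2]
      refine ⟨𝒬₂, hs2.trans hs1, hsize2, ?_⟩
      have hlt : n < N := by omega
      rw [← Finset.sum_Ioo_add_eq_sum_Ico hlt]
      have hIoo : Finset.Ioo n (N : ℤ) = Finset.Ico (n + 1) N := by
        ext x; simp only [Finset.mem_Ioo, Finset.mem_Ico]; omega
      rw [hIoo]
      have e : 6 * (∏ j, ρ j ^ (n + 1)) * ∑ j, ((ρ j ^ n) ^ 2)⁻¹ *
          (2 * energyConst D (lo j) (hi j) K * V j n) =
          24 * ∑ j, 2 * energyConst D (lo j) (hi j) K * ((4 / ρ j ^ 2) ^ n * V j n) := by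
        rw [hzprod, Finset.mul_sum, Finset.mul_sum]
        refine Finset.sum_congr rfl fun j _ => ?_
        have h1 : (ρ j ^ n) ^ 2 = (ρ j ^ 2) ^ n := by
          rw [← zpow_natCast, ← zpow_natCast, ← zpow_mul, ← zpow_mul, mul_comm]
        rw [h1, div_zpow, zpow_add_one₀ (by norm_num)]
        ring
      have hsum2' : ∑ P ∈ 𝒬₁, w P ≤ ∑ P ∈ 𝒬₂, w P + 6 * (∏ j, ρ j ^ (n + 1)) *
        ∑ j, ((ρ j ^ n) ^ 2)⁻¹ * (2 * energyConst D (lo j) (hi j) K * V j n) := hsum2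
      rw [e] at hsum2'
      linarith
  have htotal : ∀ S : Finset ℤ, ∑ n ∈ S, 24 * ∑ j, 2 * energyConst D (lo j) (hi j) K *
      ((4 / ρ j ^ 2) ^ n * V j n) ≤ 24 * ∑ j, 2 * energyConst D (lo j) (hi j) K * G j := by
    intro S
    rw [← Finset.mul_sum, Finset.sum_comm]
    gcongr with j
    rw [← Finset.mul_sum]
    have := hE j
    gcongr
    refine (sum_large_values_le (hρ1 j) (hσ j) (hp j) (hρp j) hc X (A j) S).trans ?_
    exact mul_le_of_le_one_right (hG0 j) (hA j)
  set W : ℝ := ∑ P ∈ 𝒬, (2 : ℝ) ^ 𝒯.scale P with hW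
  have hrest : ∀ k : ℕ, ∑ P ∈ 𝒬, w P ≤ W * 4 ^ ((N : ℤ) - k) +
      24 * ∑ j, 2 * energyConst D (lo j) (hi j) K * G j := by
    intro k
    obtain ⟨𝒬', hs, hsize, hsum⟩ := iter k
    refine hsum.trans (add_le_add ?_ (htotal _))
    rw [hW, Finset.sum_mul]
    refine le_trans (Finset.sum_le_sum fun P hP => ?_)
      (Finset.sum_le_sum_of_subset_of_nonneg hs fun _ _ _ => by positivity)
    have h1 : ∏ j, ‖coef (φ j) X (A j) P‖ ≤
        ∏ j, (ρ j ^ ((N : ℤ) - k) * √(2 ^ 𝒯.scale P)) := by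
      refine Finset.prod_le_prod (fun _ _ => norm_nonneg _) fun j _ => ?_
      exact (hsize j).le_mul_sqrt (by have := hρ1 j; positivity) hP (hΞ P (hs hP) j)
    rw [Finset.prod_mul_distrib, hzprod, Finset.prod_const, Finset.card_univ,
      Fintype.card_fin] at h1
    calc w P ≤ (√(2 ^ 𝒯.scale P))⁻¹ * (4 ^ ((N : ℤ) - k) * √(2 ^ 𝒯.scale P) ^ 3) := by
          simp only [w, weight]
          gcongr
      _ = √(2 ^ 𝒯.scale P) ^ 2 * 4 ^ ((N : ℤ) - k) := by
          have : √((2 : ℝ) ^ 𝒯.scale P) ≠ 0 := by positivity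
          field_simp
      _ = _ := by rw [Real.sq_sqrt (by positivity)]
  have hlim : Filter.Tendsto (fun k : ℕ => W * (4 : ℝ) ^ ((N : ℤ) - k) +
      24 * ∑ j, 2 * energyConst D (lo j) (hi j) K * G j) Filter.atTop
      (nhds (W * 0 + 24 * ∑ j, 2 * energyConst D (lo j) (hi j) K * G j)) := by
    refine Filter.Tendsto.add_const _ (Filter.Tendsto.const_mul _ ?_)
    have h1 : Filter.Tendsto (fun k : ℕ => (4 : ℝ) ^ (N : ℤ) * (4⁻¹ : ℝ) ^ k) Filter.atTop
        (nhds ((4 : ℝ) ^ (N : ℤ) * 0)) :=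
      (tendsto_pow_atTop_nhds_zero_of_lt_one (by norm_num) (by norm_num)).const_mul _
    rw [mul_zero] at h1
    refine h1.congr fun k => ?_
    rw [zpow_sub₀ (by norm_num), inv_pow, zpow_natCast, zpow_natCast, div_eq_mul_inv]
  rw [mul_zero, zero_add] at hlim
  exact ge_of_tendsto' hlim hrest

end TileSystem

/-- The Fourier transform is supported in `[-R, R]`. -/
def BandLimited (f : 𝓢(ℝ, ℂ)) (R : ℝ) : Prop := ∀ ξ, R < |ξ| → 𝓕 f ξ = 0

lemma SchwartzMap.fourier_eq_fourierInv_neg (f : 𝓢(ℝ, ℂ)) (ξ : ℝ) : 𝓕 f ξ = 𝓕⁻ f (-ξ) := by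
  rw [SchwartzMap.fourier_coe, SchwartzMap.fourierInv_coe, Real.fourierInv_eq_fourier_neg, neg_neg]

lemma BandLimited.fourierInv {f : 𝓢(ℝ, ℂ)} {R : ℝ} (hf : BandLimited f R) {ξ : ℝ} (h : R < |ξ|) :
    𝓕⁻ f ξ = 0 := by
  have := hf (-ξ) (by rwa [abs_neg])
  rwa [SchwartzMap.fourier_eq_fourierInv_neg, neg_neg] at this

lemma SchwartzMap.convolution_eq_zero {f g : 𝓢(ℝ, ℂ)} {R R' : ℝ} (hf : ∀ x, R < |x| → f x = 0)
    (hg : ∀ x, R' < |x| → g x = 0) {x : ℝ} (hx : R + R' < |x|) :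
    SchwartzMap.convolution (ContinuousLinearMap.mul ℂ ℂ) f g x = 0 := by
  rw [SchwartzMap.convolution_apply, convolution_def]
  refine integral_eq_zero_of_ae (Filter.Eventually.of_forall fun y => ?_)
  simp only [ContinuousLinearMap.mul_apply', Pi.zero_apply, mul_eq_zero]
  by_contra! h
  have h1 : |y| ≤ R := not_lt.mp fun h' => h.1 (hf _ h')
  have h2 : |x - y| ≤ R' := not_lt.mp fun h' => h.2 (hg _ h')
  have h3 := abs_add_le y (x - y)
  rw [add_sub_cancel] at h3
  linarith

lemma BandLimited.mul {f g : 𝓢(ℝ, ℂ)} {R R' : ℝ} (hf : BandLimited f R) (hg : BandLimited g R') :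
    BandLimited (SchwartzMap.pairing (ContinuousLinearMap.mul ℂ ℂ) f g) (R + R') := by
  intro ξ hξ
  have h : SchwartzMap.pairing (ContinuousLinearMap.mul ℂ ℂ) f g =
      𝓕 (SchwartzMap.convolution (ContinuousLinearMap.mul ℂ ℂ) (𝓕⁻ f) (𝓕⁻ g)) := by
    rw [SchwartzMap.fourier_convolution]
    simp
  rw [h, SchwartzMap.fourier_eq_fourierInv_neg, FourierTransform.fourierInv_fourier_eq]
  exact SchwartzMap.convolution_eq_zero (fun x hx => hf.fourierInv hx)
    (fun x hx => hg.fourierInv hx) (by rwa [abs_neg])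

/-- The Schwartz function `x ↦ f ((x - z) / t)`. -/
noncomputable def SchwartzMap.rescale (z t : ℝ) (ht : 0 < t) (f : 𝓢(ℝ, ℂ)) : 𝓢(ℝ, ℂ) :=
  SchwartzMap.compCLM ℂ (g := fun x : ℝ => (x - z) / t)
    (by simp only [div_eq_mul_inv]; fun_prop)
    ⟨1, t + |z|, fun x => by
      have h : x = (x - z) / t * t + z := by field_simp; ring
      have h1 : ‖x‖ ≤ ‖(x - z) / t‖ * t + |z| := by
        conv_lhs => rw [h]
        refine (norm_add_le _ _).trans ?_
        rw [norm_mul, Real.norm_of_nonneg ht.le, Real.norm_eq_abs z]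
      have h2 : 0 ≤ ‖(x - z) / t‖ * |z| := by positivity
      nlinarith⟩ f

lemma SchwartzMap.rescale_apply {z t : ℝ} (ht : 0 < t) (f : 𝓢(ℝ, ℂ)) (x : ℝ) :
    f.rescale z t ht x = f ((x - z) / t) := rfl

lemma BandLimited.rescale {f : 𝓢(ℝ, ℂ)} {R z t : ℝ} (ht : 0 < t) (hf : BandLimited f R) :
    BandLimited (f.rescale z t ht) (R / t) := by
  intro ξ hξ
  have h0 := hf (t * ξ) (by rw [abs_mul, abs_of_pos ht]; rwa [div_lt_iff₀' ht] at hξ)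
  rw [SchwartzMap.fourier_coe, Real.fourier_real_eq_integral_exp_smul] at h0 ⊢
  have h1 := integral_sub_right_eq_self (μ := volume) (fun x : ℝ =>
    Complex.exp (↑(-2 * π * x * ξ) * Complex.I) • f (x / t)) z
  have h2 := Measure.integral_comp_div (fun x : ℝ =>
    Complex.exp (↑(-2 * π * x * (t * ξ)) * Complex.I) • f x) t
  rw [h0, smul_zero] at h2
  have h3 : ∀ x : ℝ, Complex.exp (↑(-2 * π * x * ξ) * Complex.I) • f.rescale z t ht x =
      Complex.exp (↑(-2 * π * z * ξ) * Complex.I) •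
        (Complex.exp (↑(-2 * π * (x - z) * ξ) * Complex.I) • f ((x - z) / t)) := by
    intro x
    rw [SchwartzMap.rescale_apply, smul_smul, ← Complex.exp_add]
    congr 2
    push_cast
    ring
  simp only [h3]
  rw [integral_smul, h1]
  have h4 : ∀ x : ℝ, -2 * π * x * ξ = -2 * π * (x / t) * (t * ξ) := fun x => by field_simp
  simp only [h4]
  rw [h2, smul_zero]

lemma BandLimited.tsum_eq_zero {f : 𝓢(ℝ, ℂ)} {R ω : ℝ} (hf : BandLimited f R)
    (hω : ∀ n : ℤ, R < |ω + n|) :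
    ∑' n : ℤ, f n * Complex.exp (↑(-2 * π * n * ω) * Complex.I) = 0 := by
  have h := SchwartzMap.tsum_eq_tsum_fourier (𝓕 f) ω
  simp only [hf _ (hω _), tsum_zero] at h
  rw [h, ← (Equiv.neg ℤ).tsum_eq]
  refine tsum_congr fun n => ?_
  rw [SchwartzMap.fourier_eq_fourierInv_neg, FourierTransform.fourierInv_fourier_eq,
    fourier_coe_apply]
  simp only [Equiv.neg_apply]
  push_cast
  rw [div_one]
  congr 2
  ring

/-- There is a nonzero nonnegative band-limited Schwartz function. -/
lemma exists_bandLimited : ∃ (f : 𝓢(ℝ, ℂ)) (ρ : ℝ → ℝ), (∀ x, f x = ρ x) ∧ (∀ x, 0 ≤ ρ x) ∧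
    0 < ρ 0 ∧ BandLimited f 1 := by
  let χ : ContDiffBump (0 : ℝ) := ⟨1 / 4, 1 / 2, by norm_num, by norm_num⟩
  have hc : HasCompactSupport (fun x => (χ x : ℂ)) :=
    χ.hasCompactSupport.comp_left (g := fun x : ℝ => (x : ℂ)) (by simp)
  let h : 𝓢(ℝ, ℂ) := hc.toSchwartzMap (Complex.ofRealCLM.contDiff.comp χ.contDiff)
  have hh : ∀ x, h x = χ x := fun x => rfl
  have hsupp : ∀ x, 1 / 2 < |x| → h x = 0 := fun x hx => by
    rw [hh, χ.zero_of_le_dist, Complex.ofReal_zero]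
    rw [dist_zero_right]
    exact hx.le
  have hreal : ∀ x, ∃ r : ℝ, 𝓕 h x = r := fun x => by
    have h1 : (starRingEnd ℂ) (𝓕 h x) = 𝓕 h x := by
      rw [SchwartzMap.fourier_coe, Real.fourier_real_eq_integral_exp_smul, ← integral_conj,
        ← integral_neg_eq_self]
      refine integral_congr_ae (Filter.Eventually.of_forall fun y => ?_)
      simp only [smul_eq_mul, map_mul, hh, ← Complex.exp_conj, Complex.conj_ofReal, Complex.conj_I]
      congr 2
      · push_cast; ring
      · rw [χ.neg]
    exact ⟨_, (Complex.conj_eq_iff_re.mp h1).symm⟩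
  choose r hr using hreal
  refine ⟨𝓕 (SchwartzMap.convolution (ContinuousLinearMap.mul ℂ ℂ) h h), fun x => r x * r x,
    fun x => ?_, fun x => mul_self_nonneg _, ?_, fun ξ hξ => ?_⟩
  · rw [SchwartzMap.fourier_convolution]
    simp [hr]
  · refine mul_self_pos.mpr fun h0 => ?_
    have h1 := hr 0
    rw [h0, SchwartzMap.fourier_coe, Real.fourier_real_eq_integral_exp_smul] at h1
    have h2 : ∫ y : ℝ, χ y = 0 := by
      rw [← Complex.ofReal_inj, ← integral_complex_ofReal]
      simpa [hh] using h1
    exact χ.integral_pos.ne' h2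
  · rw [SchwartzMap.fourier_eq_fourierInv_neg, FourierTransform.fourierInv_fourier_eq]
    exact SchwartzMap.convolution_eq_zero hsupp hsupp (by rw [abs_neg]; linarith)

lemma MeasureTheory.Integrable.continuous_fourier {f : ℝ → ℂ} (hf : Integrable f) :
    Continuous (𝓕 f) := by
  have : 𝓕 f = fun ξ => ∫ x : ℝ, Complex.exp (↑(-2 * π * x * ξ) * Complex.I) • f x := by
    ext ξ
    exact Real.fourier_real_eq_integral_exp_smul _ _
  rw [this]
  refine continuous_of_dominated (bound := fun x => ‖f x‖) (fun ξ => ?_) (fun ξ => ?_) hf.norm ?_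
  · have : Continuous fun x : ℝ => Complex.exp (↑(-2 * π * x * ξ) * Complex.I) := by fun_prop
    exact this.aestronglyMeasurable.smul hf.aestronglyMeasurable
  · refine Filter.Eventually.of_forall fun x => ?_
    rw [norm_smul, Complex.norm_exp_ofReal_mul_I, one_mul]
  · exact Filter.Eventually.of_forall fun x => by fun_prop

/-- The sine transform of an even function which is nonzero at the origin does not have compact
support. -/
lemma exists_sine_transform_ne_zero {G : ℝ → ℝ} (hc : Continuous G) (hi : Integrable G)
    (he : ∀ u, G (-u) = G u) (h0 : G 0 ≠ 0) (L : ℝ) :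
    ∃ α ≥ L, ∫ u in Ioi (0 : ℝ), Real.sin (2 * π * (2 * α) * u) * G u ≠ 0 := by
  by_contra! hz
  set h : ℝ → ℂ := fun u => if 0 < u then (G u : ℂ) else -(G u : ℂ) with hh
  have hInt : Integrable h := by
    refine Integrable.mono' hi.norm ?_ (Filter.Eventually.of_forall fun u => ?_)
    · exact (Measurable.ite measurableSet_Ioi (by fun_prop) (by fun_prop)).aestronglyMeasurable
    · simp only [hh]
      split_ifs <;> simp
  have hsin : ∀ β : ℝ, IntegrableOn (fun u => Real.sin (β * u) * G u) (Ioi 0) := fun β => by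
    refine Integrable.integrableOn ?_
    refine hi.bdd_mul (c := 1) (by fun_prop) (Filter.Eventually.of_forall fun u => ?_)
    rw [Real.norm_eq_abs]
    exact Real.abs_sin_le_one _
  have hF : ∀ ξ, 𝓕 h ξ = ((-2 * ∫ u in Ioi (0 : ℝ), Real.sin (2 * π * ξ * u) * G u : ℝ) : ℂ) *
      Complex.I := by
    intro ξ
    have hInt' : Integrable fun u : ℝ => Complex.exp (↑(-2 * π * u * ξ) * Complex.I) • h u := by
      refine hInt.bdd_mul (c := 1) (by fun_prop) (Filter.Eventually.of_forall fun u => ?_)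
      rw [Complex.norm_exp_ofReal_mul_I]
    rw [Real.fourier_real_eq_integral_exp_smul,
      ← intervalIntegral.integral_Iic_add_Ioi (b := 0) hInt'.integrableOn hInt'.integrableOn]
    have h1 := integral_comp_neg_Ioi (0 : ℝ)
      (fun u : ℝ => Complex.exp (↑(-2 * π * u * ξ) * Complex.I) • h u)
    rw [neg_zero] at h1
    rw [← h1, ← integral_add (hInt'.comp_neg.integrableOn) hInt'.integrableOn]
    rw [← integral_const_mul, ← integral_complex_ofReal, ← integral_mul_const]
    refine setIntegral_congr_fun measurableSet_Ioi fun u hu => ?_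
    rw [mem_Ioi] at hu
    simp only [hh, hu, if_true, Left.neg_pos_iff, not_lt.mpr hu.le, if_false, he, smul_eq_mul,
      Complex.exp_mul_I]
    push_cast
    rw [show (-2 * (π : ℂ) * -u * ξ) = 2 * π * ξ * u by ring,
      show (-2 * (π : ℂ) * u * ξ) = -(2 * π * ξ * u) by ring, Complex.cos_neg, Complex.sin_neg]
    ring
  have hzero : ∀ ξ, 2 * |L| < |ξ| → 𝓕 h ξ = 0 := by
    intro ξ hξ
    rw [hF]
    have key : ∫ u in Ioi (0 : ℝ), Real.sin (2 * π * ξ * u) * G u = 0 := by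
      have hL := le_abs_self L
      rcases le_total 0 ξ with h' | h'
      · rw [abs_of_nonneg h'] at hξ
        have := hz (ξ / 2) (by linarith)
        rwa [mul_div_cancel₀ _ (two_ne_zero)] at this
      · rw [abs_of_nonpos h'] at hξ
        have := hz (-ξ / 2) (by linarith)
        rw [mul_div_cancel₀ _ (two_ne_zero)] at this
        rw [← neg_eq_zero, ← integral_neg]
        refine Eq.trans ?_ this
        refine integral_congr_ae (Filter.Eventually.of_forall fun u => ?_)
        simp only [← neg_mul, ← Real.sin_neg]
        congr 2
        ring
    rw [key]
    simp
  have hFint : Integrable (𝓕 h) := by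
    refine hInt.continuous_fourier.integrable_of_hasCompactSupport ?_
    refine HasCompactSupport.of_support_subset_isCompact (isCompact_Icc (a := -(2 * |L|))
      (b := 2 * |L|)) fun ξ hξ => ?_
    rw [Set.mem_Icc, ← abs_le]
    exact not_lt.mp fun h' => hξ (hzero ξ h')
  set k : ℝ → ℂ := 𝓕⁻ (𝓕 h) with hk
  have hkc : Continuous k := by
    have : k = fun x => 𝓕 (𝓕 h) (-x) := by
      ext x
      rw [hk, Real.fourierInv_eq_fourier_neg]
    rw [this]
    exact hFint.continuous_fourier.comp continuous_neg
  have hGc : Continuous fun u : ℝ => (G u : ℂ) := by fun_prop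
  have hpos : ∀ v ∈ Ioi (0 : ℝ), k v = G v := fun v hv => by
    have : h =ᶠ[nhds v] fun u => (G u : ℂ) := by
      filter_upwards [Ioi_mem_nhds hv] with u hu
      simp only [hh, mem_Ioi.mp hu, if_true]
    rw [hk, hInt.fourierInv_fourier_eq hFint (hGc.continuousAt.congr this.symm), this.eq_of_nhds]
  have hneg : ∀ v ∈ Iio (0 : ℝ), k v = -G v := fun v hv => by
    have : h =ᶠ[nhds v] fun u => -(G u : ℂ) := by
      filter_upwards [Iio_mem_nhds hv] with u hu
      simp only [hh, not_lt.mpr (mem_Iio.mp hu).le, if_false]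
    rw [hk, hInt.fourierInv_fourier_eq hFint (hGc.neg.continuousAt.congr this.symm),
      this.eq_of_nhds]
  have e1 : k 0 = G 0 := tendsto_nhds_unique (f := k) (l := nhdsWithin 0 (Ioi 0))
    (hkc.continuousAt.mono_left nhdsWithin_le_nhds)
    ((hGc.continuousAt.mono_left nhdsWithin_le_nhds : Filter.Tendsto _ _ (nhds ((G 0 : ℝ) : ℂ))).congr'
      (by filter_upwards [self_mem_nhdsWithin] with v hv using (hpos v hv).symm))
  have e2 : k 0 = -G 0 := tendsto_nhds_unique (f := k) (l := nhdsWithin 0 (Iio 0))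
    (hkc.continuousAt.mono_left nhdsWithin_le_nhds)
    ((hGc.neg.continuousAt.mono_left nhdsWithin_le_nhds :
        Filter.Tendsto _ _ (nhds (-((G 0 : ℝ) : ℂ)))).congr'
      (by filter_upwards [self_mem_nhdsWithin] with v hv using (hneg v hv).symm))
  rw [e1] at e2
  have e3 : G 0 = -G 0 := by exact_mod_cast e2
  exact h0 (by linarith)

/-- A nonnegative band-limited bump function `ρ` with polynomial decay. -/
structure IsWindow (ρ : ℝ → ℝ) (K : ℝ) : Prop where
  bandLimited : ∃ f : 𝓢(ℝ, ℂ), (∀ x, f x = ρ x) ∧ BandLimited f 1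
  nonneg : ∀ x, 0 ≤ ρ x
  pos : 0 < ρ 0
  const_nonneg : 0 ≤ K
  bound : ∀ x, ρ x ≤ K * decay 1 x ^ 6

lemma exists_isWindow : ∃ ρ K, IsWindow ρ K := by
  obtain ⟨f, ρ, hf, h0, hp, hb⟩ := exists_bandLimited
  set K : ℝ := 2 ^ 6 * (Finset.Iic (6, 0)).sup (fun m => SchwartzMap.seminorm ℝ m.1 m.2) f
  have hK : ∀ x, ρ x ≤ K * decay 1 x ^ 6 := fun x => by
    have h := SchwartzMap.one_add_le_sup_seminorm_apply (𝕜 := ℝ) (m := (6, 0)) (k := 6) (n := 0)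
      le_rfl le_rfl f x
    rw [norm_iteratedFDeriv_zero, hf, Complex.norm_real, Real.norm_of_nonneg (h0 x),
      Real.norm_eq_abs] at h
    rw [decay, div_one, inv_pow, ← div_eq_mul_inv, le_div_iff₀ (by positivity), mul_comm]
    exact h
  refine ⟨ρ, K, ⟨f, hf, hb⟩, h0, hp, ?_, hK⟩
  by_contra! h
  have h1 := hK 0
  have h2 : 0 < decay 1 0 ^ 6 := pow_pos (decay_pos one_pos 0) 6
  nlinarith

/-- The correlation `∫ ρ(v + u) ρ(v - u) ρ(v) dv`. -/
noncomputable def tripleCorr (ρ : ℝ → ℝ) (u : ℝ) : ℝ := ∫ v, ρ (v + u) * ρ (v - u) * ρ v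

namespace IsWindow

variable {ρ : ℝ → ℝ} {K : ℝ}

lemma continuous (h : IsWindow ρ K) : Continuous ρ := by
  obtain ⟨f, hf, -⟩ := h.bandLimited
  have : ρ = fun x => (f x).re := by ext x; rw [hf, Complex.ofReal_re]
  rw [this]
  exact Complex.continuous_re.comp f.continuous

lemma integrable (h : IsWindow ρ K) : Integrable ρ := by
  obtain ⟨f, hf, -⟩ := h.bandLimited
  have : ρ = fun x => (f x).re := by ext x; rw [hf, Complex.ofReal_re]
  rw [this]
  exact f.integrable.re

lemma le_const (h : IsWindow ρ K) (x : ℝ) : ρ x ≤ K :=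
  (h.bound x).trans (mul_le_of_le_one_right h.const_nonneg
    (pow_le_one₀ (decay_pos one_pos x).le (decay_le_one one_pos x)))

lemma bound_sq (h : IsWindow ρ K) (x : ℝ) : ρ x ≤ K * decay 1 x ^ 2 :=
  (h.bound x).trans (mul_le_mul_of_nonneg_left (pow_le_pow_of_le_one (decay_pos one_pos x).le
    (decay_le_one one_pos x) (by norm_num)) h.const_nonneg)

lemma mul_le (h : IsWindow ρ K) (v u : ℝ) : ρ (v + u) * ρ (v - u) ≤ K ^ 2 * decay 1 u ^ 2 := by
  have key : |u| ≤ |v + u| ∨ |u| ≤ |v - u| := by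
    by_contra! h'
    have h1 := abs_sub (v + u) (v - u)
    rw [show v + u - (v - u) = 2 * u by ring, abs_mul, abs_two] at h1
    linarith
  have hd : ∀ x, |u| ≤ |x| → ρ x ≤ K * decay 1 u ^ 2 := fun x hx => by
    refine (h.bound_sq x).trans (mul_le_mul_of_nonneg_left ?_ h.const_nonneg)
    refine pow_le_pow_left₀ (decay_pos one_pos x).le ?_ 2
    exact inv_anti₀ (by positivity) (by gcongr)
  have h0 := h.const_nonneg
  rcases key with hk | hk
  · calc _ ≤ (K * decay 1 u ^ 2) * K :=
          mul_le_mul (hd _ hk) (h.le_const _) (h.nonneg _) (by positivity)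
      _ = _ := by ring
  · calc _ ≤ K * (K * decay 1 u ^ 2) := mul_le_mul (h.le_const _) (hd _ hk) (h.nonneg _) h0
      _ = _ := by ring

lemma continuous_tripleCorr (h : IsWindow ρ K) : Continuous (tripleCorr ρ) := by
  have hc := h.continuous
  refine continuous_of_dominated (bound := fun v => K ^ 2 * ρ v) (fun u => ?_) (fun u => ?_)
    (h.integrable.const_mul _) ?_
  · exact Continuous.aestronglyMeasurable (by fun_prop)
  · refine Filter.Eventually.of_forall fun v => ?_
    have h1 : 0 ≤ ρ (v + u) * ρ (v - u) := mul_nonneg (h.nonneg _) (h.nonneg _)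
    rw [Real.norm_of_nonneg (mul_nonneg h1 (h.nonneg _))]
    refine mul_le_mul_of_nonneg_right ((h.mul_le v u).trans ?_) (h.nonneg _)
    exact mul_le_of_le_one_right (by positivity)
      (pow_le_one₀ (decay_pos one_pos u).le (decay_le_one one_pos u))
  · exact Filter.Eventually.of_forall fun v => by fun_prop

lemma integrable_corr (h : IsWindow ρ K) (u : ℝ) :
    Integrable fun v => ρ (v + u) * ρ (v - u) * ρ v := by
  have hc := h.continuous
  refine h.integrable.bdd_mul (c := K ^ 2 * decay 1 u ^ 2)
    (Continuous.aestronglyMeasurable (by fun_prop)) (Filter.Eventually.of_forall fun v => ?_)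
  rw [Real.norm_of_nonneg (mul_nonneg (h.nonneg _) (h.nonneg _))]
  exact h.mul_le v u

lemma abs_tripleCorr_le (h : IsWindow ρ K) (u : ℝ) :
    |tripleCorr ρ u| ≤ K ^ 2 * (∫ v, ρ v) * decay 1 u ^ 2 := by
  have h0 : ∀ v, 0 ≤ ρ (v + u) * ρ (v - u) * ρ v := fun v =>
    mul_nonneg (mul_nonneg (h.nonneg _) (h.nonneg _)) (h.nonneg _)
  rw [tripleCorr, abs_of_nonneg (integral_nonneg h0)]
  calc _ ≤ ∫ v, K ^ 2 * decay 1 u ^ 2 * ρ v := by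
        refine integral_mono (h.integrable_corr u) (h.integrable.const_mul _) fun v => ?_
        exact mul_le_mul_of_nonneg_right (h.mul_le v u) (h.nonneg v)
    _ = _ := by rw [integral_const_mul]; ring

lemma tripleCorr_neg (u : ℝ) : tripleCorr ρ (-u) = tripleCorr ρ u := by
  unfold tripleCorr
  congr 1
  ext v
  rw [sub_neg_eq_add, ← sub_eq_add_neg]
  ring

lemma tripleCorr_zero_pos (h : IsWindow ρ K) : 0 < tripleCorr ρ 0 := by
  have hc := h.continuous
  refine integral_pos_of_integrable_nonneg_nonzero (x := 0) (by fun_prop) (h.integrable_corr 0)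
    (fun v => mul_nonneg (mul_nonneg (h.nonneg _) (h.nonneg _)) (h.nonneg _)) ?_
  have := h.pos
  simp [this.ne']

lemma integral_rescale {t : ℝ} (ht : 0 < t) (k w : ℝ) :
    ∫ z, ρ ((w + k - z) / t) * ρ ((w - k - z) / t) * ρ ((w - z) / t) = t * tripleCorr ρ (k / t) := by
  have h1 := integral_sub_left_eq_self (μ := volume)
    (fun v : ℝ => ρ (v / t + k / t) * ρ (v / t - k / t) * ρ (v / t)) w
  have h2 := Measure.integral_comp_div (fun v : ℝ => ρ (v + k / t) * ρ (v - k / t) * ρ v) t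
  rw [abs_of_pos ht, smul_eq_mul] at h2
  rw [tripleCorr, ← h2, ← h1]
  congr 1
  ext z
  rw [← add_div, ← sub_div]
  congr 3
  · ring
  · congr 1; ring

end IsWindow

lemma decay_one_sq_le {u : ℝ} (hu : 0 < u) : decay 1 u ^ 2 ≤ u ^ (-2 : ℝ) := by
  rw [decay, div_one, abs_of_pos hu, Real.rpow_neg hu.le, Real.rpow_two, inv_pow]
  exact inv_anti₀ (by positivity) (by nlinarith)

/-- Dilation averages of an odd function give the kernel `1 / k` up to an integrable error. -/
lemma exists_kernel_of_odd {g : ℝ → ℝ} (hg : Continuous g) (hodd : ∀ u, g (-u) = -g u) {B : ℝ}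
    (hB : ∀ u, |g u| ≤ B * decay 1 u ^ 2) {a : ℝ} (ha : 0 < a) :
    ∃ κ : ℤ → ℝ, κ 0 = 0 ∧
      (∀ k : ℤ, Filter.Tendsto (fun N : ℕ => ∫ t in a..a * 2 ^ N, (t ^ 2)⁻¹ * g (k / t))
        Filter.atTop (nhds (κ k))) ∧
      ∀ k : ℤ, |κ k - (∫ u in Ioi (0 : ℝ), g u) * (k : ℝ)⁻¹| ≤ B * a * ((k : ℝ) ^ 2)⁻¹ := by
  have hB0 : 0 ≤ B := by
    have := hB 0
    have h2 : 0 < decay 1 0 ^ 2 := pow_pos (decay_pos one_pos 0) 2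
    have := abs_nonneg (g 0)
    by_contra! h
    nlinarith
  have hgi : ∀ x, 0 < x → IntegrableOn g (Ioi x) := fun x hx => by
    refine Integrable.mono' ((integrableOn_Ioi_rpow_of_lt (by norm_num : (-2 : ℝ) < -1) hx).const_mul
      B) hg.aestronglyMeasurable ?_
    filter_upwards [ae_restrict_mem measurableSet_Ioi] with u hu
    exact (hB u).trans (by gcongr; exact decay_one_sq_le (hx.trans hu))
  have hgi0 : IntegrableOn g (Ioi 0) := by
    rw [← Ioc_union_Ioi_eq_Ioi (zero_le_one' ℝ)]
    exact (hg.integrableOn_Ioc).union (hgi 1 one_pos)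
  have htail : ∀ x, 0 < x → |(∫ u in (0 : ℝ)..x, g u) - ∫ u in Ioi (0 : ℝ), g u| ≤ B * x⁻¹ := by
    intro x hx
    have h1 : (∫ u in (0 : ℝ)..x, g u) - ∫ u in Ioi (0 : ℝ), g u = -∫ u in Ioi x, g u := by
      rw [intervalIntegral.integral_of_le hx.le, ← Ioc_union_Ioi_eq_Ioi hx.le,
        setIntegral_union Ioc_disjoint_Ioi_same measurableSet_Ioi hg.integrableOn_Ioc (hgi x hx)]
      ring
    rw [h1, abs_neg, ← Real.norm_eq_abs]
    calc _ ≤ ∫ u in Ioi x, B * u ^ (-2 : ℝ) := by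
          refine norm_integral_le_of_norm_le
            ((integrableOn_Ioi_rpow_of_lt (by norm_num : (-2 : ℝ) < -1) hx).const_mul B) ?_
          filter_upwards [ae_restrict_mem measurableSet_Ioi] with u hu
          exact (hB u).trans (by gcongr; exact decay_one_sq_le (hx.trans hu))
      _ = _ := by
          rw [integral_const_mul, integral_Ioi_rpow_of_lt (by norm_num) hx]
          norm_num
          rw [Real.rpow_neg_one]
          left; trivial
  have heven : ∀ x, ∫ u in (0 : ℝ)..(-x), g u = ∫ u in (0 : ℝ)..x, g u := fun x => by
    have := intervalIntegral.integral_comp_neg (a := 0) (b := x) g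
    rw [neg_zero] at this
    rw [intervalIntegral.integral_symm, ← this]
    simp [hodd]
  have heven' : ∀ x, ∫ u in (0 : ℝ)..x, g u = ∫ u in (0 : ℝ)..|x|, g u := fun x => by
    rcases abs_choice x with h | h
    · rw [h]
    · rw [h, heven]
  have hg0 : g 0 = 0 := by
    have := hodd 0
    rw [neg_zero] at this
    linarith
  refine ⟨fun k => (k : ℝ)⁻¹ * ∫ u in (0 : ℝ)..(k / a), g u, by simp, fun k => ?_, fun k => ?_⟩
  · rcases eq_or_ne k 0 with rfl | hk
    · simp [hg0]
    have hk' : (k : ℝ) ≠ 0 := by exact_mod_cast hk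
    have hsub : ∀ N : ℕ, ∫ t in a..a * 2 ^ N, (t ^ 2)⁻¹ * g (k / t) =
        (k : ℝ)⁻¹ * ((∫ u in (0 : ℝ)..(k / a), g u) - ∫ u in (0 : ℝ)..(k / (a * 2 ^ N)), g u) := by
      intro N
      have hpos : ∀ t ∈ uIcc a (a * 2 ^ N), 0 < t := fun t ht =>
        (lt_min ha (by positivity)).trans_le ht.1
      have h := intervalIntegral.integral_comp_mul_deriv' (a := a) (b := a * 2 ^ N)
        (f := fun t : ℝ => k / t) (f' := fun t => -k / t ^ 2) (g := g)
        (fun t ht => by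
          have := (hasDerivAt_inv (hpos t ht).ne').const_mul (k : ℝ)
          simp only [← div_eq_mul_inv] at this
          rw [neg_div, ← mul_one_div, ← mul_neg, one_div]
          simpa [neg_div] using this)
        (by
          refine ContinuousOn.div (by fun_prop) (by fun_prop) fun t ht => ?_
          have := hpos t ht
          positivity) hg.continuousOn
      rw [intervalIntegral.integral_interval_sub_left (hg.intervalIntegrable _ _)
        (hg.intervalIntegrable _ _),
        intervalIntegral.integral_symm (k / a) (k / (a * 2 ^ N)), ← h]
      rw [eq_inv_mul_iff_mul_eq₀ hk', ← intervalIntegral.integral_const_mul,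
        ← intervalIntegral.integral_neg]
      refine intervalIntegral.integral_congr fun t ht => ?_
      simp only [Function.comp_apply]
      ring
    simp only [hsub]
    have hprim : Continuous fun x : ℝ => ∫ u in (0 : ℝ)..x, g u :=
      intervalIntegral.continuous_primitive (fun _ _ => hg.intervalIntegrable _ _) 0
    have hlim : Filter.Tendsto (fun N : ℕ => (k : ℝ) / (a * 2 ^ N)) Filter.atTop (nhds 0) := by
      have := (tendsto_pow_atTop_nhds_zero_of_lt_one (r := (2⁻¹ : ℝ)) (by norm_num)
        (by norm_num)).const_mul ((k : ℝ) / a)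
      rw [mul_zero] at this
      refine this.congr fun N => ?_
      rw [inv_pow]
      field_simp
    have := (hprim.tendsto 0).comp hlim
    simp only [intervalIntegral.integral_same] at this
    have h2 := (this.const_sub (∫ u in (0 : ℝ)..(k / a), g u)).const_mul (k : ℝ)⁻¹
    rw [sub_zero] at h2
    exact h2
  · rcases eq_or_ne k 0 with rfl | hk
    · simp
    have hk' : (0 : ℝ) < |(k : ℝ)| := by positivity
    have h1 := htail (|(k : ℝ)| / a) (by positivity)
    beta_reduce
    rw [heven', abs_div, abs_of_pos ha, mul_comm (∫ u in Ioi (0 : ℝ), g u), ← mul_sub, abs_mul,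
      abs_inv]
    calc _ ≤ |(k : ℝ)|⁻¹ * (B * (|(k : ℝ)| / a)⁻¹) := by gcongr
      _ = _ := by
        rw [← sq_abs (k : ℝ)]
        field_simp

/-- The character `e^{2πiθ}`. -/
noncomputable def cis (θ : ℝ) : ℂ := Complex.exp (↑(2 * π * θ) * Complex.I)

lemma norm_cis (θ : ℝ) : ‖cis θ‖ = 1 := Complex.norm_exp_ofReal_mul_I _

lemma cis_add (θ θ' : ℝ) : cis (θ + θ') = cis θ * cis θ' := by
  rw [cis, cis, cis, ← Complex.exp_add]
  congr 1
  push_cast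
  ring

lemma cis_zero : cis 0 = 1 := by simp [cis]

lemma conj_cis (θ : ℝ) : (starRingEnd ℂ) (cis θ) = cis (-θ) := by
  rw [cis, cis, ← Complex.exp_conj]
  rw [map_mul, Complex.conj_ofReal, Complex.conj_I]
  push_cast
  ring_nf

@[fun_prop]
lemma continuous_cis : Continuous cis := by unfold cis; fun_prop

/-- The wave packet with position `z`, width `t` and frequency `θ`. -/
noncomputable def wave (ρ : ℝ → ℝ) (z t θ : ℝ) (x : ℤ) : ℂ := ρ ((x - z) / t) * cis (-(θ * x))

lemma IsWindow.tsum_wave_eq_zero {ρ : ℝ → ℝ} {K : ℝ} (h : IsWindow ρ K) {z t θ z' t' θ' : ℝ}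
    (ht : 0 < t) (ht' : 0 < t') (h1 : |θ - θ'| + 1 / t + 1 / t' < 1)
    (h2 : 1 / t + 1 / t' < |θ - θ'|) :
    ∑' x : ℤ, wave ρ z t θ x * (starRingEnd ℂ) (wave ρ z' t' θ' x) = 0 := by
  obtain ⟨f, hf, hb⟩ := h.bandLimited
  have hb2 := (hb.rescale (z := z) ht).mul (hb.rescale (z := z') ht')
  refine Eq.trans (tsum_congr fun x => ?_) (hb2.tsum_eq_zero (ω := θ - θ') fun n => ?_)
  · rw [SchwartzMap.pairing_apply_apply, SchwartzMap.rescale_apply, SchwartzMap.rescale_apply,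
      hf, hf, ContinuousLinearMap.mul_apply', wave, wave, map_mul, conj_cis, Complex.conj_ofReal,
      mul_mul_mul_comm, ← cis_add, cis]
    congr 4
    ring
  · rcases eq_or_ne n 0 with rfl | hn
    · simpa using h2
    · have h3 : (1 : ℝ) ≤ |(n : ℝ)| := by exact_mod_cast Int.one_le_abs hn
      have h4 := abs_sub (θ - θ' + n) (θ - θ')
      rw [add_sub_cancel_left] at h4
      linarith

namespace TileSystem

variable {ι : Type*} {𝒯 : TileSystem ι} {lo hi : ℝ}

lemma overlap_of_abs_sub_le {P Q : ι} {c c' t t' : ℝ} (ht : 2 ^ 𝒯.scale P ≤ t)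
    (ht' : 2 ^ 𝒯.scale Q ≤ t') (hc : c * 2 ^ 𝒯.scale P - 𝒯.freq P ∈ Icc (lo + 1) (hi - 1))
    (hc' : c' * 2 ^ 𝒯.scale Q - 𝒯.freq Q ∈ Icc (lo + 1) (hi - 1))
    (h : |c - c'| ≤ 1 / t + 1 / t') : 𝒯.Overlap lo hi P Q := by
  have key : ∀ (R : ι) (d u w : ℝ), 2 ^ 𝒯.scale R ≤ u →
      d * 2 ^ 𝒯.scale R - 𝒯.freq R ∈ Icc (lo + 1) (hi - 1) → |w - d| ≤ 1 / u →
      w * 2 ^ 𝒯.scale R - 𝒯.freq R ∈ Icc lo hi := by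
    intro R d u w hu hd hw
    have h0 := one_le_two_pow_real (𝒯.scale R)
    have hu0 : 0 < u := by linarith
    have h1 : |w - d| * 2 ^ 𝒯.scale R ≤ 1 := by
      calc _ ≤ 1 / u * u := by gcongr
        _ = 1 := one_div_mul_cancel (by linarith)
    rw [← abs_of_pos (zero_lt_one.trans_le h0), ← abs_mul, abs_le] at h1
    constructor <;> nlinarith [hd.1, hd.2, h1.1, h1.2]
  have hp : 0 < t := (zero_lt_one.trans_le (one_le_two_pow_real _)).trans_le ht
  have hp' : 0 < t' := (zero_lt_one.trans_le (one_le_two_pow_real _)).trans_le ht'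
  have hi1 : 0 < 1 / t := by positivity
  have hi2 : 0 < 1 / t' := by positivity
  obtain ⟨w, hw, hw'⟩ : ∃ w, |w - c| ≤ 1 / t ∧ |w - c'| ≤ 1 / t' := by
    rw [abs_le] at h
    rcases le_total c c' with hcc | hcc
    · refine ⟨min c' (c + 1 / t), ?_, ?_⟩ <;> rw [abs_le] <;>
        rcases min_cases c' (c + 1 / t) with ⟨e, _⟩ | ⟨e, _⟩ <;> rw [e] <;> constructor <;>
        linarith
    · refine ⟨max c' (c - 1 / t), ?_, ?_⟩ <;> rw [abs_le] <;>
        rcases max_cases c' (c - 1 / t) with ⟨e, _⟩ | ⟨e, _⟩ <;> rw [e] <;> constructor <;>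
        linarith
  exact ⟨w, key P c t w ht hc hw, key Q c' t' w ht' hc' hw'⟩

open Classical in
variable (𝒯) in
/-- The normalized wave packets attached to the tiles of a subset `g`. -/
noncomputable def packet (ρ : ℝ → ℝ) (g : Set ι) (z t θ : ι → ℝ) (P : ι) (x : ℤ) : ℂ :=
  if P ∈ g then ((√(2 ^ 𝒯.scale P))⁻¹ : ℝ) * wave ρ (z P) (t P) (θ P) x else 0

lemma isPacketFamily_packet {ρ : ℝ → ℝ} {K : ℝ} (h : IsWindow ρ K) {g : Set ι} {z t θ c : ι → ℝ}
    (ht : ∀ P ∈ g, 2 ^ 𝒯.scale P ≤ t P) (ht' : ∀ P ∈ g, t P ≤ 2 * 2 ^ 𝒯.scale P)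
    (hz : ∀ P ∈ g, |z P - 𝒯.left P| ≤ 2 ^ 𝒯.scale P)
    (hc : ∀ P ∈ g, c P * 2 ^ 𝒯.scale P - 𝒯.freq P ∈ Icc (lo + 1) (hi - 1))
    (hcθ : ∀ P ∈ g, ∀ Q ∈ g, |c P - c Q| ≤ |θ P - θ Q|)
    (hθ : ∀ P ∈ g, ∀ Q ∈ g, |θ P - θ Q| + 1 / t P + 1 / t Q < 1) :
    𝒯.IsPacketFamily lo hi (64 * K) (𝒯.packet ρ g z t θ) := by
  have hpos : ∀ P ∈ g, 0 < t P := fun P hP =>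
    (zero_lt_one.trans_le (one_le_two_pow_real _)).trans_le (ht P hP)
  constructor
  · intro P x
    have h0 : (0 : ℝ) < 2 ^ 𝒯.scale P := by positivity
    have hK := h.const_nonneg
    have hd := (decay_pos h0 (x - 𝒯.left P)).le
    unfold packet
    split_ifs with hP
    · rw [wave, norm_mul, norm_mul, norm_cis, Complex.norm_real, Complex.norm_real,
        Real.norm_of_nonneg (by positivity), Real.norm_of_nonneg (h.nonneg _), mul_one,
        mul_comm (64 * K), mul_assoc]
      refine mul_le_mul_of_nonneg_left ((h.bound _).trans ?_) (by positivity)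
      have h1 : decay 1 ((x - z P) / t P) ≤ 2 * decay (2 ^ 𝒯.scale P) (x - 𝒯.left P) := by
        unfold decay
        rw [← div_eq_mul_inv, inv_eq_one_div, div_le_div_iff₀ (by positivity) (by positivity),
          div_one, one_mul, abs_div, abs_of_pos (hpos P hP)]
        have e1 : |(x : ℝ) - 𝒯.left P| / 2 ^ 𝒯.scale P ≤
            |(x : ℝ) - z P| / 2 ^ 𝒯.scale P + 1 := by
          rw [← sub_le_iff_le_add', ← sub_nonneg]
          have e2 := abs_sub_le (x : ℝ) (z P) (𝒯.left P)
          have e3 := hz P hP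
          have e4 : |(x : ℝ) - 𝒯.left P| / 2 ^ 𝒯.scale P ≤
            (|(x : ℝ) - z P| + 2 ^ 𝒯.scale P) / 2 ^ 𝒯.scale P := by gcongr; linarith
          rw [add_div, div_self h0.ne'] at e4
          linarith
        have e5 : |(x : ℝ) - z P| / 2 ^ 𝒯.scale P ≤ 2 * (|(x : ℝ) - z P| / t P) := by
          rw [← mul_div_assoc, div_le_div_iff₀ h0 (hpos P hP)]
          nlinarith [ht' P hP, abs_nonneg ((x : ℝ) - z P)]
        linarith
      calc _ ≤ K * (2 * decay (2 ^ 𝒯.scale P) (x - 𝒯.left P)) ^ 6 := by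
            have := (decay_pos one_pos ((x - z P) / t P)).le
            gcongr
        _ = _ := by ring
    · rw [norm_zero]
      positivity
  · intro P Q hPQ
    by_cases hP : P ∈ g
    swap
    · simp [packet, hP]
    by_cases hQ : Q ∈ g
    swap
    · simp [packet, hQ]
    simp only [packet, hP, hQ, if_true, map_mul]
    rw [tsum_congr fun x => mul_mul_mul_comm _ _ _ _, tsum_mul_left, h.tsum_wave_eq_zero (hpos P hP) (hpos Q hQ) (hθ P hP Q hQ), mul_zero]
    by_contra! h'
    exact hPQ (overlap_of_abs_sub_le (ht P hP) (ht Q hQ) (hc P hP) (hc Q hQ)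
      ((hcθ P hP Q hQ).trans h'))

end TileSystem

/-- The tile system of all triples (scale, position, frequency). -/
def allTiles : TileSystem (ℕ × ℤ × ℤ) where
  scale P := P.1
  pos P := P.2.1
  freq P := P.2.2
  inj _ _ h1 h2 h3 := Prod.ext h1 (Prod.ext h2 h3)

namespace allTiles

/-- The frequency at relative height `v` in the tile `P`. -/
noncomputable def eta (v : ℝ) (P : ℕ × ℤ × ℤ) : ℝ := (P.2.2 + v) / 2 ^ P.1

/-- The frequencies of the three wave packets attached to frequency `η` and width `t`. -/
noncomputable def theta (α t η : ℝ) : Fin 3 → ℝ := ![η + α / t, η - α / t, -2 * η]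

/-- The frequency window centres. -/
noncomputable def center (α t η : ℝ) : Fin 3 → ℝ := ![η + α / t, η - α / t, η]

/-- The lower ends of the frequency windows. -/
noncomputable def lo (α : ℝ) : Fin 3 → ℝ := ![α / 2 - 1, -α - 1, -1]

/-- The upper ends of the frequency windows. -/
noncomputable def hi (α : ℝ) : Fin 3 → ℝ := ![α + 2, 2 - α / 2, 2]

/-- The tiles of scale at least `s₀` whose frequency lies in a given quarter. -/
def quarter (s₀ : ℕ) (v : ℝ) (i : ℕ) : Set (ℕ × ℤ × ℤ) :=
  {P | s₀ ≤ P.1 ∧ eta v P ∈ Icc ((i : ℝ) / 4) ((i + 1) / 4)}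

/-- The packets of the three families. -/
noncomputable def packets (ρ : ℝ → ℝ) (α σ u v : ℝ) (g : Set (ℕ × ℤ × ℤ)) (j : Fin 3) :
    ℕ × ℤ × ℤ → ℤ → ℂ :=
  allTiles.packet ρ g (fun P => (P.2.1 + u) * 2 ^ P.1) (fun P => σ * 2 ^ P.1)
    (fun P => theta α (σ * 2 ^ P.1) (eta v P) j)

lemma isModel {ρ : ℝ → ℝ} {K : ℝ} (h : IsWindow ρ K) {α σ u v : ℝ} {s₀ M : ℕ} (hα : 10 ≤ α)
    (hσ : σ ∈ Icc (1 : ℝ) 2) (hu : u ∈ Icc (0 : ℝ) 1) (hv : v ∈ Icc (0 : ℝ) 1)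
    (hs : 4 * (α + 2) < 2 ^ s₀) (hM : 4 * (α + 3) < 2 ^ M) (i : ℕ) :
    allTiles.IsModel (α + 3) M (lo α) (hi α) (64 * K)
      (packets ρ α σ u v (quarter s₀ v i)) := by
  obtain ⟨hσ1, hσ2⟩ := hσ
  obtain ⟨hu0, hu1⟩ := hu
  obtain ⟨hv0, hv1⟩ := hv
  refine ⟨fun j => ?_, fun j => ?_, fun j => ?_, fun j => ?_, hM, fun i j hij => ?_⟩
  · refine TileSystem.isPacketFamily_packet h
      (c := fun P => center α (σ * 2 ^ P.1) (eta v P) j) ?_ ?_ ?_ ?_ ?_ ?_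
    · intro P _
      exact le_mul_of_one_le_left (by positivity) hσ1
    · intro P _
      exact mul_le_mul_of_nonneg_right hσ2 (by positivity)
    · intro P _
      change |(P.2.1 + u) * 2 ^ P.1 - P.2.1 * 2 ^ P.1| ≤ 2 ^ P.1
      rw [← sub_mul, add_sub_cancel_left, abs_of_nonneg (by positivity)]
      exact mul_le_of_le_one_left (by positivity) hu1
    · intro P _
      change center α (σ * 2 ^ P.1) (eta v P) j * 2 ^ P.1 - P.2.2 ∈ _
      have h0 : (0 : ℝ) < 2 ^ P.1 := by positivity
      have e1 : eta v P * 2 ^ P.1 = P.2.2 + v := by rw [eta, div_mul_cancel₀ _ h0.ne']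
      have e2 : α / (σ * 2 ^ P.1) * 2 ^ P.1 = α / σ := by field_simp
      have e3 : α / σ ≤ α := div_le_self (by linarith) hσ1
      have e4 : α / 2 ≤ α / σ := by gcongr
      fin_cases j <;> simp only [center, lo, hi, Fin.zero_eta, Fin.mk_one, Fin.reduceFinMk,
        Matrix.cons_val_zero, Matrix.cons_val_one, Matrix.cons_val, add_mul, sub_mul, e1, e2] <;>
        constructor <;> linarith
    · intro P _ Q _
      fin_cases j
      · exact le_rfl
      · exact le_rfl
      · simp only [center, theta, Fin.reduceFinMk, Matrix.cons_val]
        rw [← mul_sub, abs_mul, abs_of_neg (by norm_num : (-2 : ℝ) < 0)]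
        linarith [abs_nonneg (eta v P - eta v Q)]
    · rintro P ⟨hP, hP1, hP2⟩ Q ⟨hQ, hQ1, hQ2⟩
      have key : ∀ s, s₀ ≤ s → 0 ≤ (α + 2) / (σ * 2 ^ s) ∧ (α + 2) / (σ * 2 ^ s) < 1 / 4 := by
        intro s hs'
        refine ⟨by positivity, ?_⟩
        have : (2 : ℝ) ^ s₀ ≤ 2 ^ s := pow_le_pow_right₀ (by norm_num) hs'
        rw [div_lt_div_iff₀ (by positivity) (by norm_num)]
        nlinarith
      have kP := key _ hP
      have kQ := key _ hQ
      have eP : (α + 2) / (σ * 2 ^ P.1) = α / (σ * 2 ^ P.1) + 2 * (1 / (σ * 2 ^ P.1)) := by ring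
      have eQ : (α + 2) / (σ * 2 ^ Q.1) = α / (σ * 2 ^ Q.1) + 2 * (1 / (σ * 2 ^ Q.1)) := by ring
      rw [eP] at kP
      rw [eQ] at kQ
      have p1 : 0 ≤ α / (σ * 2 ^ P.1) := by positivity
      have p2 : 0 ≤ α / (σ * 2 ^ Q.1) := by positivity
      have p3 : 0 ≤ 1 / (σ * 2 ^ P.1) := by positivity
      have p4 : 0 ≤ 1 / (σ * 2 ^ Q.1) := by positivity
      have : |theta α (σ * 2 ^ P.1) (eta v P) j - theta α (σ * 2 ^ Q.1) (eta v Q) j| ≤ 1 / 2 := by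
        fin_cases j <;> simp only [theta, Fin.zero_eta, Fin.mk_one, Fin.reduceFinMk,
          Matrix.cons_val_zero, Matrix.cons_val_one, Matrix.cons_val] <;>
          rw [abs_le] <;> constructor <;> linarith
      linarith
  · fin_cases j <;> simp [lo] <;> linarith
  · fin_cases j <;> simp [lo, hi] <;> linarith
  · fin_cases j <;> simp [hi] <;> linarith
  · fin_cases i <;> fin_cases j <;> simp [lo, hi] at hij ⊢ <;>
      first | (left; linarith) | (right; linarith)

variable {H : Type*} [NormedAddCommGroup H] [InnerProductSpace ℂ H]

variable (H) in
lemma exists_tile_sum_le {ρ : ℝ → ℝ} {K : ℝ} (h : IsWindow ρ K) {α : ℝ} {s₀ : ℕ} (hα : 10 ≤ α)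
    (hs : 4 * (α + 2) < 2 ^ s₀) (p : Fin 3 → ℝ) (hp : ∀ j, 2 < p j) (hps : ∑ j, 1 / p j = 1) :
    ∃ C : ℝ, 0 ≤ C ∧ ∀ σ ∈ Icc (1 : ℝ) 2, ∀ u ∈ Icc (0 : ℝ) 1, ∀ v ∈ Icc (0 : ℝ) 1,
      ∀ 𝒬 : Finset (ℕ × ℤ × ℤ), (∀ P ∈ 𝒬, s₀ ≤ P.1 ∧ 0 ≤ P.2.2 ∧ P.2.2 < 2 ^ P.1) →
      ∀ (X : Finset ℤ) (A : Fin 3 → ℤ → H), (∀ j, ∑ x ∈ X, ‖A j x‖ ^ p j ≤ 1) →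
        ∑ P ∈ 𝒬, ((2 : ℝ) ^ P.1)⁻¹ ^ 2 * ∏ j, ‖∑ x ∈ X, wave ρ ((P.2.1 + u) * 2 ^ P.1)
          (σ * 2 ^ P.1) (theta α (σ * 2 ^ P.1) (eta v P) j) x • A j x‖ ≤ C := by
  obtain ⟨M, hM⟩ := pow_unbounded_of_one_lt (4 * (α + 3)) (one_lt_two (α := ℝ))
  obtain ⟨C, hC0, hC⟩ := TileSystem.exists_model_bound (ℕ × ℤ × ℤ) (fun _ : Fin 3 => H)
    (α + 3) (64 * K) M (lo α) (hi α) p hp hps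
  have hM0 : 0 < M := by
    rcases Nat.eq_zero_or_pos M with rfl | h0
    · norm_num at hM; linarith
    · exact h0
  refine ⟨4 * (M * C), by positivity, fun σ hσ u hu v hv 𝒬 h𝒬 X A hA => ?_⟩
  have key : ∀ i ∈ Finset.range 4, ∑ P ∈ 𝒬, allTiles.weight
      (packets ρ α σ u v (quarter s₀ v i)) X A P ≤ M * C := by
    intro i _
    rw [← Finset.sum_fiberwise_of_maps_to (s := 𝒬) (t := Finset.range M) (g := fun P => P.1 % M)
      fun P _ => Finset.mem_range.2 (Nat.mod_lt _ hM0)]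
    refine (Finset.sum_le_sum fun r _ => hC _ _ (isModel h hα hσ hu hv hs hM i) _ ?_ X A hA).trans
      (by simp)
    intro P hP Q hQ hlt
    have e : P.1 % M = Q.1 % M := by
      rw [(Finset.mem_filter.1 hP).2, (Finset.mem_filter.1 hQ).2]
    change P.1 < Q.1 at hlt
    change P.1 + M ≤ Q.1
    have := Nat.le_of_dvd (by omega) ((Nat.modEq_iff_dvd' hlt.le).1 e)
    omega
  calc _ ≤ ∑ P ∈ 𝒬, ∑ i ∈ Finset.range 4, allTiles.weight
          (packets ρ α σ u v (quarter s₀ v i)) X A P := by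
        refine Finset.sum_le_sum fun P hP => ?_
        obtain ⟨h1, h2, h3⟩ := h𝒬 P hP
        have h0 : (0 : ℝ) < 2 ^ P.1 := by positivity
        have h2' : (0 : ℝ) ≤ P.2.2 := by exact_mod_cast h2
        have h3' : (P.2.2 : ℝ) + 1 ≤ 2 ^ P.1 := by exact_mod_cast h3
        have e0 : 0 ≤ eta v P := div_nonneg (by linarith [hv.1]) h0.le
        have e1 : eta v P ≤ 1 := by rw [eta, div_le_one h0]; linarith [hv.2]
        obtain ⟨i, hi, hPi⟩ : ∃ i ∈ Finset.range 4, P ∈ quarter s₀ v i := by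
          have : ∀ i : ℕ, (i : ℝ) / 4 ≤ eta v P → eta v P ≤ (i + 1) / 4 → P ∈ quarter s₀ v i :=
            fun i a b => ⟨h1, a, b⟩
          rcases le_total (eta v P) (1 / 4) with a | a
          · exact ⟨0, by simp, this 0 (by simpa using e0) (by norm_num; linarith)⟩
          rcases le_total (eta v P) (2 / 4) with b | b
          · exact ⟨1, by simp, this 1 (by norm_num; linarith) (by norm_num; linarith)⟩
          rcases le_total (eta v P) (3 / 4) with c | c
          · exact ⟨2, by simp, this 2 (by norm_num; linarith) (by norm_num; linarith)⟩
          · exact ⟨3, by simp, this 3 (by norm_num; linarith) (by norm_num; linarith)⟩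
        refine le_trans (le_of_eq ?_) (Finset.single_le_sum
          (fun i _ => TileSystem.weight_nonneg _) hi)
        have hs : √((2 : ℝ) ^ P.1) * √((2 : ℝ) ^ P.1) = 2 ^ P.1 := Real.mul_self_sqrt h0.le
        have hn : 0 < √((2 : ℝ) ^ P.1) := Real.sqrt_pos.2 h0
        have hcoef : ∀ j, ‖TileSystem.coef (packets ρ α σ u v (quarter s₀ v i) j) X (A j) P‖ =
            (√((2 : ℝ) ^ P.1))⁻¹ * ‖∑ x ∈ X, wave ρ ((P.2.1 + u) * 2 ^ P.1)
          (σ * 2 ^ P.1) (theta α (σ * 2 ^ P.1) (eta v P) j) x • A j x‖ := by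
          intro j
          have : ∀ x, packets ρ α σ u v (quarter s₀ v i) j P x = ((√((2 : ℝ) ^ P.1))⁻¹ : ℝ) *
              wave ρ ((P.2.1 + u) * 2 ^ P.1)
              (σ * 2 ^ P.1) (theta α (σ * 2 ^ P.1) (eta v P) j) x := fun x => if_pos hPi
          simp_rw [TileSystem.coef, this, mul_smul]
          rw [← Finset.smul_sum, norm_smul, Complex.norm_real, Real.norm_of_nonneg (by positivity)]
        simp_rw [TileSystem.weight, hcoef, Finset.prod_mul_distrib]
        change _ = (√((2 : ℝ) ^ P.1))⁻¹ * _
        rw [← mul_assoc]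
        congr 1
        rw [Finset.prod_const, Finset.card_univ, Fintype.card_fin]
        nth_rw 1 [← hs]
        rw [mul_inv]
        ring
    _ ≤ _ := by
        rw [Finset.sum_comm]
        refine (Finset.sum_le_sum key).trans (le_of_eq ?_)
        simp

end allTiles

/-- Lebesgue measure on the unit interval. -/
noncomputable def unitMeasure : Measure ℝ := volume.restrict (Ioc 0 1)

instance : IsProbabilityMeasure unitMeasure := ⟨by simp [unitMeasure]⟩

lemma integral_unitMeasure {E : Type*} [NormedAddCommGroup E] [NormedSpace ℝ E] (f : ℝ → E) :
    ∫ x, f x ∂unitMeasure = ∫ x in (0 : ℝ)..1, f x := by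
  rw [intervalIntegral.integral_of_le zero_le_one, unitMeasure]

lemma ae_unitMeasure_prod : ∀ᵐ x ∂unitMeasure.prod unitMeasure,
    x.1 ∈ Icc (0 : ℝ) 1 ∧ x.2 ∈ Icc (0 : ℝ) 1 := by
  rw [unitMeasure, Measure.prod_restrict]
  filter_upwards [ae_restrict_mem (measurableSet_Ioc.prod measurableSet_Ioc)] with x hx
  exact ⟨Ioc_subset_Icc_self hx.1, Ioc_subset_Icc_self hx.2⟩

lemma integrable_unitMeasure_prod {E : Type*} [NormedAddCommGroup E] {f : ℝ × ℝ → E}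
    (hf : Continuous f) : Integrable f (unitMeasure.prod unitMeasure) := by
  rw [unitMeasure, Measure.prod_restrict]
  exact (hf.continuousOn.integrableOn_compact (isCompact_Icc.prod isCompact_Icc)).mono_set
    (prod_mono Ioc_subset_Icc_self Ioc_subset_Icc_self)

lemma sum_mul_norm_integral_le {S : Finset ℕ} {J : ℕ → ℝ × ℝ → ℂ} (hJ : ∀ s, Continuous (J s))
    {c : ℕ → ℝ} (hc : ∀ s, 0 ≤ c s) {C : ℝ}
    (h : ∀ u ∈ Icc (0 : ℝ) 1, ∀ v ∈ Icc (0 : ℝ) 1, ∑ s ∈ S, c s * ‖J s (u, v)‖ ≤ C) :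
    ∑ s ∈ S, c s * ‖∫ x, J s x ∂unitMeasure.prod unitMeasure‖ ≤ C := by
  calc _ ≤ ∑ s ∈ S, ∫ x, c s * ‖J s x‖ ∂unitMeasure.prod unitMeasure := by
        refine Finset.sum_le_sum fun s _ => ?_
        rw [integral_const_mul]
        exact mul_le_mul_of_nonneg_left (norm_integral_le_integral_norm _) (hc s)
    _ = ∫ x, ∑ s ∈ S, c s * ‖J s x‖ ∂unitMeasure.prod unitMeasure :=
        (integral_finsetSum _ fun s _ => integrable_unitMeasure_prod
          (continuous_const.mul (hJ s).norm)).symm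
    _ ≤ ∫ x, C ∂unitMeasure.prod unitMeasure := by
        refine integral_mono_ae (integrable_unitMeasure_prod (continuous_finsetSum _ fun s _ =>
          continuous_const.mul (hJ s).norm)) (integrable_const _) ?_
        filter_upwards [ae_unitMeasure_prod] with x hx using h x.1 hx.1 x.2 hx.2
    _ = C := by simp

lemma sum_mul_integral_unit {f : ℝ → ℂ} (hf : Continuous f) (h : ℝ) (a : ℤ) (m : ℕ) :
    ∑ n ∈ Finset.Ico a (a + m), h * ∫ u in (0 : ℝ)..1, f ((n + u) * h) =
      ∫ z in a * h..(a + m) * h, f z := by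
  induction m with
  | zero => simp
  | succ m ih =>
    have e : Finset.Ico a (a + (m + 1 : ℕ)) = insert (a + m : ℤ) (Finset.Ico a (a + m)) := by
      rw [Finset.insert_Ico_right_eq_Ico_add_one (by omega)]
      congr 1
      push_cast
      ring
    have e2 := intervalIntegral.smul_integral_comp_mul_right (a := a + m) (b := a + m + 1) f h
    rw [e, Finset.sum_insert (by simp), ih, add_comm]
    have e3 : ∫ u in (0 : ℝ)..1, f (((a + m : ℤ) + u) * h) = ∫ x in (a + m : ℝ)..a + m + 1,
        f (x * h) := by
      rw [intervalIntegral.integral_comp_add_left (fun x => f (x * h))]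
      push_cast
      rw [add_zero]
    rw [e3, ← Complex.real_smul, e2, intervalIntegral.integral_add_adjacent_intervals
      (hf.intervalIntegrable _ _) (hf.intervalIntegrable _ _)]
    push_cast
    rw [add_assoc]

lemma integral_cis_int (m : ℤ) : ∫ η in (0 : ℝ)..1, cis (-(η * m)) = if m = 0 then 1 else 0 := by
  split_ifs with h
  · simp [h, cis_zero]
  · have hc : (-(2 * π * m * Complex.I) : ℂ) ≠ 0 := by
      simp [h, Real.pi_ne_zero, Complex.I_ne_zero]
    have e : ∀ η : ℝ, cis (-(η * m)) = Complex.exp (-(2 * π * m * Complex.I) * η) := by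
      intro η
      rw [cis]
      congr 1
      push_cast
      ring
    simp_rw [e]
    rw [integral_exp_mul_complex hc]
    have : Complex.exp (-(2 * π * m * Complex.I) * (1 : ℝ)) = 1 := by
      have := Complex.exp_int_mul_two_pi_mul_I (-m)
      rw [← this]
      congr 1
      push_cast
      ring
    rw [this]
    simp

section

variable {V₁ V₂ V₃ : Type*} [AddCommGroup V₁] [AddCommGroup V₂] [AddCommGroup V₃]
  [Module ℂ V₁] [Module ℂ V₂] [Module ℂ V₃]

/-- The trilinear form with kernel `κ` on vector-valued sequences. -/
noncomputable def triForm (τ : V₁ →ₗ[ℂ] V₂ →ₗ[ℂ] V₃ →ₗ[ℂ] ℂ) (X : Finset ℤ) (κ : ℤ → ℂ)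
    (A : ℤ → V₁) (B : ℤ → V₂) (C : ℤ → V₃) : ℂ :=
  ∑ x ∈ X, ∑ y ∈ X, ∑ w ∈ X, if x + y = 2 * w then κ (x - w) * τ (A x) (B y) (C w) else 0

/-- The product of the three wave packets at frequency `η`. -/
noncomputable def prodWave (ρ : ℝ → ℝ) (α t z η : ℝ) (x y w : ℤ) : ℂ :=
  wave ρ z t (allTiles.theta α t η 0) x * wave ρ z t (allTiles.theta α t η 1) y *
    wave ρ z t (allTiles.theta α t η 2) w

lemma prodWave_eq (ρ : ℝ → ℝ) (α t z η : ℝ) (x y w : ℤ) : prodWave ρ α t z η x y w =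
    cis (-(α / t * (x - y))) * (((ρ ((x - z) / t) * ρ ((y - z) / t) * ρ ((w - z) / t) : ℝ) : ℂ) *
      cis (-(η * (x + y - 2 * w : ℤ)))) := by
  simp only [prodWave, wave, allTiles.theta, Matrix.cons_val_zero, Matrix.cons_val_one,
    Matrix.cons_val]
  have : cis (-(α / t * (x - y))) * cis (-(η * (x + y - 2 * w : ℤ))) =
      cis (-((η + α / t) * x)) * cis (-((η - α / t) * y)) * cis (-(-2 * η * w)) := by
    rw [← cis_add, ← cis_add, ← cis_add]
    congr 1
    push_cast
    ring
  rw [Complex.ofReal_mul, Complex.ofReal_mul]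
  linear_combination -((ρ ((x - z) / t) : ℂ) * ρ ((y - z) / t) * ρ ((w - z) / t)) * this

lemma apply_sum_smul (τ : V₁ →ₗ[ℂ] V₂ →ₗ[ℂ] V₃ →ₗ[ℂ] ℂ) (X : Finset ℤ) (a b c : ℤ → ℂ)
    (A : ℤ → V₁) (B : ℤ → V₂) (C : ℤ → V₃) :
    τ (∑ x ∈ X, a x • A x) (∑ y ∈ X, b y • B y) (∑ w ∈ X, c w • C w) =
      ∑ x ∈ X, ∑ y ∈ X, ∑ w ∈ X, a x * b y * c w * τ (A x) (B y) (C w) := by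
  rw [map_sum τ, LinearMap.sum_apply, LinearMap.sum_apply]
  refine Finset.sum_congr rfl fun x _ => ?_
  rw [map_smul τ, LinearMap.smul_apply, map_sum (τ (A x)), LinearMap.smul_apply, LinearMap.sum_apply,
    Finset.smul_sum]
  refine Finset.sum_congr rfl fun y _ => ?_
  rw [map_sum, Finset.smul_sum]
  refine Finset.sum_congr rfl fun w _ => ?_
  simp only [map_smul, LinearMap.smul_apply, smul_eq_mul]
  ring

/-- The kernel of the form at scale `t`. -/
noncomputable def scaleKernel (ρ : ℝ → ℝ) (α t : ℝ) (k : ℤ) : ℂ :=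
  ((t ^ 2)⁻¹ * tripleCorr ρ (k / t) : ℝ) * cis (-(2 * α * (k / t)))

/-- The sum over the tiles of scale `s`. -/
noncomputable def tileForm (τ : V₁ →ₗ[ℂ] V₂ →ₗ[ℂ] V₃ →ₗ[ℂ] ℂ) (ρ : ℝ → ℝ) (α σ : ℝ) (X : Finset ℤ)
    (A : ℤ → V₁) (B : ℤ → V₂) (C : ℤ → V₃) (N s : ℕ) (x : ℝ × ℝ) : ℂ :=
  ∑ n ∈ Finset.Ico (-N : ℤ) (-N + (2 * N : ℕ)), ∑ l ∈ Finset.Ico (0 : ℤ) (0 + (2 ^ s : ℕ)),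
    ∑ a ∈ X, ∑ b ∈ X, ∑ c ∈ X,
      prodWave ρ α (σ * 2 ^ s) ((n + x.1) * 2 ^ s) ((l + x.2) / 2 ^ s) a b c *
        τ (A a) (B b) (C c)

lemma continuous_tileForm {ρ : ℝ → ℝ} (hρ : Continuous ρ) (τ : V₁ →ₗ[ℂ] V₂ →ₗ[ℂ] V₃ →ₗ[ℂ] ℂ)
    (α σ : ℝ) (X : Finset ℤ) (A : ℤ → V₁) (B : ℤ → V₂) (C : ℤ → V₃) (N s : ℕ) :
    Continuous (tileForm τ ρ α σ X A B C N s) := by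
  unfold tileForm
  simp_rw [prodWave_eq]
  fun_prop

lemma integral_tileForm {ρ : ℝ → ℝ} (hρ : Continuous ρ) (τ : V₁ →ₗ[ℂ] V₂ →ₗ[ℂ] V₃ →ₗ[ℂ] ℂ)
    (α σ : ℝ) (X : Finset ℤ) (A : ℤ → V₁) (B : ℤ → V₂) (C : ℤ → V₃) (N s : ℕ) :
    ∫ x, tileForm τ ρ α σ X A B C N s x ∂unitMeasure.prod unitMeasure =
      ∑ a ∈ X, ∑ b ∈ X, ∑ c ∈ X, if a + b = 2 * c then
        cis (-(α / (σ * 2 ^ s) * (a - b))) * ((∫ z in (-N * 2 ^ s : ℝ)..N * 2 ^ s,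
          ρ ((a - z) / (σ * 2 ^ s)) * ρ ((b - z) / (σ * 2 ^ s)) * ρ ((c - z) / (σ * 2 ^ s)) : ℝ) : ℂ)
          * τ (A a) (B b) (C c) else 0 := by
  set t : ℝ := σ * 2 ^ s with ht
  set R : ℤ → ℤ → ℤ → ℝ → ℂ := fun a b c z =>
    ((ρ ((a - z) / t) * ρ ((b - z) / t) * ρ ((c - z) / t) : ℝ) : ℂ) with hR
  set E : ℤ → ℤ → ℤ → ℝ → ℂ := fun a b c η => cis (-(η * (a + b - 2 * c : ℤ))) with hE
  have hRc : ∀ a b c, Continuous (R a b c) := fun a b c => by simp only [hR]; fun_prop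
  have hEc : ∀ a b c, Continuous (E a b c) := fun a b c => by simp only [hE]; fun_prop
  have h0 : (2 ^ s : ℝ) ≠ 0 := by positivity
  have h0' : ((2 ^ s : ℝ) : ℂ) ≠ 0 := by exact_mod_cast h0
  have e : ∀ x : ℝ × ℝ, tileForm τ ρ α σ X A B C N s x = ∑ a ∈ X, ∑ b ∈ X, ∑ c ∈ X,
      cis (-(α / t * (a - b))) * τ (A a) (B b) (C c) *
      ((∑ n ∈ Finset.Ico (-N : ℤ) (-N + (2 * N : ℕ)), R a b c ((n + x.1) * 2 ^ s)) *
      ∑ l ∈ Finset.Ico (0 : ℤ) (0 + (2 ^ s : ℕ)), E a b c ((l + x.2) / 2 ^ s)) := by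
    intro x
    rw [tileForm, ← Finset.sum_product']
    rw [Finset.sum_comm]
    refine Finset.sum_congr rfl fun a _ => ?_
    rw [Finset.sum_comm]
    refine Finset.sum_congr rfl fun b _ => ?_
    rw [Finset.sum_comm]
    refine Finset.sum_congr rfl fun c _ => ?_
    rw [Finset.sum_mul_sum, ← Finset.sum_product', Finset.mul_sum]
    refine Finset.sum_congr rfl fun q _ => ?_
    rw [prodWave_eq]
    simp only [hR, hE]
    ring
  have hRi : ∀ a b c, ∫ u, ∑ n ∈ Finset.Ico (-N : ℤ) (-N + (2 * N : ℕ)), R a b c ((n + u) * 2 ^ s)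
      ∂unitMeasure = ((2 ^ s : ℝ) : ℂ)⁻¹ * ∫ z in (-N * 2 ^ s : ℝ)..N * 2 ^ s, R a b c z := by
    intro a b c
    have := sum_mul_integral_unit (hRc a b c) (2 ^ s) (-N) (2 * N)
    rw [← Finset.mul_sum] at this
    rw [integral_unitMeasure, intervalIntegral.integral_finsetSum fun n _ =>
      Continuous.intervalIntegrable (by have := hRc a b c; fun_prop) _ _, eq_inv_mul_iff_mul_eq₀ h0',
      this]
    congr 1 <;> push_cast <;> ring
  have hEi : ∀ a b c, ∫ v, ∑ l ∈ Finset.Ico (0 : ℤ) (0 + (2 ^ s : ℕ)), E a b c ((l + v) / 2 ^ s)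
      ∂unitMeasure = ((2 ^ s : ℝ) : ℂ) * if a + b = 2 * c then 1 else 0 := by
    intro a b c
    have := sum_mul_integral_unit (hEc a b c) (2 ^ s)⁻¹ 0 (2 ^ s)
    rw [← Finset.mul_sum] at this
    simp only [← sub_eq_zero (a := a + b)]
    rw [integral_unitMeasure, intervalIntegral.integral_finsetSum fun n _ =>
      Continuous.intervalIntegrable (by have := hEc a b c; fun_prop) _ _, ← integral_cis_int,
      ← inv_mul_eq_iff_eq_mul₀ h0']
    simp only [div_eq_mul_inv]
    rw [← Complex.ofReal_inv, this]
    congr 1 <;> simp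
  simp_rw [e]
  have hInt : ∀ a b c : ℤ, Integrable (fun x : ℝ × ℝ => cis (-(α / t * (a - b))) * τ (A a) (B b) (C c) *
      ((∑ n ∈ Finset.Ico (-N : ℤ) (-N + (2 * N : ℕ)), R a b c ((n + x.1) * 2 ^ s)) *
      ∑ l ∈ Finset.Ico (0 : ℤ) (0 + (2 ^ s : ℕ)), E a b c ((l + x.2) / 2 ^ s)))
      (unitMeasure.prod unitMeasure) := fun a b c =>
    integrable_unitMeasure_prod (by have := hRc a b c; have := hEc a b c; fun_prop)
  rw [integral_finsetSum _ fun a _ => integrable_finsetSum _ fun b _ =>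
    integrable_finsetSum _ fun c _ => hInt a b c]
  refine Finset.sum_congr rfl fun a _ => ?_
  rw [integral_finsetSum _ fun b _ => integrable_finsetSum _ fun c _ => hInt a b c]
  refine Finset.sum_congr rfl fun b _ => ?_
  rw [integral_finsetSum _ fun c _ => hInt a b c]
  refine Finset.sum_congr rfl fun c _ => ?_
  rw [integral_const_mul, integral_prod_mul
    (fun u : ℝ => ∑ n ∈ Finset.Ico (-N : ℤ) (-N + (2 * N : ℕ)), R a b c ((n + u) * 2 ^ s))
    (fun v : ℝ => ∑ l ∈ Finset.Ico (0 : ℤ) (0 + (2 ^ s : ℕ)), E a b c ((l + v) / 2 ^ s)),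
    hRi, hEi]
  simp only [hR]
  rw [intervalIntegral.integral_ofReal]
  split_ifs
  · field_simp
  · simp

end

section

variable {V₁ V₂ V₃ : Type*} [AddCommGroup V₁] [AddCommGroup V₂] [AddCommGroup V₃]
  [Module ℂ V₁] [Module ℂ V₂] [Module ℂ V₃]

lemma tendsto_integral_tileForm {ρ : ℝ → ℝ} {K : ℝ} (h : IsWindow ρ K)
    (τ : V₁ →ₗ[ℂ] V₂ →ₗ[ℂ] V₃ →ₗ[ℂ] ℂ) (α : ℝ) {σ : ℝ} (hσ : 0 < σ) (X : Finset ℤ)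
    (A : ℤ → V₁) (B : ℤ → V₂) (C : ℤ → V₃) (s : ℕ) :
    Filter.Tendsto (fun N => ∫ x, tileForm τ ρ α σ X A B C N s x ∂unitMeasure.prod unitMeasure)
      Filter.atTop (nhds (((σ * 2 ^ s) ^ 3 : ℝ) *
        triForm τ X (scaleKernel ρ α (σ * 2 ^ s)) A B C)) := by
  have ht : 0 < σ * 2 ^ s := by positivity
  have hρ := h.continuous
  simp_rw [integral_tileForm h.continuous]
  rw [triForm, Finset.mul_sum]
  refine tendsto_finsetSum _ fun a _ => ?_
  rw [Finset.mul_sum]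
  refine tendsto_finsetSum _ fun b _ => ?_
  rw [Finset.mul_sum]
  refine tendsto_finsetSum _ fun c _ => ?_
  split_ifs with habc
  swap
  · simp
  set t := σ * 2 ^ s with htdef
  have hInt : Integrable fun z : ℝ => ρ ((a - z) / t) * ρ ((b - z) / t) * ρ ((c - z) / t) := by
    have h1 : Integrable fun z : ℝ => ρ ((c - z) / t) :=
      (h.integrable.comp_div ht.ne').comp_sub_left (c : ℝ)
    refine h1.bdd_mul (c := K * K) (Continuous.aestronglyMeasurable (by fun_prop))
      (Filter.Eventually.of_forall fun z => ?_)
    rw [Real.norm_of_nonneg (mul_nonneg (h.nonneg _) (h.nonneg _))]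
    exact mul_le_mul (h.le_const _) (h.le_const _) (h.nonneg _) h.const_nonneg
  have hN : Filter.Tendsto (fun N : ℕ => (N : ℝ) * 2 ^ s) Filter.atTop Filter.atTop :=
    tendsto_natCast_atTop_atTop.atTop_mul_const (by positivity)
  have key := intervalIntegral_tendsto_integral hInt
    (a := fun N : ℕ => -(N : ℝ) * 2 ^ s) (b := fun N : ℕ => (N : ℝ) * 2 ^ s) (l := Filter.atTop)
    ((Filter.tendsto_neg_atTop_atBot.comp hN).congr fun N => by simp) hN
  have hk := IsWindow.integral_rescale (ρ := ρ) ht ((a - c : ℤ) : ℝ) (c : ℝ)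
  have hab : (a : ℝ) + b = 2 * c := by exact_mod_cast habc
  have ea : (c : ℝ) + ((a - c : ℤ) : ℝ) = a := by push_cast; ring
  have eb : (c : ℝ) - ((a - c : ℤ) : ℝ) = b := by push_cast; linarith
  rw [ea, eb] at hk
  rw [hk] at key
  have key2 := (((Complex.continuous_ofReal.tendsto _).comp key).const_mul
    (cis (-(α / t * (a - b))))).mul_const (τ (A a) (B b) (C c))
  suffices e : ((t ^ 3 : ℝ) : ℂ) * (scaleKernel ρ α t (a - c) * τ (A a) (B b) (C c)) =
      cis (-(α / t * (a - b))) * ((t * tripleCorr ρ (((a - c : ℤ) : ℝ) / t) : ℝ) : ℂ) *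
        τ (A a) (B b) (C c) by
    rw [e]
    exact key2
  unfold scaleKernel
  have e1 : α / t * (a - b) = 2 * α * (((a - c : ℤ) : ℝ) / t) := by
    push_cast
    rw [show (b : ℝ) = 2 * c - a by linarith]
    ring
  have e2 : ((t ^ 3 : ℝ) : ℂ) * ((((t ^ 2)⁻¹ * tripleCorr ρ (((a - c : ℤ) : ℝ) / t) : ℝ)) : ℂ) =
      ((t * tripleCorr ρ (((a - c : ℤ) : ℝ) / t) : ℝ) : ℂ) := by
    rw [← Complex.ofReal_mul]
    congr 1
    field_simp
  rw [e1, ← e2]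
  ring

variable {H : Type*} [NormedAddCommGroup H] [InnerProductSpace ℂ H]
  {ι₁ : V₁ →ₗ[ℂ] H} {ι₂ : V₂ →ₗ[ℂ] H} {ι₃ : V₃ →ₗ[ℂ] H} {τ : V₁ →ₗ[ℂ] V₂ →ₗ[ℂ] V₃ →ₗ[ℂ] ℂ}

/-- The sequences `A`, `B`, `C` are normalized in the three mixed-norm spaces. -/
structure IsNormalized (ι₁ : V₁ →ₗ[ℂ] H) (ι₂ : V₂ →ₗ[ℂ] H) (ι₃ : V₃ →ₗ[ℂ] H) (p q r : ℝ)
    (X : Finset ℤ) (A : ℤ → V₁) (B : ℤ → V₂) (C : ℤ → V₃) : Prop where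
  fst : ∑ x ∈ X, ‖ι₁ (A x)‖ ^ p ≤ 1
  snd : ∑ x ∈ X, ‖ι₂ (B x)‖ ^ q ≤ 1
  thd : ∑ x ∈ X, ‖ι₃ (C x)‖ ^ r ≤ 1

lemma exists_scale_sum_le (hτ : ∀ a b c, ‖τ a b c‖ ≤ ‖ι₁ a‖ * ‖ι₂ b‖ * ‖ι₃ c‖)
    {ρ : ℝ → ℝ} {K : ℝ} (h : IsWindow ρ K) {α : ℝ} {s₀ : ℕ} (hα : 10 ≤ α)
    (hs : 4 * (α + 2) < 2 ^ s₀) {p q r : ℝ} (hp : 2 < p) (hq : 2 < q) (hr : 2 < r)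
    (hpqr : 1 / p + 1 / q + 1 / r = 1) :
    ∃ C₀ : ℝ, 0 ≤ C₀ ∧ ∀ σ ∈ Icc (1 : ℝ) 2, ∀ (S : Finset ℕ), (∀ s ∈ S, s₀ ≤ s) →
      ∀ (X : Finset ℤ) (A : ℤ → V₁) (B : ℤ → V₂) (C : ℤ → V₃),
        IsNormalized ι₁ ι₂ ι₃ p q r X A B C →
        ∑ s ∈ S, 2 ^ s * ‖triForm τ X (scaleKernel ρ α (σ * 2 ^ s)) A B C‖ ≤ C₀ := by
  obtain ⟨C₀, h0, hC⟩ := allTiles.exists_tile_sum_le H h hα hs ![p, q, r]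
    (by intro j; fin_cases j <;> simpa) (by simpa [Fin.sum_univ_three] using hpqr)
  refine ⟨C₀, h0, fun σ hσ S hS X A B C hABC => ?_⟩
  have hσ0 : 0 < σ := zero_lt_one.trans_le hσ.1
  have bound : ∀ N : ℕ, ∑ s ∈ S, (2 ^ s * ((σ * 2 ^ s) ^ 3)⁻¹) *
      ‖∫ x, tileForm τ ρ α σ X A B C N s x ∂unitMeasure.prod unitMeasure‖ ≤ C₀ := by
    intro N
    refine sum_mul_norm_integral_le (fun s => continuous_tileForm h.continuous _ _ _ _ _ _ _ _ _)
      (fun s => by positivity) fun u hu v hv => ?_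
    set T : ℕ → Finset (ℤ × ℤ) := fun s =>
      Finset.Ico (-N : ℤ) (-N + (2 * N : ℕ)) ×ˢ Finset.Ico (0 : ℤ) (0 + (2 ^ s : ℕ)) with hT
    set 𝒬 : Finset (ℕ × ℤ × ℤ) := (S.sigma T).map (Equiv.sigmaEquivProd _ _).toEmbedding with h𝒬
    have hmem : ∀ P, P ∈ 𝒬 ↔ P.1 ∈ S ∧ P.2 ∈ T P.1 := by
      intro P
      simp only [h𝒬, Finset.mem_map, Finset.mem_sigma, Equiv.toEmbedding_apply]
      constructor
      · rintro ⟨x, hx, rfl⟩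
        exact hx
      · intro hx
        exact ⟨⟨P.1, P.2⟩, hx, rfl⟩
    set A' : Fin 3 → ℤ → H := ![fun x => ι₁ (A x), fun x => ι₂ (B x), fun x => ι₃ (C x)] with hA'
    refine le_trans ?_ (hC σ hσ u hu v hv 𝒬 (fun P hP => ?_) X A' fun j => ?_)
    · rw [Finset.sum_finset_product (f := fun P : ℕ × ℤ × ℤ => ((2 : ℝ) ^ P.1)⁻¹ ^ 2 * ∏ j,
        ‖∑ x ∈ X, wave ρ ((P.2.1 + u) * 2 ^ P.1) (σ * 2 ^ P.1) (allTiles.theta α (σ * 2 ^ P.1)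
          (allTiles.eta v P) j) x • A' j x‖) 𝒬 S T hmem]
      refine Finset.sum_le_sum fun s _ => ?_
      have hc : (2 : ℝ) ^ s * ((σ * 2 ^ s) ^ 3)⁻¹ ≤ ((2 : ℝ) ^ s)⁻¹ ^ 2 := by
        have h2 : (0 : ℝ) < 2 ^ s := by positivity
        have h3 : 1 ≤ σ ^ 3 := one_le_pow₀ hσ.1
        rw [← div_eq_mul_inv, div_le_iff₀ (by positivity), mul_pow]
        have : ((2 : ℝ) ^ s)⁻¹ ^ 2 * (σ ^ 3 * (2 ^ s) ^ 3) = σ ^ 3 * 2 ^ s := by field_simp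
        rw [this]
        nlinarith
      dsimp only
      rw [← Finset.mul_sum]
      refine mul_le_mul hc ?_ (norm_nonneg _) (by positivity)
      rw [tileForm, ← Finset.sum_product']
      refine norm_sum_le_of_le _ fun P _ => ?_
      rw [Fin.prod_univ_three]
      simp only [prodWave, ← apply_sum_smul]
      refine (hτ _ _ _).trans (le_of_eq ?_)
      simp [hA', allTiles.eta]
    · rw [hmem] at hP
      refine ⟨hS _ hP.1, ?_⟩
      have := hP.2
      simp only [hT, Finset.mem_product, Finset.mem_Ico] at this
      refine ⟨this.2.1, ?_⟩
      have h2 := this.2.2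
      push_cast at h2
      simpa using h2
    · fin_cases j
      · exact hABC.fst
      · exact hABC.snd
      · exact hABC.thd
  refine le_of_tendsto (x := Filter.atTop) (tendsto_finsetSum S fun s _ => ?_)
    (Filter.Eventually.of_forall bound)
  convert (tendsto_integral_tileForm h τ α hσ0 X A B C s).norm.const_mul
    (2 ^ s * ((σ * 2 ^ s) ^ 3)⁻¹) using 2
  have ht : 0 < σ * 2 ^ s := by positivity
  rw [norm_mul, Complex.norm_real, Real.norm_of_nonneg (by positivity)]
  field_simp

end

lemma intervalIntegrable_finsetSum {ι : Type*} {s : Finset ι} {f : ι → ℝ → ℂ} {a b : ℝ}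
    (h : ∀ i ∈ s, IntervalIntegrable (f i) volume a b) :
    IntervalIntegrable (fun x => ∑ i ∈ s, f i x) volume a b := by
  simpa only [Finset.sum_fn] using IntervalIntegrable.sum s h

lemma norm_integral_dyadic_le {F : ℝ → ℂ} (hF : ContinuousOn F (Ioi 0)) {s₀ N : ℕ} {C : ℝ}
    (h : ∀ σ ∈ Icc (1 : ℝ) 2, ∑ s ∈ Finset.Ico s₀ (s₀ + N), 2 ^ s * ‖F (σ * 2 ^ s)‖ ≤ C) :
    ‖∫ t in (2 : ℝ) ^ s₀..2 ^ s₀ * 2 ^ N, F t‖ ≤ C := by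
  have hI : ∀ s : ℕ, IntervalIntegrable F volume (2 ^ s) (2 ^ (s + 1)) := fun s =>
    ContinuousOn.intervalIntegrable (hF.mono fun x hx => by
      have h1 : (0 : ℝ) < 2 ^ s := by positivity
      have h2 : (0 : ℝ) < 2 ^ (s + 1) := by positivity
      exact (lt_min h1 h2).trans_le hx.1)
  have hI2 : ∀ s : ℕ, IntervalIntegrable (fun σ => 2 ^ s * ‖F (σ * 2 ^ s)‖) volume 1 2 := fun s =>
    ContinuousOn.intervalIntegrable (continuousOn_const.mul
      (ContinuousOn.norm (hF.comp (by fun_prop) fun x hx => by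
        rw [uIcc_of_le one_le_two] at hx
        have : 0 < x := zero_lt_one.trans_le hx.1
        exact mem_Ioi.2 (by positivity))))
  rw [← pow_add, ← intervalIntegral.sum_integral_adjacent_intervals_Ico (a := fun s => (2 : ℝ) ^ s)
    (Nat.le_add_right _ _) fun s _ => hI s]
  calc _ ≤ ∑ s ∈ Finset.Ico s₀ (s₀ + N), ∫ σ in (1 : ℝ)..2, 2 ^ s * ‖F (σ * 2 ^ s)‖ := by
        refine norm_sum_le_of_le _ fun s _ => ?_
        have e := intervalIntegral.smul_integral_comp_mul_right (a := 1) (b := 2) F (2 ^ s)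
        rw [one_mul, mul_comm (2 : ℝ), ← pow_succ] at e
        rw [← e, norm_smul, Real.norm_of_nonneg (by positivity), intervalIntegral.integral_const_mul]
        exact mul_le_mul_of_nonneg_left
          (intervalIntegral.norm_integral_le_integral_norm one_le_two) (by positivity)
    _ = ∫ σ in (1 : ℝ)..2, ∑ s ∈ Finset.Ico s₀ (s₀ + N), 2 ^ s * ‖F (σ * 2 ^ s)‖ :=
        (intervalIntegral.integral_finsetSum fun s _ => hI2 s).symm
    _ ≤ ∫ σ in (1 : ℝ)..2, C :=
        intervalIntegral.integral_mono_on one_le_two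
          (by simpa only [Finset.sum_fn] using IntervalIntegrable.sum _ fun s _ => hI2 s)
          intervalIntegrable_const h
    _ = C := by simp; norm_num

section

variable {V₁ V₂ V₃ : Type*} [AddCommGroup V₁] [AddCommGroup V₂] [AddCommGroup V₃]
  [Module ℂ V₁] [Module ℂ V₂] [Module ℂ V₃]
  {H : Type*} [NormedAddCommGroup H] [InnerProductSpace ℂ H]
  {ι₁ : V₁ →ₗ[ℂ] H} {ι₂ : V₂ →ₗ[ℂ] H} {ι₃ : V₃ →ₗ[ℂ] H} {τ : V₁ →ₗ[ℂ] V₂ →ₗ[ℂ] V₃ →ₗ[ℂ] ℂ}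
  {p q r : ℝ} {X : Finset ℤ} {A : ℤ → V₁} {B : ℤ → V₂} {C : ℤ → V₃}

lemma triForm_sub (κ κ' : ℤ → ℂ) : triForm τ X (fun k => κ k - κ' k) A B C =
    triForm τ X κ A B C - triForm τ X κ' A B C := by
  simp only [triForm, ← Finset.sum_sub_distrib]
  refine Finset.sum_congr rfl fun x _ => Finset.sum_congr rfl fun y _ =>
    Finset.sum_congr rfl fun w _ => ?_
  split_ifs <;> ring

lemma triForm_const_mul (c : ℂ) (κ : ℤ → ℂ) : triForm τ X (fun k => c * κ k) A B C =
    c * triForm τ X κ A B C := by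
  simp only [triForm, Finset.mul_sum]
  refine Finset.sum_congr rfl fun x _ => Finset.sum_congr rfl fun y _ =>
    Finset.sum_congr rfl fun w _ => ?_
  split_ifs <;> ring

lemma triForm_flip (κ : ℤ → ℂ) :
    triForm τ.flip X κ B A C = triForm τ X (fun k => κ (-k)) A B C := by
  unfold triForm
  rw [Finset.sum_comm]
  refine Finset.sum_congr rfl fun x _ => Finset.sum_congr rfl fun y _ =>
    Finset.sum_congr rfl fun w _ => ?_
  rw [add_comm y x, LinearMap.flip_apply]
  split_ifs with h
  · rw [show y - w = -(x - w) by omega]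
  · rfl

lemma tendsto_triForm {κ : ℕ → ℤ → ℂ} {κ' : ℤ → ℂ}
    (h : ∀ k, Filter.Tendsto (fun N => κ N k) Filter.atTop (nhds (κ' k))) :
    Filter.Tendsto (fun N => triForm τ X (κ N) A B C) Filter.atTop
      (nhds (triForm τ X κ' A B C)) := by
  refine tendsto_finsetSum _ fun x _ => tendsto_finsetSum _ fun y _ =>
    tendsto_finsetSum _ fun w _ => ?_
  split_ifs
  · exact (h _).mul_const _
  · exact tendsto_const_nhds

lemma integral_triForm {κ : ℝ → ℤ → ℂ} {a b : ℝ}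
    (h : ∀ k, IntervalIntegrable (fun t => κ t k) volume a b) :
    ∫ t in a..b, triForm τ X (κ t) A B C = triForm τ X (fun k => ∫ t in a..b, κ t k) A B C := by
  have hi : ∀ x y w : ℤ, IntervalIntegrable (fun t => if x + y = 2 * w then
      κ t (x - w) * τ (A x) (B y) (C w) else 0) volume a b := by
    intro x y w
    split_ifs
    · exact (h _).mul_const _
    · exact intervalIntegrable_const
  unfold triForm
  rw [intervalIntegral.integral_finsetSum fun x _ => intervalIntegrable_finsetSum fun y _ =>
    intervalIntegrable_finsetSum fun w _ => hi x y w]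
  refine Finset.sum_congr rfl fun x _ => ?_
  rw [intervalIntegral.integral_finsetSum fun y _ => intervalIntegrable_finsetSum fun w _ => hi x y w]
  refine Finset.sum_congr rfl fun y _ => ?_
  rw [intervalIntegral.integral_finsetSum fun w _ => hi x y w]
  refine Finset.sum_congr rfl fun w _ => ?_
  split_ifs
  · rw [intervalIntegral.integral_mul_const]
  · simp

lemma mul_mul_le_rpow_add {a b c : ℝ} (ha : 0 ≤ a) (hb : 0 ≤ b) (hc : 0 ≤ c)
    (hp : 2 < p) (hq : 2 < q) (hr : 2 < r) (hpqr : 1 / p + 1 / q + 1 / r = 1) :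
    a * b * c ≤ a ^ p + b ^ q + c ^ r := by
  have key : ∀ (x s : ℝ), 0 ≤ x → 2 < s →
      (x ^ s) ^ (1 / s) = x ∧ 0 ≤ x ^ s ∧ 1 / s * x ^ s ≤ x ^ s ∧ 0 ≤ 1 / s := by
    intro x s hx hs
    have h0 : 0 ≤ x ^ s := rpow_nonneg hx _
    refine ⟨?_, h0, mul_le_of_le_one_left h0 ?_, by positivity⟩
    · rw [← rpow_mul hx, mul_one_div_cancel (by linarith), rpow_one]
    · rw [div_le_one (by linarith)]
      linarith
  obtain ⟨a1, a2, a3, a4⟩ := key a p ha hp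
  obtain ⟨b1, b2, b3, b4⟩ := key b q hb hq
  obtain ⟨c1, c2, c3, c4⟩ := key c r hc hr
  have := Real.geom_mean_le_arith_mean3_weighted a4 b4 c4 a2 b2 c2 hpqr
  rw [a1, b1, c1] at this
  linarith

/-- Trilinear forms with summable kernels are bounded. -/
lemma norm_triForm_le (hτ : ∀ a b c, ‖τ a b c‖ ≤ ‖ι₁ a‖ * ‖ι₂ b‖ * ‖ι₃ c‖)
    (hp : 2 < p) (hq : 2 < q) (hr : 2 < r) (hpqr : 1 / p + 1 / q + 1 / r = 1)
    (hABC : IsNormalized ι₁ ι₂ ι₃ p q r X A B C) {κ : ℤ → ℂ} {e : ℤ → ℝ} (he : Summable e)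
    (hκ : ∀ k, ‖κ k‖ ≤ e k) : ‖triForm τ X κ A B C‖ ≤ 3 * ∑' k, e k := by
  have he0 : ∀ k, 0 ≤ e k := fun k => (norm_nonneg _).trans (hκ k)
  set E : ℤ → ℤ → ℤ → ℝ := fun x y w => if x + y = 2 * w then e (x - w) else 0 with hE
  have hE0 : ∀ x y w, 0 ≤ E x y w := fun x y w => by
    simp only [hE]; split_ifs; exacts [he0 _, le_rfl]
  have hsum : ∀ φ : ℤ → ℤ, Function.Injective φ → ∑ w ∈ X, e (φ w) ≤ ∑' k, e k := by
    intro φ hφ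
    rw [← Finset.sum_image (s := X) (g := φ) (f := e) fun _ _ _ _ h => hφ h]
    exact he.sum_le_tsum _ fun k _ => he0 k
  have h1 : ∀ x, ∑ y ∈ X, ∑ w ∈ X, E x y w ≤ ∑' k, e k := by
    intro x
    rw [Finset.sum_comm]
    refine (Finset.sum_le_sum fun w _ => ?_).trans (hsum (fun w => x - w) fun a b h => by
      simpa using h)
    have : ∀ y, E x y w = if y = 2 * w - x then e (x - w) else 0 := fun y =>
      if_congr (by omega) rfl rfl
    simp_rw [this, Finset.sum_ite_eq']
    split_ifs; exacts [le_rfl, he0 _]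
  have h2 : ∀ y, ∑ x ∈ X, ∑ w ∈ X, E x y w ≤ ∑' k, e k := by
    intro y
    rw [Finset.sum_comm]
    refine (Finset.sum_le_sum fun w _ => ?_).trans (hsum (fun w => w - y) fun a b h => by
      simpa using h)
    have : ∀ x, E x y w = if x = 2 * w - y then e (w - y) else 0 := fun x => by
      simp only [hE]
      by_cases h : x + y = 2 * w
      · rw [if_pos h, if_pos (by omega), show x - w = w - y by omega]
      · rw [if_neg h, if_neg (by omega)]
    simp_rw [this, Finset.sum_ite_eq']
    split_ifs; exacts [le_rfl, he0 _]
  have h3 : ∀ w, ∑ x ∈ X, ∑ y ∈ X, E x y w ≤ ∑' k, e k := by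
    intro w
    refine (Finset.sum_le_sum fun x _ => ?_).trans (hsum (fun x => x - w) fun a b h => by
      simpa using h)
    have : ∀ y, E x y w = if y = 2 * w - x then e (x - w) else 0 := fun y =>
      if_congr (by omega) rfl rfl
    simp_rw [this, Finset.sum_ite_eq']
    split_ifs; exacts [le_rfl, he0 _]
  have hS : 0 ≤ ∑' k, e k := tsum_nonneg he0
  calc _ ≤ ∑ x ∈ X, ∑ y ∈ X, ∑ w ∈ X, (E x y w * ‖ι₁ (A x)‖ ^ p + E x y w * ‖ι₂ (B y)‖ ^ q +
        E x y w * ‖ι₃ (C w)‖ ^ r) := by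
        refine norm_sum_le_of_le _ fun x _ => norm_sum_le_of_le _ fun y _ =>
          norm_sum_le_of_le _ fun w _ => ?_
        rw [← mul_add, ← mul_add]
        simp only [hE]
        split_ifs
        · rw [norm_mul]
          exact mul_le_mul (hκ _) ((hτ _ _ _).trans (mul_mul_le_rpow_add (norm_nonneg _)
            (norm_nonneg _) (norm_nonneg _) hp hq hr hpqr)) (norm_nonneg _) (he0 _)
        · simp
    _ = ∑ x ∈ X, (∑ y ∈ X, ∑ w ∈ X, E x y w) * ‖ι₁ (A x)‖ ^ p +
        ∑ y ∈ X, (∑ x ∈ X, ∑ w ∈ X, E x y w) * ‖ι₂ (B y)‖ ^ q +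
        ∑ w ∈ X, (∑ x ∈ X, ∑ y ∈ X, E x y w) * ‖ι₃ (C w)‖ ^ r := by
        simp only [Finset.sum_add_distrib, Finset.sum_mul]
        congr 1
        · congr 1
          rw [Finset.sum_comm]
        · rw [Finset.sum_congr rfl fun x _ => Finset.sum_comm, Finset.sum_comm]
    _ ≤ ∑ x ∈ X, (∑' k, e k) * ‖ι₁ (A x)‖ ^ p + ∑ y ∈ X, (∑' k, e k) * ‖ι₂ (B y)‖ ^ q +
        ∑ w ∈ X, (∑' k, e k) * ‖ι₃ (C w)‖ ^ r := by
        gcongr with x _ y _ w _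
        exacts [h1 x, h2 y, h3 w]
    _ ≤ (∑' k, e k) * 1 + (∑' k, e k) * 1 + (∑' k, e k) * 1 := by
        simp only [← Finset.mul_sum]
        gcongr
        exacts [hABC.fst, hABC.snd, hABC.thd]
    _ = _ := by ring

end

lemma cis_neg_sub_cis (θ : ℝ) : cis (-θ) - cis θ = -2 * Complex.I * (Real.sin (2 * π * θ) : ℂ) := by
  unfold cis
  rw [Complex.exp_mul_I, Complex.exp_mul_I]
  push_cast
  rw [mul_neg, Complex.cos_neg, Complex.sin_neg]
  ring

section

variable {V₁ V₂ V₃ : Type*} [AddCommGroup V₁] [AddCommGroup V₂] [AddCommGroup V₃]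
  [Module ℂ V₁] [Module ℂ V₂] [Module ℂ V₃]
  {H : Type*} [NormedAddCommGroup H] [InnerProductSpace ℂ H]
  {ι₁ : V₁ →ₗ[ℂ] H} {ι₂ : V₂ →ₗ[ℂ] H} {ι₃ : V₃ →ₗ[ℂ] H} {τ : V₁ →ₗ[ℂ] V₂ →ₗ[ℂ] V₃ →ₗ[ℂ] ℂ}
  {p q r : ℝ}

lemma continuousOn_scaleKernel {ρ : ℝ → ℝ} (hG : Continuous (tripleCorr ρ)) (α : ℝ) (k : ℤ) :
    ContinuousOn (fun t => scaleKernel ρ α t k) (Ioi 0) := by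
  have h0 : ∀ t ∈ Ioi (0 : ℝ), t ≠ 0 := fun t ht => (mem_Ioi.1 ht).ne'
  have h1 : ContinuousOn (fun t : ℝ => (k : ℝ) / t) (Ioi 0) := continuousOn_const.div continuousOn_id h0
  unfold scaleKernel
  refine ContinuousOn.mul (Complex.continuous_ofReal.comp_continuousOn
    (ContinuousOn.mul ?_ (hG.comp_continuousOn h1))) ?_
  · exact (continuousOn_id.pow 2).inv₀ fun t ht => pow_ne_zero 2 (h0 t ht)
  · exact continuous_cis.comp_continuousOn (continuousOn_const.mul h1).neg

lemma continuousOn_triForm {κ : ℝ → ℤ → ℂ} {s : Set ℝ} (h : ∀ k, ContinuousOn (fun t => κ t k) s)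
    (X : Finset ℤ) (A : ℤ → V₁) (B : ℤ → V₂) (C : ℤ → V₃) :
    ContinuousOn (fun t => triForm τ X (κ t) A B C) s := by
  refine continuousOn_finsetSum _ fun x _ => continuousOn_finsetSum _ fun y _ =>
    continuousOn_finsetSum _ fun w _ => ?_
  split_ifs
  · exact (h _).mul_const _
  · exact continuousOn_const

lemma exists_scale_integral_le (hτ : ∀ a b c, ‖τ a b c‖ ≤ ‖ι₁ a‖ * ‖ι₂ b‖ * ‖ι₃ c‖)
    {ρ : ℝ → ℝ} {K : ℝ} (h : IsWindow ρ K) {α : ℝ} {s₀ : ℕ} (hα : 10 ≤ α)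
    (hs : 4 * (α + 2) < 2 ^ s₀) (hp : 2 < p) (hq : 2 < q) (hr : 2 < r)
    (hpqr : 1 / p + 1 / q + 1 / r = 1) :
    ∃ C₀, 0 ≤ C₀ ∧ ∀ N : ℕ, ∀ X A B C, IsNormalized ι₁ ι₂ ι₃ p q r X A B C →
      ‖triForm τ X (fun k => ∫ t in (2 : ℝ) ^ s₀..2 ^ s₀ * 2 ^ N, scaleKernel ρ α t k) A B C‖
        ≤ C₀ := by
  obtain ⟨C₀, hC₀, hb⟩ := exists_scale_sum_le hτ h hα hs hp hq hr hpqr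
  refine ⟨C₀, hC₀, fun N X A B C hABC => ?_⟩
  have hc := continuousOn_scaleKernel h.continuous_tripleCorr α
  rw [← integral_triForm fun k => ((hc k).mono fun x hx => ?_).intervalIntegrable]
  · exact norm_integral_dyadic_le (continuousOn_triForm hc X A B C) fun σ hσ =>
      hb σ hσ _ (fun s hs => (Finset.mem_Ico.1 hs).1) X A B C hABC
  · exact (lt_min (by positivity) (by positivity : (0 : ℝ) < 2 ^ s₀ * 2 ^ N)).trans_le hx.1

/-- The discrete bilinear Hilbert transform with values in the local form `τ`. -/
theorem exists_triForm_inv_le (hτ : ∀ a b c, ‖τ a b c‖ ≤ ‖ι₁ a‖ * ‖ι₂ b‖ * ‖ι₃ c‖)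
    (hp : 2 < p) (hq : 2 < q) (hr : 2 < r) (hpqr : 1 / p + 1 / q + 1 / r = 1) :
    ∃ C₀, 0 ≤ C₀ ∧ ∀ X A B C, IsNormalized ι₁ ι₂ ι₃ p q r X A B C →
      ‖triForm τ X (fun k => (k : ℂ)⁻¹) A B C‖ ≤ C₀ := by
  obtain ⟨ρ, K, h⟩ := exists_isWindow
  set G := tripleCorr ρ with hG
  have hGc : Continuous G := h.continuous_tripleCorr
  set B₀ := K ^ 2 * (∫ v, ρ v) with hB₀
  have hGB : ∀ u, |G u| ≤ B₀ * decay 1 u ^ 2 := h.abs_tripleCorr_le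
  have hGi : Integrable G := by
    have h2 : Integrable fun u : ℝ => B₀ * (1 + ‖u‖) ^ (-2 : ℝ) :=
      (integrable_one_add_norm (by simp)).const_mul _
    refine h2.mono' hGc.aestronglyMeasurable (ae_of_all _ fun u => (hGB u).trans_eq ?_)
    rw [rpow_neg (by positivity)]
    simp [decay]
  obtain ⟨α, hα, hco⟩ := exists_sine_transform_ne_zero hGc hGi
    (fun u => IsWindow.tripleCorr_neg (ρ := ρ) u) h.tripleCorr_zero_pos.ne' 10
  set g : ℝ → ℝ := fun u => sin (2 * π * (2 * α) * u) * G u with hg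
  have hgc : Continuous g := by fun_prop
  have hgodd : ∀ u, g (-u) = -g u := fun u => by
    simp only [hg, hG, IsWindow.tripleCorr_neg (ρ := ρ) u, mul_neg, sin_neg, neg_mul]
  have hgB : ∀ u, |g u| ≤ B₀ * decay 1 u ^ 2 := fun u => by
    rw [hg, abs_mul]
    exact (mul_le_of_le_one_left (abs_nonneg _) (abs_sin_le_one _)).trans (hGB u)
  set c : ℝ := ∫ u in Ioi 0, g u with hc
  obtain ⟨s₀, hs₀⟩ := pow_unbounded_of_one_lt (4 * (α + 2)) (one_lt_two : (1 : ℝ) < 2)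
  set a : ℝ := 2 ^ s₀ with ha
  have ha0 : 0 < a := by positivity
  obtain ⟨κ, hκ0, hκ, hκe⟩ := exists_kernel_of_odd hgc hgodd hgB ha0
  obtain ⟨C₁, hC₁, h1⟩ := exists_scale_integral_le hτ h hα hs₀ hp hq hr hpqr
  obtain ⟨C₂, hC₂, h2⟩ := exists_scale_integral_le (τ := τ.flip) (ι₁ := ι₂) (ι₂ := ι₁) (ι₃ := ι₃)
    (fun b a c => (hτ a b c).trans_eq (by ring)) h hα hs₀ hq hp hr (by linarith)
  have hcont := continuousOn_scaleKernel hGc α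
  have hInt : ∀ (N : ℕ) k, IntervalIntegrable (fun t => scaleKernel ρ α t k) volume a (a * 2 ^ N) :=
    fun N k => ((hcont k).mono fun x hx =>
      (lt_min ha0 (by positivity : 0 < a * 2 ^ N)).trans_le hx.1).intervalIntegrable
  have hdiff : ∀ (N : ℕ) (k : ℤ), (∫ t in a..a * 2 ^ N, scaleKernel ρ α t k) -
      (∫ t in a..a * 2 ^ N, scaleKernel ρ α t (-k)) =
      -2 * Complex.I * ((∫ t in a..a * 2 ^ N, (t ^ 2)⁻¹ * g (k / t) : ℝ) : ℂ) := by
    intro N k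
    rw [← intervalIntegral.integral_sub (hInt N k) (hInt N (-k)), ← intervalIntegral.integral_ofReal,
      ← intervalIntegral.integral_const_mul]
    congr 1
    funext t
    have e1 : tripleCorr ρ (((-k : ℤ) : ℝ) / t) = G (k / t) := by
      rw [← IsWindow.tripleCorr_neg (ρ := ρ)]
      congr 1
      push_cast
      ring
    have e2 : cis (-(2 * (α * (((-k : ℤ) : ℝ) / t)))) = cis (2 * α * (k / t)) := by
      congr 1
      push_cast
      ring
    have e3 := cis_neg_sub_cis (2 * α * (k / t))
    rw [← mul_assoc (2 * π)] at e3
    unfold scaleKernel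
    rw [e1, mul_assoc 2 α (((-k : ℤ) : ℝ) / t), e2, ← mul_sub, e3]
    simp only [hg]
    push_cast
    ring
  have hbound : ∀ X A B C, IsNormalized ι₁ ι₂ ι₃ p q r X A B C →
      ‖triForm τ X (fun k => (κ k : ℂ)) A B C‖ ≤ C₁ + C₂ := by
    intro X A B C hABC
    have hlim := tendsto_triForm (τ := τ) (X := X) (A := A) (B := B) (C := C) fun k =>
      (((Complex.continuous_ofReal.tendsto _).comp (hκ k)).const_mul (-2 * Complex.I))
    have hle := le_of_tendsto' hlim.norm fun N => by
      have e : (fun k : ℤ => -2 * Complex.I * (Complex.ofReal ∘ fun N : ℕ =>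
          ∫ t in a..a * 2 ^ N, (t ^ 2)⁻¹ * g (k / t)) N) = fun k : ℤ =>
          (∫ t in a..a * 2 ^ N, scaleKernel ρ α t k) -
            (∫ t in a..a * 2 ^ N, scaleKernel ρ α t (-k)) := by
        funext k
        rw [hdiff]
        rfl
      rw [e, triForm_sub, ← triForm_flip fun k => ∫ t in a..a * 2 ^ N, scaleKernel ρ α t k]
      exact (norm_sub_le _ _).trans (add_le_add (h1 N X A B C hABC)
        (h2 N X B A C ⟨hABC.snd, hABC.fst, hABC.thd⟩))
    rw [triForm_const_mul, norm_mul] at hle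
    have : ‖-2 * Complex.I‖ = 2 := by simp
    rw [this] at hle
    have := norm_nonneg (triForm τ X (fun k => (κ k : ℂ)) A B C)
    linarith
  have hsum : Summable fun k : ℤ => |c|⁻¹ * (B₀ * a * ((k : ℝ) ^ 2)⁻¹) := by
    refine Summable.mul_left _ (Summable.mul_left _ ?_)
    simpa using Real.summable_one_div_int_pow.2 (one_lt_two)
  have hsum0 : 0 ≤ ∑' k : ℤ, |c|⁻¹ * (B₀ * a * ((k : ℝ) ^ 2)⁻¹) := by
    refine tsum_nonneg fun k => mul_nonneg (by positivity) ((abs_nonneg _).trans (hκe k))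
  refine ⟨|c|⁻¹ * (C₁ + C₂) + 3 * ∑' k : ℤ, |c|⁻¹ * (B₀ * a * ((k : ℝ) ^ 2)⁻¹), by positivity,
    fun X A B C hABC => ?_⟩
  have e : (fun k : ℤ => (k : ℂ)⁻¹) = fun k : ℤ => (c : ℂ)⁻¹ * κ k -
      (c : ℂ)⁻¹ * ((κ k - c * (k : ℝ)⁻¹ : ℝ) : ℂ) := by
    funext k
    have : (c : ℂ) ≠ 0 := by exact_mod_cast hco
    push_cast
    field_simp
    ring
  rw [e, triForm_sub, triForm_const_mul]
  refine (norm_sub_le _ _).trans (add_le_add ?_ ?_)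
  · rw [norm_mul, norm_inv, Complex.norm_real, Real.norm_eq_abs]
    gcongr
    exact hbound X A B C hABC
  · refine norm_triForm_le hτ hp hq hr hpqr hABC hsum fun k => ?_
    rw [norm_mul, norm_inv, Complex.norm_real, Complex.norm_real, Real.norm_eq_abs,
      Real.norm_eq_abs]
    gcongr
    exact hκe k

end

/-- Lebesgue measure on a unit interval centred at the origin. -/
noncomputable def cellMeasure : Measure ℝ := volume.restrict (Ioc (-(1 / 2)) (1 / 2))

instance : IsProbabilityMeasure cellMeasure := ⟨by
  rw [cellMeasure, Measure.restrict_apply_univ, Real.volume_Ioc]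
  norm_num⟩

lemma lintegral_comp_two_mul {F : ℝ → ℝ≥0∞} (hF : Measurable F) :
    ∫⁻ t, F (2 * t) = 2⁻¹ * ∫⁻ t, F t := by
  rw [← lintegral_map hF (measurable_const_mul 2), Real.map_volume_mul_left two_ne_zero,
    lintegral_smul_measure, abs_of_pos (by norm_num), ENNReal.ofReal_inv_of_pos two_pos]
  simp

lemma lintegral_eq_tsum_cell (F : ℝ → ℝ≥0∞) :
    ∫⁻ x, F x = ∑' m : ℤ, ∫⁻ t, F (m + t) ∂cellMeasure := by
  rw [← setLIntegral_univ, ← iUnion_Ioc_add_intCast (-(1 / 2) : ℝ),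
    lintegral_iUnion (fun _ => measurableSet_Ioc) (pairwise_disjoint_Ioc_add_intCast _)]
  refine tsum_congr fun m => ?_
  rw [cellMeasure, ← lintegral_indicator measurableSet_Ioc, ← lintegral_indicator measurableSet_Ioc,
    ← lintegral_add_left_eq_self _ (m : ℝ)]
  refine lintegral_congr fun t => ?_
  by_cases h : t ∈ Ioc (-(1 / 2)) (1 / 2 : ℝ)
  · rw [indicator_of_mem h, indicator_of_mem]
    constructor <;> linarith [h.1, h.2]
  · rw [indicator_of_notMem h, indicator_of_notMem]
    intro h'
    exact h ⟨by linarith [h'.1], by linarith [h'.2]⟩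

lemma lintegral_cell_two_mul {F : ℝ → ℝ≥0∞} (hF : Measurable F) :
    ∫⁻ t, F (2 * t) ∂cellMeasure = 2⁻¹ * ∫⁻ t, (Ioc (-1) 1).indicator F t := by
  rw [← lintegral_comp_two_mul (hF.indicator measurableSet_Ioc), cellMeasure,
    ← lintegral_indicator measurableSet_Ioc]
  refine lintegral_congr fun t => ?_
  by_cases h : t ∈ Ioc (-(1 / 2)) (1 / 2 : ℝ)
  · rw [indicator_of_mem h, indicator_of_mem]
    constructor <;> linarith [h.1, h.2]
  · rw [indicator_of_notMem h, indicator_of_notMem]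
    intro h'
    exact h ⟨by linarith [h'.1], by linarith [h'.2]⟩

lemma lintegral_cell_prod_le {F G : ℝ → ℝ≥0∞} (hF : Measurable F) (hG : Measurable G) :
    ∫⁻ z, F (z.1 + z.2) * G (z.1 - z.2) ∂(cellMeasure.prod cellMeasure) ≤
      2 * ((∫⁻ t, F (2 * t) ∂cellMeasure) * ∫⁻ t, G (2 * t) ∂cellMeasure) := by
  set F' := (Ioc (-1) 1).indicator F with hF'
  set G' := (Ioc (-1) 1).indicator G with hG'
  have mF : Measurable F' := hF.indicator measurableSet_Ioc
  have mG : Measurable G' := hG.indicator measurableSet_Ioc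
  rw [lintegral_cell_two_mul hF, lintegral_cell_two_mul hG, ← hF', ← hG']
  calc _ ≤ ∫⁻ z, F' (z.1 + z.2) * G' (z.1 - z.2) ∂((volume : Measure ℝ).prod volume) := by
        rw [cellMeasure, Measure.prod_restrict,
          ← lintegral_indicator (measurableSet_Ioc.prod measurableSet_Ioc)]
        refine lintegral_mono fun z => indicator_le (g := fun z => F' (z.1 + z.2) * G' (z.1 - z.2))
          (fun z hz => ?_) z
        obtain ⟨⟨h1, h2⟩, h3, h4⟩ := hz
        have e1 : z.1 + z.2 ∈ Ioc (-1 : ℝ) 1 := ⟨by linarith, by linarith⟩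
        have e2 : z.1 - z.2 ∈ Ioc (-1 : ℝ) 1 := ⟨by linarith, by linarith⟩
        rw [hF', hG', indicator_of_mem e1, indicator_of_mem e2]
    _ = ∫⁻ t, ∫⁻ s, F' s * G' (2 * t - s) := by
        rw [lintegral_prod _ (by fun_prop)]
        refine lintegral_congr fun t => ?_
        rw [← lintegral_add_left_eq_self (fun s => F' s * G' (2 * t - s)) t]
        refine lintegral_congr fun s => ?_
        congr 2
        ring
    _ = ∫⁻ s, ∫⁻ t, F' s * G' (2 * t - s) := lintegral_lintegral_swap (by fun_prop)
    _ = ∫⁻ s, F' s * (2⁻¹ * ∫⁻ t, G' t) := by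
        refine lintegral_congr fun s => ?_
        rw [lintegral_const_mul _ (by fun_prop), lintegral_comp_two_mul (F := fun t => G' (t - s))
          (by fun_prop), lintegral_sub_right_eq_self]
    _ = (∫⁻ s, F' s) * (2⁻¹ * ∫⁻ t, G' t) := lintegral_mul_const _ mF
    _ = _ := by
        have e : (2 : ℝ≥0∞) * (2⁻¹ * 2⁻¹) = 2⁻¹ := by
          rw [← mul_assoc, ENNReal.mul_inv_cancel (by simp) (by simp), one_mul]
        rw [mul_mul_mul_comm, ← mul_assoc 2 (2⁻¹ * 2⁻¹), e, mul_left_comm]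

/-- The square of two unit cells. -/
noncomputable def squareMeasure : Measure (ℝ × ℝ) := cellMeasure.prod cellMeasure

instance : IsProbabilityMeasure squareMeasure := by unfold squareMeasure; infer_instance

/-- The embedding of functions on the square into `L²`. -/
noncomputable def squareEmb : (ℝ × ℝ →ᵇ ℂ) →ₗ[ℂ] Lp ℂ 2 squareMeasure :=
  (BoundedContinuousFunction.toLp 2 squareMeasure ℂ).toLinearMap

/-- The local `L²` embedding of functions on the line. -/
noncomputable def lineEmb : (ℝ →ᵇ ℂ) →ₗ[ℂ] Lp ℂ 2 squareMeasure where
  toFun a := squareEmb (a.compContinuous ⟨fun z => 2 * z.1, by fun_prop⟩)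
  map_add' a b := by rw [← map_add]; rfl
  map_smul' c a := by rw [← map_smul]; rfl

/-- The product `(t, y) ↦ a (t + y) b (t - y)`. -/
noncomputable def skewProd : (ℝ →ᵇ ℂ) →ₗ[ℂ] (ℝ →ᵇ ℂ) →ₗ[ℂ] (ℝ × ℝ →ᵇ ℂ) :=
  LinearMap.mk₂ ℂ (fun a b => a.compContinuous ⟨fun z => z.1 + z.2, by fun_prop⟩ *
      b.compContinuous ⟨fun z => z.1 - z.2, by fun_prop⟩)
    (fun a a' b => by ext z; simp [add_mul]) (fun c a b => by ext z; simp [mul_assoc])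
    (fun a b b' => by ext z; simp [mul_add]) (fun c a b => by ext z; simp [mul_left_comm])

/-- Half the integral over the square. -/
noncomputable def halfIntegral : (ℝ × ℝ →ᵇ ℂ) →ₗ[ℂ] ℂ where
  toFun c := (1 / 2) * ∫ z, c z ∂squareMeasure
  map_add' a b := by
    rw [← mul_add, ← integral_add (a.integrable _) (b.integrable _)]
    rfl
  map_smul' c a := by
    simp only [BoundedContinuousFunction.coe_smul, integral_const_mul, smul_eq_mul,
      RingHom.id_apply]
    ring

/-- The local trilinear form `∫∫ a (t + y) b (t - y) c (t, y)`, up to normalisation. -/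
noncomputable def localForm : (ℝ →ᵇ ℂ) →ₗ[ℂ] (ℝ →ᵇ ℂ) →ₗ[ℂ] (ℝ × ℝ →ᵇ ℂ) →ₗ[ℂ] ℂ :=
  skewProd.compr₂ ((LinearMap.mul ℂ (ℝ × ℝ →ᵇ ℂ)).compr₂ halfIntegral)

lemma localForm_apply (a b : ℝ →ᵇ ℂ) (c : ℝ × ℝ →ᵇ ℂ) :
    localForm a b c = halfIntegral (skewProd a b * c) := rfl

lemma halfIntegral_mul (c d : ℝ × ℝ →ᵇ ℂ) :
    halfIntegral (c * d) = (1 / 2) * inner ℂ (squareEmb (star c)) (squareEmb d) := by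
  have := BoundedContinuousFunction.inner_toLp (𝕜 := ℂ) squareMeasure (star c) d
  simp only [squareEmb, halfIntegral, LinearMap.coe_mk, AddHom.coe_mk]
  erw [this]
  simp [mul_comm]

lemma enorm_squareEmb_sq (c : ℝ × ℝ →ᵇ ℂ) :
    ‖squareEmb c‖ₑ ^ 2 = ∫⁻ z, ‖c z‖ₑ ^ 2 ∂squareMeasure := by
  have h := eLpNorm_nnreal_pow_eq_lintegral (p := 2) (f := c) (μ := squareMeasure) two_ne_zero
  have e : ‖squareEmb c‖ₑ = eLpNorm c 2 squareMeasure := by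
    rw [Lp.enorm_def]
    exact eLpNorm_congr_ae (BoundedContinuousFunction.coeFn_toLp 2 squareMeasure ℂ c)
  rw [e]
  simpa using h

lemma enorm_lineEmb_sq (a : ℝ →ᵇ ℂ) :
    ‖lineEmb a‖ₑ ^ 2 = ∫⁻ t, ‖a (2 * t)‖ₑ ^ 2 ∂cellMeasure := by
  have := enorm_squareEmb_sq (a.compContinuous ⟨fun z => 2 * z.1, by fun_prop⟩)
  refine this.trans ?_
  simp only [BoundedContinuousFunction.compContinuous_apply, ContinuousMap.coe_mk, squareMeasure]
  rw [lintegral_prod _ (by fun_prop)]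
  simp

lemma norm_squareEmb_star (c : ℝ × ℝ →ᵇ ℂ) : ‖squareEmb (star c)‖ = ‖squareEmb c‖ := by
  have h : ‖squareEmb (star c)‖ₑ ^ 2 = ‖squareEmb c‖ₑ ^ 2 := by
    rw [enorm_squareEmb_sq, enorm_squareEmb_sq]
    simp
  simp only [enorm_eq_nnnorm] at h
  exact (sq_eq_sq₀ (norm_nonneg _) (norm_nonneg _)).1 
    (congrArg NNReal.toReal (by exact_mod_cast h :
      ‖squareEmb (star c)‖₊ ^ 2 = ‖squareEmb c‖₊ ^ 2))

lemma norm_squareEmb_skewProd_le (a b : ℝ →ᵇ ℂ) :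
    ‖squareEmb (skewProd a b)‖ ≤ 2 * (‖lineEmb a‖ * ‖lineEmb b‖) := by
  have h : ‖squareEmb (skewProd a b)‖ₑ ^ 2 ≤ 2 * (‖lineEmb a‖ₑ * ‖lineEmb b‖ₑ) ^ 2 := by
    rw [mul_pow, enorm_squareEmb_sq, enorm_lineEmb_sq, enorm_lineEmb_sq]
    refine le_trans (le_of_eq ?_) (lintegral_cell_prod_le (F := fun t => ‖a t‖ₑ ^ 2)
      (G := fun t => ‖b t‖ₑ ^ 2) (by fun_prop) (by fun_prop))
    refine lintegral_congr fun z => ?_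
    simp [skewProd, mul_pow]
  have h' : ‖squareEmb (skewProd a b)‖ ^ 2 ≤ 2 * (‖lineEmb a‖ * ‖lineEmb b‖) ^ 2 := by
    simp only [enorm_eq_nnnorm] at h
    exact_mod_cast h
  refine le_of_sq_le_sq ?_ (by positivity)
  nlinarith [sq_nonneg (‖lineEmb a‖ * ‖lineEmb b‖)]

lemma norm_localForm_le (a b : ℝ →ᵇ ℂ) (c : ℝ × ℝ →ᵇ ℂ) :
    ‖localForm a b c‖ ≤ ‖lineEmb a‖ * ‖lineEmb b‖ * ‖squareEmb c‖ := by
  rw [localForm_apply, halfIntegral_mul, norm_mul]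
  have h1 := norm_inner_le_norm (𝕜 := ℂ) (squareEmb (star (skewProd a b))) (squareEmb c)
  rw [norm_squareEmb_star] at h1
  have h2 := mul_le_mul_of_nonneg_right (norm_squareEmb_skewProd_le a b) (norm_nonneg (squareEmb c))
  norm_num
  linarith

section

variable {V₁ V₂ V₃ : Type*} [AddCommGroup V₁] [AddCommGroup V₂] [AddCommGroup V₃]
  [Module ℂ V₁] [Module ℂ V₂] [Module ℂ V₃]
  {H : Type*} [NormedAddCommGroup H] [InnerProductSpace ℂ H]
  {ι₁ : V₁ →ₗ[ℂ] H} {ι₂ : V₂ →ₗ[ℂ] H} {ι₃ : V₃ →ₗ[ℂ] H} {τ : V₁ →ₗ[ℂ] V₂ →ₗ[ℂ] V₃ →ₗ[ℂ] ℂ}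
  {p q r : ℝ}

/-- `ℓ^r` duality for a bounded trilinear form. -/
lemma sum_rpow_le_of_dual {κ : ℤ → ℂ} {C₀ : ℝ} (hr : 2 < r)
    (h : ∀ X A B C, IsNormalized ι₁ ι₂ ι₃ p q r X A B C → ‖triForm τ X κ A B C‖ ≤ C₀)
    {X : Finset ℤ} {A : ℤ → V₁} {B : ℤ → V₂} (hA : ∑ x ∈ X, ‖ι₁ (A x)‖ ^ p ≤ 1)
    (hB : ∑ x ∈ X, ‖ι₂ (B x)‖ ^ q ≤ 1) {T : ℤ → V₃}
    (hT : ∀ m, (∑ x ∈ X, ∑ y ∈ X, if x + y = 2 * m then κ (x - m) * τ (A x) (B y) (T m) else 0) =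
      ((1 / 2 * ‖ι₃ (T m)‖ ^ 2 : ℝ) : ℂ)) :
    ∑ m ∈ X, ‖ι₃ (T m)‖ ^ (r / (r - 1)) ≤ (2 * C₀) ^ (r / (r - 1)) := by
  set s := r / (r - 1) with hs
  have hr1 : r - 1 ≠ 0 := by linarith
  have hr0 : r ≠ 0 := by linarith
  have hs1 : s - 1 = 1 / (r - 1) := by rw [hs]; field_simp; ring
  have hs1' : 0 < s - 1 := by rw [hs1]; exact one_div_pos.2 (by linarith)
  have hsr : (s - 1) * r = s := by rw [hs1, hs]; ring
  have hsr' : 1 - 1 / r = 1 / s := by rw [hs]; field_simp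
  set Z := ∑ m ∈ X, ‖ι₃ (T m)‖ ^ s with hZ
  have hC₀ : 0 ≤ C₀ := by
    refine (norm_nonneg _).trans (h X A B 0 ⟨hA, hB, ?_⟩)
    simp [Real.zero_rpow hr0]
  have hZ0 : 0 ≤ Z := Finset.sum_nonneg fun m _ => rpow_nonneg (norm_nonneg _) _
  rcases hZ0.eq_or_lt with hZ1 | hZ1
  · rw [← hZ1]
    positivity
  set c : ℤ → ℝ := fun m => Z ^ (-(1 / r)) * ‖ι₃ (T m)‖ ^ (s - 2) with hc
  have hc0 : ∀ m, 0 ≤ c m := fun m => by positivity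
  have hcN : ∀ m, c m * ‖ι₃ (T m)‖ = Z ^ (-(1 / r)) * ‖ι₃ (T m)‖ ^ (s - 1) := by
    intro m
    rcases (norm_nonneg (ι₃ (T m))).eq_or_lt with h0 | h0
    · rw [← h0, Real.zero_rpow hs1'.ne', mul_zero, mul_zero]
    · rw [hc, mul_assoc, ← rpow_add_one h0.ne']
      congr 2
      ring
  have hcN2 : ∀ m, c m * ‖ι₃ (T m)‖ ^ 2 = Z ^ (-(1 / r)) * ‖ι₃ (T m)‖ ^ s := by
    intro m
    rcases (norm_nonneg (ι₃ (T m))).eq_or_lt with h0 | h0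
    · rw [← h0, Real.zero_rpow (by linarith)]
      simp
    · rw [sq, ← mul_assoc, hcN, mul_assoc, ← rpow_add_one h0.ne']
      congr 2
      ring
  have hC : ∑ m ∈ X, ‖ι₃ ((c m : ℂ) • T m)‖ ^ r ≤ 1 := by
    have : ∀ m, ‖ι₃ ((c m : ℂ) • T m)‖ ^ r = Z⁻¹ * ‖ι₃ (T m)‖ ^ s := by
      intro m
      rw [map_smul, norm_smul, Complex.norm_real, Real.norm_of_nonneg (hc0 m), hcN,
        mul_rpow (by positivity) (by positivity), ← rpow_mul hZ0, ← rpow_mul (norm_nonneg _), hsr,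
        neg_mul, one_div_mul_cancel hr0, rpow_neg_one]
    simp_rw [this, ← Finset.mul_sum]
    exact (inv_mul_cancel₀ hZ1.ne').le
  have key := h X A B _ ⟨hA, hB, hC⟩
  have e : triForm τ X κ A B (fun m => (c m : ℂ) • T m) = ((1 / 2 * Z ^ (1 / s) : ℝ) : ℂ) := by
    have e1 : triForm τ X κ A B (fun m => (c m : ℂ) • T m) =
        ∑ m ∈ X, (c m : ℂ) * ((1 / 2 * ‖ι₃ (T m)‖ ^ 2 : ℝ) : ℂ) := by
      unfold triForm
      rw [Finset.sum_congr rfl fun x _ => Finset.sum_comm, Finset.sum_comm]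
      refine Finset.sum_congr rfl fun m _ => ?_
      rw [← hT, Finset.mul_sum]
      refine Finset.sum_congr rfl fun x _ => ?_
      rw [Finset.mul_sum]
      refine Finset.sum_congr rfl fun y _ => ?_
      rw [map_smul, smul_eq_mul]
      split_ifs <;> ring
    rw [e1]
    simp_rw [← Complex.ofReal_mul]
    rw [← Complex.ofReal_sum]
    congr 1
    simp_rw [mul_left_comm, hcN2, ← Finset.mul_sum]
    rw [← hsr', sub_eq_add_neg, rpow_add hZ1, rpow_one]
    ring
  rw [e, Complex.norm_real, Real.norm_of_nonneg (by positivity)] at key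
  have h2 : Z ^ (1 / s) ≤ 2 * C₀ := by linarith
  calc Z = (Z ^ (1 / s)) ^ s := by
        rw [← rpow_mul hZ0, one_div_mul_cancel (by linarith), rpow_one]
    _ ≤ _ := rpow_le_rpow (by positivity) h2 (by linarith)

end

/-- The translate `t ↦ a (x + t)`. -/
noncomputable def shiftFun (a : ℝ →ᵇ ℂ) (x : ℤ) : ℝ →ᵇ ℂ :=
  a.compContinuous ⟨fun t => x + t, by fun_prop⟩

/-- Finite sections of the localised bilinear convolution with kernel `κ`. -/
noncomputable def cellSum (κ : ℤ → ℂ) (X : Finset ℤ) (a b : ℝ →ᵇ ℂ) (m : ℤ) : ℝ × ℝ →ᵇ ℂ :=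
  ∑ x ∈ X, ∑ y ∈ X, if x + y = 2 * m then κ (x - m) • skewProd (shiftFun a x) (shiftFun b y) else 0

lemma cellSum_dual (κ : ℤ → ℂ) (X : Finset ℤ) (a b : ℝ →ᵇ ℂ) (m : ℤ) :
    (∑ x ∈ X, ∑ y ∈ X, if x + y = 2 * m then κ (x - m) *
      localForm (shiftFun a x) (shiftFun b y) (star (cellSum κ X a b m)) else 0) =
      ((1 / 2 * ‖squareEmb (star (cellSum κ X a b m))‖ ^ 2 : ℝ) : ℂ) := by
  set c := star (cellSum κ X a b m) with hc
  have e : (∑ x ∈ X, ∑ y ∈ X, if x + y = 2 * m then κ (x - m) *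
      localForm (shiftFun a x) (shiftFun b y) c else 0) = halfIntegral (cellSum κ X a b m * c) := by
    unfold cellSum
    rw [Finset.sum_mul, map_sum]
    refine Finset.sum_congr rfl fun x _ => ?_
    rw [Finset.sum_mul, map_sum]
    refine Finset.sum_congr rfl fun y _ => ?_
    split_ifs
    · rw [smul_mul_assoc, map_smul, localForm_apply, smul_eq_mul]
    · simp
  rw [e, halfIntegral_mul, ← hc, inner_self_eq_norm_sq_to_K]
  push_cast
  rfl

lemma rpow_lintegral_le {Ω : Type*} [MeasurableSpace Ω] {μ : Measure Ω} [IsProbabilityMeasure μ]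
    {F : Ω → ℝ≥0∞} (hF : AEMeasurable F μ) {s : ℝ} (hs : 1 ≤ s) :
    (∫⁻ t, F t ∂μ) ^ s ≤ ∫⁻ t, F t ^ s ∂μ := by
  have hs0 : 0 < s := by linarith
  have := eLpNorm'_le_eLpNorm'_of_exponent_le one_pos hs μ hF.aestronglyMeasurable
  simp only [eLpNorm', enorm_eq_self, ENNReal.rpow_one, div_one] at this
  calc _ ≤ ((∫⁻ t, F t ^ s ∂μ) ^ (1 / s)) ^ s := ENNReal.rpow_le_rpow this hs0.le
    _ = _ := by rw [← ENNReal.rpow_mul, one_div_mul_cancel hs0.ne', ENNReal.rpow_one]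

lemma lintegral_rpow_le_of_le_one {Ω : Type*} [MeasurableSpace Ω] {μ : Measure Ω}
    [IsProbabilityMeasure μ] {F : Ω → ℝ≥0∞} (hF : AEMeasurable F μ) {s : ℝ} (hs0 : 0 < s)
    (hs : s ≤ 1) : ∫⁻ t, F t ^ s ∂μ ≤ (∫⁻ t, F t ∂μ) ^ s := by
  have := rpow_lintegral_le (hF.pow_const s) (one_le_one_div hs0 hs)
  simp only [← ENNReal.rpow_mul, mul_one_div_cancel hs0.ne', ENNReal.rpow_one] at this
  calc _ = ((∫⁻ t, F t ^ s ∂μ) ^ (1 / s)) ^ s := by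
        rw [← ENNReal.rpow_mul, one_div_mul_cancel hs0.ne', ENNReal.rpow_one]
    _ ≤ _ := ENNReal.rpow_le_rpow this hs0.le

lemma tsum_lintegral_cell_le {F : ℝ → ℝ≥0∞} (hF : Measurable F) :
    ∑' x : ℤ, ∫⁻ t, F (x + 2 * t) ∂cellMeasure = ∫⁻ t, F t := by
  have h1 : ∀ x : ℤ, ∫⁻ t, F (x + 2 * t) ∂cellMeasure =
      2⁻¹ * (∫⁻ t, F (x + t - 2⁻¹) ∂cellMeasure + ∫⁻ t, F (x + t + 2⁻¹) ∂cellMeasure) := by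
    intro x
    rw [lintegral_cell_two_mul (F := fun t => F (x + t)) (by fun_prop),
      lintegral_indicator measurableSet_Ioc, ← Ioc_union_Ioc_eq_Ioc (b := 0) (by norm_num) (by norm_num),
      lintegral_union measurableSet_Ioc (by
        rw [Set.disjoint_left]; exact fun x h h' => by linarith [h.2, h'.1])]
    have key : ∀ c : ℝ, ∫⁻ t in Ioc (c - 1 / 2) (c + 1 / 2), F (x + t) =
        ∫⁻ t, F (x + t + c) ∂cellMeasure := by
      intro c
      rw [cellMeasure, ← lintegral_indicator measurableSet_Ioc,
        ← lintegral_indicator measurableSet_Ioc, ← lintegral_add_left_eq_self _ c]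
      refine lintegral_congr fun t => ?_
      by_cases h : t ∈ Ioc (-(1 / 2)) (1 / 2 : ℝ)
      · rw [indicator_of_mem h, indicator_of_mem (by constructor <;> linarith [h.1, h.2])]
        congr 1
        ring
      · rw [indicator_of_notMem h, indicator_of_notMem]
        intro h'
        exact h ⟨by linarith [h'.1], by linarith [h'.2]⟩
    have k1 := key (-2⁻¹)
    have k2 := key 2⁻¹
    norm_num [← sub_eq_add_neg] at k1 k2
    rw [k1, k2]
    norm_num
  simp_rw [h1, ENNReal.tsum_mul_left]
  rw [ENNReal.tsum_add, ← lintegral_eq_tsum_cell fun u => F (u - 2⁻¹),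
    ← lintegral_eq_tsum_cell fun u => F (u + 2⁻¹), lintegral_sub_right_eq_self,
    lintegral_add_right_eq_self, ← two_mul, ← mul_assoc, ENNReal.inv_mul_cancel (by simp) (by simp),
    one_mul]

lemma sum_norm_lineEmb_le {a : ℝ →ᵇ ℂ} {p : ℝ} (hp : 2 < p) (ha : ∫⁻ t, ‖a t‖ₑ ^ p ≤ 1)
    (X : Finset ℤ) : ∑ x ∈ X, ‖lineEmb (shiftFun a x)‖ ^ p ≤ 1 := by
  have h1 : ∀ x : ℤ, ENNReal.ofReal (‖lineEmb (shiftFun a x)‖ ^ p) ≤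
      ∫⁻ t, ‖a (x + 2 * t)‖ₑ ^ p ∂cellMeasure := by
    intro x
    have hc : Continuous fun t : ℝ => a (x + 2 * t) := a.continuous.comp (by fun_prop)
    have h2 := rpow_lintegral_le (μ := cellMeasure) (F := fun t => ‖a (x + 2 * t)‖ₑ ^ 2)
      (hc.measurable.enorm.pow_const 2).aemeasurable (s := p / 2) (by linarith)
    have h3 : ‖lineEmb (shiftFun a x)‖ₑ ^ 2 = ∫⁻ t, ‖a (x + 2 * t)‖ₑ ^ 2 ∂cellMeasure :=
      enorm_lineEmb_sq (shiftFun a x)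
    rw [← h3] at h2
    simp only [← ENNReal.rpow_two, ← ENNReal.rpow_mul, mul_div_cancel₀ p two_ne_zero] at h2
    rwa [← ENNReal.ofReal_rpow_of_nonneg (norm_nonneg _) (by linarith), ofReal_norm]
  rw [← ENNReal.ofReal_le_one, ENNReal.ofReal_sum_of_nonneg fun _ _ => by positivity]
  calc _ ≤ ∑ x ∈ X, ∫⁻ t, ‖a (x + 2 * t)‖ₑ ^ p ∂cellMeasure := Finset.sum_le_sum fun x _ => h1 x
    _ ≤ ∑' x : ℤ, ∫⁻ t, ‖a (x + 2 * t)‖ₑ ^ p ∂cellMeasure := ENNReal.sum_le_tsum _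
    _ = _ := tsum_lintegral_cell_le (F := fun t => ‖a t‖ₑ ^ p) (by fun_prop)
    _ ≤ 1 := ha

/-- A kernel is admissible with constant `C₀` if its local trilinear form is bounded by `C₀`. -/
def KernelBound (p q r : ℝ) (κ : ℤ → ℂ) (C₀ : ℝ) : Prop :=
  ∀ X A B C, IsNormalized lineEmb lineEmb squareEmb p q r X A B C →
    ‖triForm localForm X κ A B C‖ ≤ C₀

lemma sum_lintegral_cellSum_le {p q r : ℝ} (hp : 2 < p) (hq : 2 < q) (hr : 2 < r) {κ : ℤ → ℂ}
    {C₀ : ℝ} (h : KernelBound p q r κ C₀) {a b : ℝ →ᵇ ℂ} (ha : ∫⁻ t, ‖a t‖ₑ ^ p ≤ 1)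
    (hb : ∫⁻ t, ‖b t‖ₑ ^ q ≤ 1) (X : Finset ℤ) :
    ∑ m ∈ X, (∫⁻ z, ‖cellSum κ X a b m z‖ₑ ^ 2 ∂squareMeasure) ^ (r / (r - 1) / 2) ≤
      ENNReal.ofReal ((2 * C₀) ^ (r / (r - 1))) := by
  have key := sum_rpow_le_of_dual hr h (sum_norm_lineEmb_le hp ha X) (sum_norm_lineEmb_le hq hb X)
    (T := fun m => star (cellSum κ X a b m)) (cellSum_dual κ X a b)
  have hs : 0 < r / (r - 1) := div_pos (by linarith) (by linarith)
  refine le_trans (le_of_eq ?_) (ENNReal.ofReal_le_ofReal key)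
  rw [ENNReal.ofReal_sum_of_nonneg fun _ _ => by positivity]
  refine Finset.sum_congr rfl fun m _ => ?_
  rw [norm_squareEmb_star, ← enorm_squareEmb_sq, ← ENNReal.rpow_two, ← ENNReal.rpow_mul,
    ← ENNReal.ofReal_rpow_of_nonneg (norm_nonneg _) hs.le, ofReal_norm]
  congr 1
  ring

/-- The terms of the bilinear sum in the cell `m` with kernel `κ`. -/
noncomputable def cellTerm (κ : ℤ → ℂ) (a b : ℝ → ℂ) (m : ℤ) (z : ℝ × ℝ) (k : ℤ) : ℂ :=
  κ k * (a (m + k + (z.1 + z.2)) * b (m - k + (z.1 - z.2)))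

/-- The limit of `cellSum` over all integers. -/
noncomputable def fullSum (κ : ℤ → ℂ) (a b : ℝ → ℂ) (m : ℤ) (z : ℝ × ℝ) : ℂ :=
  ∑' k, cellTerm κ a b m z k

lemma cellSum_eq_sum_cellTerm (κ : ℤ → ℂ) (X : Finset ℤ) (a b : ℝ →ᵇ ℂ) (m : ℤ) (z : ℝ × ℝ) :
    cellSum κ X a b m z = ∑ x ∈ X with 2 * m - x ∈ X, cellTerm κ a b m z (x - m) := by
  rw [cellSum, BoundedContinuousFunction.sum_apply, Finset.sum_filter]
  refine Finset.sum_congr rfl fun x _ => ?_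
  rw [BoundedContinuousFunction.sum_apply]
  rw [Finset.sum_congr rfl (g := fun y => if 2 * m - x = y then cellTerm κ a b m z (x - m) else 0)]
  · rw [Finset.sum_ite_eq]
  intro y _
  by_cases h : x + y = 2 * m
  · obtain rfl : y = 2 * m - x := by lia
    simp only [add_sub_cancel, if_true, cellTerm]
    simp only [BoundedContinuousFunction.smul_apply, smul_eq_mul, skewProd, LinearMap.mk₂_apply,
      shiftFun]
    simp
    left
    left
    congr 1
    ring
  · rw [if_neg h, if_neg (by lia)]
    rfl

lemma tendsto_cellSum {κ : ℤ → ℂ} {a b : ℝ →ᵇ ℂ} {m : ℤ} {z : ℝ × ℝ}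
    (h : Summable (cellTerm κ a b m z)) :
    Filter.Tendsto (fun N : ℕ => cellSum κ (Finset.Icc (-N : ℤ) N) a b m z) Filter.atTop
      (nhds (fullSum κ a b m z)) := by
  have h1 : HasSum (fun x : ℤ => cellTerm κ a b m z (x - m)) (fullSum κ a b m z) :=
    (Equiv.subRight m).hasSum_iff.2 h.hasSum
  have h2 : Filter.Tendsto (fun N : ℕ => (Finset.Icc (-N : ℤ) N).filter
      fun x => 2 * m - x ∈ Finset.Icc (-N : ℤ) N) Filter.atTop Filter.atTop := by
    refine Filter.tendsto_atTop_finset_of_monotone ?_ ?_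
    · intro N M hNM x
      simp only [Finset.mem_filter, Finset.mem_Icc]
      lia
    · intro x
      refine ⟨x.natAbs + 2 * m.natAbs, ?_⟩
      simp only [Finset.mem_filter, Finset.mem_Icc]
      lia
  exact (h1.comp h2).congr fun N => (cellSum_eq_sum_cellTerm κ _ a b m z).symm

lemma measurable_fullSum {κ : ℤ → ℂ} {a b : ℝ →ᵇ ℂ} {m : ℤ}
    (h : ∀ z, Summable (cellTerm κ a b m z)) : Measurable (fullSum κ a b m) :=
  measurable_of_tendsto_metrizable
    (fun N => (cellSum κ (Finset.Icc (-N : ℤ) N) a b m).continuous.measurable)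
    (tendsto_pi_nhds.2 fun z => tendsto_cellSum (h z))

/-- Fatou's lemma for the bilinear sums. -/
lemma tsum_lintegral_fullSum_le {p q r : ℝ} (hp : 2 < p) (hq : 2 < q) (hr : 2 < r) {κ : ℤ → ℂ}
    {C₀ : ℝ} (h : KernelBound p q r κ C₀) {a b : ℝ →ᵇ ℂ} (ha : ∫⁻ t, ‖a t‖ₑ ^ p ≤ 1)
    (hb : ∫⁻ t, ‖b t‖ₑ ^ q ≤ 1) (hs : ∀ m z, Summable (cellTerm κ a b m z)) :
    ∑' m, (∫⁻ z, ‖fullSum κ a b m z‖ₑ ^ 2 ∂squareMeasure) ^ (r / (r - 1) / 2) ≤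
      ENNReal.ofReal ((2 * C₀) ^ (r / (r - 1))) := by
  set s := r / (r - 1) / 2 with hsdef
  have hs0 : 0 < s := div_pos (div_pos (by linarith) (by linarith)) two_pos
  set X : ℕ → Finset ℤ := fun N => Finset.Icc (-N : ℤ) N with hX
  set J : ℕ → ℤ → ℝ≥0∞ := fun N m => ∫⁻ z, ‖cellSum κ (X N) a b m z‖ₑ ^ 2 ∂squareMeasure with hJ
  have h1 : ∀ m, ∫⁻ z, ‖fullSum κ a b m z‖ₑ ^ 2 ∂squareMeasure ≤
      Filter.liminf (fun N => J N m) Filter.atTop := by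
    intro m
    refine le_trans (le_of_eq ?_) (lintegral_liminf_le fun N => ?_)
    · refine lintegral_congr fun z => ?_
      refine (Filter.Tendsto.liminf_eq ?_).symm
      exact ((ENNReal.continuous_pow 2).tendsto _).comp (tendsto_cellSum (hs m z)).enorm
    · exact ((cellSum κ (X N) a b m).continuous.enorm.measurable).pow_const 2
  rw [ENNReal.tsum_eq_iSup_sum]
  refine iSup_le fun F => ?_
  have h2 : ∀ m, (∫⁻ z, ‖fullSum κ a b m z‖ₑ ^ 2 ∂squareMeasure) ^ s ≤
      Filter.liminf (fun N => J N m ^ s) Filter.atTop := by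
    intro m
    refine (ENNReal.rpow_le_rpow (h1 m) hs0.le).trans (le_of_eq ?_)
    exact (ENNReal.orderIsoRpow s hs0).liminf_apply
  have h3 : ∑ m ∈ F, Filter.liminf (fun N => J N m ^ s) Filter.atTop ≤
      Filter.liminf (fun N => ∑ m ∈ F, J N m ^ s) Filter.atTop := by
    have := lintegral_liminf_le (u := Filter.atTop) (μ := Measure.count.restrict (F : Set ℤ))
      (f := fun N m => J N m ^ s) fun N => measurable_of_countable _
    simpa only [lintegral_finset, Measure.count_singleton, mul_one] using this
  refine ((Finset.sum_le_sum fun m _ => h2 m).trans h3).trans ?_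
  refine Filter.liminf_le_of_frequently_le' (Filter.Eventually.frequently ?_)
  have hF : Filter.Tendsto X Filter.atTop Filter.atTop := by
    refine Filter.tendsto_atTop_finset_of_monotone (fun N M hNM x => ?_) fun x => ⟨x.natAbs, ?_⟩
    · simp only [hX, Finset.mem_Icc]
      lia
    · simp only [hX, Finset.mem_Icc]
      lia
  filter_upwards [hF.eventually_ge_atTop F] with N hN
  exact (Finset.sum_le_sum_of_subset hN).trans (sum_lintegral_cellSum_le hp hq hr h ha hb (X N))

section

variable {h : ℝ → ℂ} {M : ℝ}

lemma summable_norm_comp_add_of_decay (hd : ∀ y, ‖h y‖ ≤ M * decay 1 y ^ 2) (y : ℝ) :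
    Summable fun k : ℤ => ‖h (y + k)‖ := by
  refine Summable.of_nonneg_of_le (fun _ => norm_nonneg _) (fun k => ?_)
    ((summable_decay_pow le_rfl (-y) le_rfl).mul_left M)
  simpa [add_comm] using hd (y + k)

lemma norm_tsum_comp_add_le (hd : ∀ y, ‖h y‖ ≤ M * decay 1 y ^ 2) (y : ℝ) :
    ‖∑' k : ℤ, h (y + k)‖ ≤ M * 16 := by
  have hM : 0 ≤ M := by simpa [decay] using (norm_nonneg _).trans (hd 0)
  refine (tsum_of_norm_bounded ((summable_decay_pow le_rfl (-y) le_rfl).mul_left M).hasSum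
    fun k => ?_).trans ?_
  · simpa [add_comm] using hd (y + k)
  · rw [tsum_mul_left]
    simpa using mul_le_mul_of_nonneg_left (tsum_decay_pow_le le_rfl (-y) le_rfl) hM

lemma integrable_of_decay (hc : Continuous h) (hd : ∀ y, ‖h y‖ ≤ M * decay 1 y ^ 2) :
    Integrable h := by
  have hM : 0 ≤ M := by simpa [decay] using (norm_nonneg _).trans (hd 0)
  refine (integrable_inv_one_add_sq.const_mul M).mono' hc.aestronglyMeasurable
    (Filter.Eventually.of_forall fun y => (hd y).trans (mul_le_mul_of_nonneg_left ?_ hM))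
  rw [decay, inv_pow]
  refine inv_anti₀ (by positivity) ?_
  rw [div_one]
  nlinarith [abs_nonneg y, sq_abs y]

lemma hasSum_integral_cell {E : Type*} [NormedAddCommGroup E] [NormedSpace ℝ E] {H : ℝ → E}
    (hH : Integrable H) : HasSum (fun k : ℤ => ∫ y, H (y + k) ∂cellMeasure) (∫ y, H y) := by
  have := hH.hasSum_intervalIntegral (-(1 / 2))
  convert this using 2 with k
  rw [cellMeasure, ← intervalIntegral.integral_of_le (by norm_num),
    intervalIntegral.integral_comp_add_right]
  congr 1
  ring

lemma integral_eq_integral_cell_tsum (hi : Integrable h) :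
    ∫ y, h y = ∫ y, ∑' k : ℤ, h (y + k) ∂cellMeasure :=
  (hasSum_integral_cell hi).unique (hasSum_integral_of_summable_integral_norm (μ := cellMeasure)
    (F := fun (k : ℤ) y => h (y + k)) (fun _ => (hi.comp_add_right _).integrableOn)
    (hasSum_integral_cell hi.norm).summable)

lemma cis_intCast_mul_add (n k : ℤ) (y : ℝ) : cis (n * (y + k)) = cis (n * y) := by
  rw [mul_add, cis_add, ← Int.cast_mul]
  nth_rw 2 [cis]
  have : Complex.exp (↑(2 * π * (n * k : ℤ)) * Complex.I) = 1 := by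
    rw [← Complex.exp_int_mul_two_pi_mul_I (n * k)]
    congr 1
    push_cast
    ring
  rw [this, mul_one]

lemma cis_add_intCast (y : ℝ) (k : ℤ) : cis (y + k) = cis y := by
  simpa using cis_intCast_mul_add 1 k y

lemma measurable_tsum_comp_add (hc : Continuous h) (hd : ∀ y, ‖h y‖ ≤ M * decay 1 y ^ 2) :
    Measurable fun y => ∑' k : ℤ, h (y + k) :=
  measurable_of_tendsto_metrizable' (Filter.atTop : Filter (Finset ℤ))
    (f := fun (X : Finset ℤ) y => ∑ k ∈ X, h (y + k))
    (fun X => (continuous_finsetSum X fun k _ => by fun_prop).measurable)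
    (tendsto_pi_nhds.2 fun y => (summable_norm_comp_add_of_decay hd y).of_norm.hasSum)

/-- Parseval's identity for the periodisation. -/
lemma hasSum_sq_norm_integral_cis (hc : Continuous h) (hd : ∀ y, ‖h y‖ ≤ M * decay 1 y ^ 2) :
    HasSum (fun n : ℤ => ‖∫ y, h y * cis (n * y)‖ ^ 2)
      (∫ y, ‖∑' k : ℤ, h (y + k)‖ ^ 2 ∂cellMeasure) := by
  set W : ℝ → ℂ := fun y => ∑' k : ℤ, h (y + k) with hW
  have hab : (-(1 / 2) : ℝ) < 1 / 2 := by norm_num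
  have hL : MemLp W 2 (volume.restrict (Ioc (-(1 / 2)) (1 / 2))) :=
    MemLp.of_bound (measurable_tsum_comp_add hc hd).aestronglyMeasurable (M * 16)
      (Filter.Eventually.of_forall (norm_tsum_comp_add_le hd))
  have key := hasSum_sq_fourierCoeffOn hab hL
  have e1 : ((1 / 2 : ℝ) - -(1 / 2)) = 1 := by norm_num
  rw [intervalIntegral.integral_of_le hab.le, e1, inv_one, one_smul] at key
  rw [← (Equiv.neg ℤ).hasSum_iff]
  refine key.congr_fun fun n => ?_
  have e2 : ∫ y, h y * cis ((-n : ℤ) * y) = fourierCoeffOn hab W n := by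
    rw [integral_eq_integral_cell_tsum, fourierCoeffOn_eq_integral, e1, div_one, one_smul,
      intervalIntegral.integral_of_le hab.le, cellMeasure]
    · congr 1
      funext y
      simp only [cis_intCast_mul_add]
      rw [tsum_mul_right, mul_comm, smul_eq_mul, fourier_coe_apply, cis]
      congr 2
      rw [Complex.ofReal_one, div_one]
      push_cast
      ring
    · exact integrable_of_decay (hc.mul (continuous_cis.comp (by fun_prop))) fun y => by
        rw [norm_mul, norm_cis, mul_one]
        exact hd y
  exact congrArg (fun c => ‖c‖ ^ 2) e2

end

lemma phi_eq (n : ℤ) (y : ℝ) : phi n y = cis (n * y) * phi 0 y := by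
  have := intervalIntegral.integral_comp_add_right (a := 0) (b := 1)
    (fun ξ => Complex.exp (((2 * Real.pi * y * ξ : ℝ) : ℂ) * Complex.I)) (n : ℝ)
  rw [phi, phi, ← intervalIntegral.integral_const_mul, add_comm (n : ℝ) 1]
  simp only [Int.cast_zero, zero_add] at this ⊢
  rw [← this]
  congr 1
  funext ξ
  rw [cis, ← Complex.exp_add]
  congr 1
  push_cast
  ring

lemma norm_phi_le (n : ℤ) (y : ℝ) : ‖phi n y‖ ≤ 1 := by
  have := intervalIntegral.norm_integral_le_of_norm_le_const (a := (n : ℝ)) (b := n + 1) (C := 1)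
    (f := fun ξ => Complex.exp (((2 * Real.pi * y * ξ : ℝ) : ℂ) * Complex.I))
    fun ξ _ => (Complex.norm_exp_ofReal_mul_I _).le
  simpa [phi] using this

lemma continuous_phi (n : ℤ) : Continuous (phi n) := by
  unfold phi
  refine intervalIntegral.continuous_parametric_intervalIntegral_of_continuous' ?_ _ _
  fun_prop

lemma phi_zero_mul (y : ℝ) : phi 0 y * y = (cis y - 1) / (2 * π * Complex.I) := by
  rcases eq_or_ne y 0 with rfl | hy
  · simp [cis_zero]
  have hy' : (y : ℂ) ≠ 0 := by exact_mod_cast hy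
  have hpi : (π : ℂ) ≠ 0 := by exact_mod_cast Real.pi_ne_zero
  have := integral_exp_mul_complex (a := 0) (b := 1) (c := 2 * π * y * Complex.I)
    (by simp [hy', hpi])
  have e : phi 0 y = ∫ x in (0 : ℝ)..1, Complex.exp (2 * π * y * Complex.I * x) := by
    rw [phi]
    simp only [Int.cast_zero, zero_add]
    congr 1
    funext x
    push_cast
    ring_nf
  rw [e, this, cis]
  field_simp
  push_cast
  simp
  ring_nf

/-- The error in replacing the kernel by the discrete Hilbert kernel. -/
noncomputable def kernelError (k : ℤ) : ℝ := if k = 0 then 1 else 1 / (k : ℝ) ^ 2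

lemma summable_kernelError : Summable kernelError := by
  refine ((Real.summable_one_div_int_pow.2 one_lt_two).add
    (summable_of_hasFiniteSupport (f := fun k : ℤ => if k = 0 then (1 : ℝ) else 0)
      ((finite_singleton (0 : ℤ)).subset fun k => by simp))).congr fun k => ?_
  by_cases hk : k = 0 <;> simp [kernelError, hk]

lemma exists_norm_phi_zero_sub_le {y : ℝ} (hy : |y| ≤ 1 / 2) :
    ∃ u : ℂ, ‖u‖ ≤ 1 ∧ ∀ k : ℤ, ‖phi 0 (y + k) - u * (k : ℂ)⁻¹‖ ≤ kernelError k := by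
  obtain ⟨u, hu⟩ : ∃ u, u = (cis y - 1) / (2 * π * Complex.I) := ⟨_, rfl⟩
  have hu1 : ‖u‖ ≤ 1 := by
    rw [hu, norm_div]
    refine div_le_one_of_le₀ ?_ (norm_nonneg _)
    have h1 : ‖cis y - 1‖ ≤ 1 + 1 := by simpa [norm_cis] using norm_sub_le (cis y) 1
    have h2 : ‖(2 * π * Complex.I : ℂ)‖ = 2 * π := by simp [abs_of_pos pi_pos]
    rw [h2]
    linarith [pi_gt_three]
  refine ⟨u, hu1, fun k => ?_⟩
  rcases eq_or_ne k 0 with rfl | hk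
  · simpa [kernelError] using norm_phi_le 0 y
  have hk1 : 1 ≤ |(k : ℝ)| := by exact_mod_cast Int.one_le_abs hk
  have hyk : |(k : ℝ)| / 2 ≤ |y + k| := by
    have := abs_sub_abs_le_abs_sub (k : ℝ) (-y)
    rw [abs_neg, sub_neg_eq_add, add_comm] at this
    linarith
  have hyk0 : y + k ≠ 0 := abs_pos.1 (by linarith)
  have hk0 : (k : ℂ) ≠ 0 := by exact_mod_cast hk
  have hyk0' : (y + k : ℂ) ≠ 0 := by exact_mod_cast hyk0
  have hphi : phi 0 (y + k) = u / (y + k) := by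
    rw [eq_div_iff hyk0', hu, ← cis_add_intCast y k, ← phi_zero_mul]
    push_cast
    rfl
  have e : phi 0 (y + k) - u * (k : ℂ)⁻¹ = u * ((-y / ((y + k) * k) : ℝ) : ℂ) := by
    rw [hphi]
    push_cast
    field_simp
    ring
  rw [e, norm_mul, Complex.norm_real, Real.norm_eq_abs, abs_div, abs_neg, abs_mul, kernelError,
    if_neg hk, ← sq_abs (k : ℝ)]
  refine (mul_le_of_le_one_left (by positivity) hu1).trans ?_
  have h0 : 0 < |(k : ℝ)| := by linarith
  rw [div_le_div_iff₀ (by positivity) (by positivity)]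
  nlinarith

/-- The absolute value of a bounded continuous function, as a complex-valued function. -/
noncomputable def absFun (a : ℝ →ᵇ ℂ) : ℝ →ᵇ ℂ :=
  BoundedContinuousFunction.ofNormedAddCommGroup (fun t => ((‖a t‖ : ℝ) : ℂ)) (by fun_prop) ‖a‖
    fun t => by simpa using a.norm_coe_le_norm t

lemma absFun_apply (a : ℝ →ᵇ ℂ) (t : ℝ) : absFun a t = ((‖a t‖ : ℝ) : ℂ) := rfl

lemma enorm_absFun (a : ℝ →ᵇ ℂ) (t : ℝ) : ‖absFun a t‖ₑ = ‖a t‖ₑ := by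
  rw [absFun_apply, ← ofReal_norm, ← ofReal_norm, Complex.norm_real, norm_norm]

/-- The periodised integrand of `S n`, without the character. -/
noncomputable def wrapSum (a b : ℝ → ℂ) (x y : ℝ) : ℂ :=
  ∑' k : ℤ, a (x + (y + k)) * b (x - (y + k)) * phi 0 (y + k)

section

variable {a b : ℝ →ᵇ ℂ} {M : ℝ}

lemma summable_cellTerm (ha : ∀ y, ‖a y‖ ≤ M * decay 1 y ^ 2) {κ : ℤ → ℂ} (hκ : ∀ k, ‖κ k‖ ≤ 1)
    (m : ℤ) (z : ℝ × ℝ) : Summable (cellTerm κ a b m z) := by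
  refine Summable.of_norm_bounded
    ((summable_norm_comp_add_of_decay ha (m + (z.1 + z.2))).mul_right ‖b‖) fun k => ?_
  rw [cellTerm, norm_mul, norm_mul, add_right_comm]
  refine (mul_le_of_le_one_left (by positivity) (hκ k)).trans ?_
  gcongr
  exact b.norm_coe_le_norm _

lemma norm_intCast_inv_le_one (k : ℤ) : ‖(k : ℂ)⁻¹‖ ≤ 1 := by
  rcases eq_or_ne k 0 with rfl | hk
  · simp
  · rw [norm_inv, Complex.norm_intCast]
    exact inv_le_one_of_one_le₀ (by exact_mod_cast Int.one_le_abs hk)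

lemma kernelError_nonneg (k : ℤ) : 0 ≤ kernelError k := by
  unfold kernelError; split_ifs <;> positivity

lemma norm_kernelError_le_one (k : ℤ) : ‖(kernelError k : ℂ)‖ ≤ 1 := by
  rw [Complex.norm_real, Real.norm_of_nonneg (kernelError_nonneg k), kernelError]
  split_ifs with hk
  · exact le_rfl
  · have : (1 : ℝ) ≤ |(k : ℝ)| := by exact_mod_cast Int.one_le_abs hk
    rw [← sq_abs]
    exact div_le_one_of_le₀ (by nlinarith) (by positivity)

lemma norm_absFun_le (ha : ∀ y, ‖a y‖ ≤ M * decay 1 y ^ 2) (y : ℝ) :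
    ‖absFun a y‖ ≤ M * decay 1 y ^ 2 := by
  rw [absFun_apply, Complex.norm_real, norm_norm]
  exact ha y

lemma norm_wrapSum_le (ha : ∀ y, ‖a y‖ ≤ M * decay 1 y ^ 2) (m : ℤ) (t : ℝ) {y : ℝ}
    (hy : |y| ≤ 1 / 2) :
    ‖wrapSum a b (m + t) y‖ ≤ ‖fullSum (fun k => (k : ℂ)⁻¹) a b m (t, y)‖ +
      ‖fullSum (fun k => (kernelError k : ℂ)) (absFun a) (absFun b) m (t, y)‖ := by
  obtain ⟨u, hu, h⟩ := exists_norm_phi_zero_sub_le hy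
  have s1 := summable_cellTerm ha (b := b) norm_intCast_inv_le_one m (t, y)
  have s2 := summable_cellTerm (norm_absFun_le ha) (b := absFun b) norm_kernelError_le_one m (t, y)
  set D : ℤ → ℂ := fun k => (phi 0 (y + k) - u * (k : ℂ)⁻¹) *
    (a (m + k + (t + y)) * b (m - k + (t - y))) with hD
  have hDn : ∀ k, ‖D k‖ ≤ ‖cellTerm (fun k => (kernelError k : ℂ)) (absFun a) (absFun b) m (t, y) k‖ := by
    intro k
    rw [hD, cellTerm, norm_mul, norm_mul, norm_mul, norm_mul, absFun_apply, absFun_apply,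
      Complex.norm_real, Complex.norm_real, Complex.norm_real, norm_norm, norm_norm,
      Real.norm_of_nonneg (kernelError_nonneg k)]
    gcongr
    exact h k
  have hDs : Summable D := Summable.of_norm_bounded s2.norm hDn
  have e : wrapSum a b (m + t) y =
      u * fullSum (fun k => (k : ℂ)⁻¹) a b m (t, y) + ∑' k, D k := by
    rw [fullSum, ← tsum_mul_left, ← (s1.mul_left u).tsum_add hDs, wrapSum]
    refine tsum_congr fun k => ?_
    rw [hD, cellTerm]
    have e1 : (m + t + (y + k) : ℝ) = m + k + (t + y) := by ring
    have e2 : (m + t - (y + k) : ℝ) = m - k + (t - y) := by ring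
    rw [e1, e2]
    ring
  rw [e]
  refine (norm_add_le _ _).trans (add_le_add ?_ ?_)
  · rw [norm_mul]
    exact mul_le_of_le_one_left (norm_nonneg _) hu
  · refine (tsum_of_norm_bounded s2.norm.hasSum hDn).trans (le_of_eq ?_)
    have : ∀ k, cellTerm (fun k => (kernelError k : ℂ)) (absFun a) (absFun b) m (t, y) k =
        ((‖cellTerm (fun k => (kernelError k : ℂ)) (absFun a) (absFun b) m (t, y) k‖ : ℝ) : ℂ) := by
      intro k
      rw [cellTerm, norm_mul, norm_mul, absFun_apply, absFun_apply, Complex.norm_real,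
        Complex.norm_real, Complex.norm_real, norm_norm, norm_norm,
        Real.norm_of_nonneg (kernelError_nonneg k)]
      push_cast
      rfl
    rw [fullSum, tsum_congr this, ← Complex.ofReal_tsum, Complex.norm_real,
      Real.norm_of_nonneg (tsum_nonneg fun _ => norm_nonneg _)]

lemma ENNReal.add_sq_le (u v : ℝ≥0∞) : (u + v) ^ 2 ≤ 4 * (u ^ 2 + v ^ 2) := by
  rcases le_total u v with h | h
  · calc (u + v) ^ 2 ≤ (v + v) ^ 2 := by gcongr
      _ = 4 * v ^ 2 := by ring
      _ ≤ _ := by gcongr; exact le_add_self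
  · calc (u + v) ^ 2 ≤ (u + u) ^ 2 := by gcongr
      _ = 4 * u ^ 2 := by ring
      _ ≤ _ := by gcongr; exact le_self_add

lemma exists_lintegral_wrapSum_le {p q r : ℝ} (hp : 2 < p) (hq : 2 < q) (hr : 2 < r)
    (hpqr : 1 / p + 1 / q + 1 / r = 1) :
    ∃ K : ℝ≥0∞, K ≠ ⊤ ∧ ∀ (a b : ℝ →ᵇ ℂ) (M : ℝ), (∀ y, ‖a y‖ ≤ M * decay 1 y ^ 2) →
      ∫⁻ t, ‖a t‖ₑ ^ p ≤ 1 → ∫⁻ t, ‖b t‖ₑ ^ q ≤ 1 →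
      ∫⁻ x, (∫⁻ y, ‖wrapSum a b x y‖ₑ ^ 2 ∂cellMeasure) ^ (r / (r - 1) / 2) ≤ K := by
  obtain ⟨C₀, -, hC₀⟩ := exists_triForm_inv_le norm_localForm_le hp hq hr hpqr
  have hE : KernelBound p q r (fun k => (kernelError k : ℂ)) (3 * ∑' k, kernelError k) :=
    fun X A B C h => norm_triForm_le norm_localForm_le hp hq hr hpqr h summable_kernelError
      fun k => by rw [Complex.norm_real, Real.norm_of_nonneg (kernelError_nonneg k)]
  set s := r / (r - 1) / 2 with hs
  have hs0 : 0 < s := div_pos (div_pos (by linarith) (by linarith)) two_pos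
  have hs1 : s ≤ 1 := by
    rw [hs, div_div, div_le_one (by linarith)]
    linarith
  set K₁ := ENNReal.ofReal ((2 * C₀) ^ (r / (r - 1)))
  set K₂ := ENNReal.ofReal ((2 * (3 * ∑' k, kernelError k)) ^ (r / (r - 1)))
  refine ⟨4 ^ s * (K₁ + K₂), ?_, fun a b M ha hap hbq => ?_⟩
  · refine ENNReal.mul_ne_top (ENNReal.rpow_ne_top_of_nonneg hs0.le (by norm_num)) ?_
    exact ENNReal.add_ne_top.2 ⟨ENNReal.ofReal_ne_top, ENNReal.ofReal_ne_top⟩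
  set Φ := fullSum (fun k => (k : ℂ)⁻¹) a b with hΦ
  set Ψ := fullSum (fun k => (kernelError k : ℂ)) (absFun a) (absFun b) with hΨ
  have s1 := summable_cellTerm ha (b := b) norm_intCast_inv_le_one
  have s2 := summable_cellTerm (norm_absFun_le ha) (b := absFun b) norm_kernelError_le_one
  have m1 : ∀ m, Measurable (Φ m) := fun m => measurable_fullSum (s1 m)
  have m2 : ∀ m, Measurable (Ψ m) := fun m => measurable_fullSum (s2 m)
  have b1 : ∑' m, (∫⁻ z, ‖Φ m z‖ₑ ^ 2 ∂squareMeasure) ^ s ≤ K₁ :=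
    tsum_lintegral_fullSum_le hp hq hr hC₀ hap hbq s1
  have b2 : ∑' m, (∫⁻ z, ‖Ψ m z‖ₑ ^ 2 ∂squareMeasure) ^ s ≤ K₂ :=
    tsum_lintegral_fullSum_le hp hq hr hE (by simpa only [enorm_absFun])
      (by simpa only [enorm_absFun]) s2
  have hm : ∀ m, Measurable fun z => 4 * (‖Φ m z‖ₑ ^ 2 + ‖Ψ m z‖ₑ ^ 2) := fun m =>
    (((m1 m).enorm.pow_const 2).add ((m2 m).enorm.pow_const 2)).const_mul 4
  have step : ∀ m : ℤ, ∫⁻ t, (∫⁻ y, ‖wrapSum a b (m + t) y‖ₑ ^ 2 ∂cellMeasure) ^ s ∂cellMeasure ≤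
      4 ^ s * ((∫⁻ z, ‖Φ m z‖ₑ ^ 2 ∂squareMeasure) ^ s +
        (∫⁻ z, ‖Ψ m z‖ₑ ^ 2 ∂squareMeasure) ^ s) := by
    intro m
    calc _ ≤ ∫⁻ t, (∫⁻ y, 4 * (‖Φ m (t, y)‖ₑ ^ 2 + ‖Ψ m (t, y)‖ₑ ^ 2) ∂cellMeasure) ^ s
          ∂cellMeasure := by
          refine lintegral_mono fun t => ENNReal.rpow_le_rpow ?_ hs0.le
          refine lintegral_mono_ae ?_
          rw [cellMeasure]
          filter_upwards [ae_restrict_mem measurableSet_Ioc] with y hy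
          refine le_trans ?_ (ENNReal.add_sq_le _ _)
          gcongr
          rw [← ofReal_norm, ← ofReal_norm, ← ofReal_norm,
            ← ENNReal.ofReal_add (norm_nonneg _) (norm_nonneg _)]
          exact ENNReal.ofReal_le_ofReal (norm_wrapSum_le ha m t (abs_le.2 ⟨hy.1.le, hy.2⟩))
      _ ≤ (∫⁻ t, ∫⁻ y, 4 * (‖Φ m (t, y)‖ₑ ^ 2 + ‖Ψ m (t, y)‖ₑ ^ 2) ∂cellMeasure
          ∂cellMeasure) ^ s :=
          lintegral_rpow_le_of_le_one (hm m).lintegral_prod_right'.aemeasurable hs0 hs1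
      _ = (4 * (∫⁻ z, ‖Φ m z‖ₑ ^ 2 ∂squareMeasure + ∫⁻ z, ‖Ψ m z‖ₑ ^ 2 ∂squareMeasure)) ^ s := by
          rw [← lintegral_add_left ((m1 m).enorm.pow_const 2), ← lintegral_const_mul' _ _ (by norm_num),
            squareMeasure, lintegral_prod _ (hm m).aemeasurable]
      _ ≤ _ := by
          rw [ENNReal.mul_rpow_of_nonneg _ _ hs0.le]
          gcongr
          exact ENNReal.rpow_add_le_add_rpow _ _ hs0.le hs1
  rw [lintegral_eq_tsum_cell]
  refine (ENNReal.tsum_le_tsum step).trans ?_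
  rw [ENNReal.tsum_mul_left, ENNReal.tsum_add]
  gcongr

lemma ofReal_tsum_sq_le (ha : ∀ y, ‖a y‖ ≤ M * decay 1 y ^ 2) (x : ℝ) :
    ENNReal.ofReal (∑' n : ℤ, ‖S n a b x‖ ^ 2) ≤ ∫⁻ y, ‖wrapSum a b x y‖ₑ ^ 2 ∂cellMeasure := by
  set h : ℝ → ℂ := fun y => a (x + y) * b (x - y) * phi 0 y with hh
  have hx := decay_pos one_pos (-x)
  have hM : 0 ≤ M := by simpa [decay] using (norm_nonneg _).trans (ha 0)
  have hc : Continuous h := by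
    have := continuous_phi 0
    fun_prop
  have hd : ∀ y, ‖h y‖ ≤ M * ‖b‖ / decay 1 (-x) ^ 2 * decay 1 y ^ 2 := by
    intro y
    have h1 : decay 1 (x + y) ≤ decay 1 y / decay 1 (-x) := by
      rw [le_div_iff₀ hx]
      simpa using decay_mul_decay_le one_pos le_rfl (x + y) (-x)
    calc ‖h y‖ ≤ M * decay 1 (x + y) ^ 2 * ‖b‖ * 1 := by
          rw [hh, norm_mul, norm_mul]
          have := (decay_pos one_pos (x + y)).le
          gcongr
          · exact ha _
          · exact b.norm_coe_le_norm _
          · exact norm_phi_le 0 y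
      _ ≤ M * (decay 1 y / decay 1 (-x)) ^ 2 * ‖b‖ * 1 := by
          have := (decay_pos one_pos (x + y)).le
          gcongr
      _ = _ := by ring
  have e : ∀ n : ℤ, S n a b x = ∫ y, h y * cis (n * y) := by
    intro n
    rw [S]
    congr 1
    funext y
    rw [phi_eq, hh]
    ring
  simp only [e]
  rw [(hasSum_sq_norm_integral_cis hc hd).tsum_eq]
  refine (Real.ofReal_le_enorm _).trans ((enorm_integral_le_lintegral_enorm _).trans (le_of_eq ?_))
  refine lintegral_congr fun y => ?_
  rw [enorm_pow, enorm_norm]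
  rfl

end

lemma exists_schwartz_norm_le_decay_sq (f : SchwartzMap ℝ ℂ) :
    ∃ M : ℝ, ∀ y, ‖f y‖ ≤ M * decay 1 y ^ 2 := by
  refine ⟨2 ^ 2 * (Finset.Iic (2, 0)).sup (fun m => SchwartzMap.seminorm ℝ m.1 m.2) f,
    fun y => ?_⟩
  have h := SchwartzMap.one_add_le_sup_seminorm_apply (𝕜 := ℝ) (m := (2, 0)) (k := 2) (n := 0)
    le_rfl le_rfl f y
  rw [norm_iteratedFDeriv_zero, Real.norm_eq_abs] at h
  rw [decay, div_one, inv_pow, ← div_eq_mul_inv, le_div_iff₀ (by positivity), mul_comm]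
  exact h

/-- The square function of the family `S n`. -/
noncomputable def squareFun (f g : ℝ → ℂ) (x : ℝ) : ℝ := √(∑' n : ℤ, ‖S n f g x‖ ^ 2)

lemma squareFun_smul {α β : ℝ} (hα : 0 ≤ α) (hβ : 0 ≤ β) (f g : ℝ → ℂ) :
    squareFun (fun x => (α : ℂ) * f x) (fun x => (β : ℂ) * g x) = (α * β) • squareFun f g := by
  funext x
  have h : ∀ n, S n (fun x => (α : ℂ) * f x) (fun x => (β : ℂ) * g x) x = (α * β : ℝ) * S n f g x := by
    intro n
    rw [S, S, ← integral_const_mul]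
    congr 1
    funext y
    push_cast
    ring
  simp only [squareFun, Pi.smul_apply, smul_eq_mul, h, norm_mul (_ : ℂ), mul_pow, tsum_mul_left]
  rw [Complex.norm_real, Real.norm_of_nonneg (by positivity), Real.sqrt_mul (by positivity),
    Real.sqrt_sq (by positivity)]

lemma eLpNorm_ofReal_eq {E : Type*} [NormedAddCommGroup E] (f : ℝ → E) {p : ℝ} (hp : 0 < p) :
    eLpNorm f (ENNReal.ofReal p) volume = (∫⁻ t, ‖f t‖ₑ ^ p) ^ (1 / p) := by
  rw [eLpNorm_eq_lintegral_rpow_enorm_toReal (by simpa using hp) ENNReal.ofReal_ne_top,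
    ENNReal.toReal_ofReal hp.le]

lemma enorm_squareFun_rpow_le {a b : ℝ →ᵇ ℂ} {M : ℝ} (ha : ∀ y, ‖a y‖ ≤ M * decay 1 y ^ 2) {s : ℝ}
    (hs : 0 < s) (x : ℝ) : ‖squareFun a b x‖ₑ ^ s ≤
      (∫⁻ y, ‖wrapSum a b x y‖ₑ ^ 2 ∂cellMeasure) ^ (s / 2) := by
  have h0 : 0 ≤ ∑' n : ℤ, ‖S n a b x‖ ^ 2 := tsum_nonneg fun _ => by positivity
  rw [squareFun, Real.enorm_of_nonneg (Real.sqrt_nonneg _), Real.sqrt_eq_rpow,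
    ← ENNReal.ofReal_rpow_of_nonneg h0 (by norm_num), ← ENNReal.rpow_mul, one_div_mul_eq_div]
  exact ENNReal.rpow_le_rpow (ofReal_tsum_sq_le ha x) (by positivity)

/-- A function with finite positive norm is a multiple of a normalised one. -/
lemma exists_schwartz_normalized (f : SchwartzMap ℝ ℂ) {p : ℝ} (hp : 1 < p) :
    ∃ (α : ℝ) (a : ℝ →ᵇ ℂ) (M : ℝ), 0 ≤ α ∧ (∀ y, ‖a y‖ ≤ M * decay 1 y ^ 2) ∧
      ∫⁻ t, ‖a t‖ₑ ^ p ≤ 1 ∧ (⇑f = fun x => (α : ℂ) * a x) ∧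
      ENNReal.ofReal α = eLpNorm f (ENNReal.ofReal p) volume := by
  have hp0 : 0 < p := by linarith
  have hfin : eLpNorm f (ENNReal.ofReal p) volume ≠ ⊤ := (f.memLp _ _).2.ne
  obtain ⟨α, hα, hα'⟩ : ∃ α : ℝ, 0 ≤ α ∧
      ENNReal.ofReal α = eLpNorm f (ENNReal.ofReal p) volume :=
    ⟨_, ENNReal.toReal_nonneg, ENNReal.ofReal_toReal hfin⟩
  obtain ⟨M, hM⟩ := exists_schwartz_norm_le_decay_sq f
  rcases hα.eq_or_lt with h0 | h0
  · subst h0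
    refine ⟨0, 0, 0, le_rfl, by simp, by simp [hp0], ?_, hα'⟩
    rw [ENNReal.ofReal_zero, eq_comm, eLpNorm_eq_zero_iff f.continuous.aestronglyMeasurable
      (by simpa using hp0)] at hα'
    rw [Continuous.ae_eq_iff_eq volume f.continuous continuous_zero] at hα'
    rw [hα']
    funext x
    simp
  · refine ⟨α, ((α : ℂ)⁻¹) • f.toBoundedContinuousFunction, α⁻¹ * M, h0.le, fun y => ?_, ?_, ?_, hα'⟩
    · have : (((α : ℂ)⁻¹) • f.toBoundedContinuousFunction) y = (α : ℂ)⁻¹ * f y := rfl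
      rw [this, norm_mul, norm_inv, Complex.norm_real, Real.norm_of_nonneg h0.le, mul_assoc]
      gcongr
      exact hM y
    · have h1 : eLpNorm (((α : ℂ)⁻¹) • ⇑f) (ENNReal.ofReal p) volume = 1 := by
        rw [eLpNorm_const_smul, ← hα', enorm_inv (by exact_mod_cast h0.ne'), ← ofReal_norm,
          Complex.norm_real, Real.norm_of_nonneg h0.le]
        exact ENNReal.inv_mul_cancel (by simpa using h0) ENNReal.ofReal_ne_top
      rw [eLpNorm_ofReal_eq _ hp0] at h1
      have h2 := congrArg (fun c => c ^ p) h1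
      simp only [← ENNReal.rpow_mul, one_div_mul_cancel hp0.ne', ENNReal.rpow_one,
        ENNReal.one_rpow] at h2
      exact h2.le
    · funext x
      have : (((α : ℂ)⁻¹) • f.toBoundedContinuousFunction) x = (α : ℂ)⁻¹ * f x := rfl
      rw [this, mul_inv_cancel_left₀ (by exact_mod_cast h0.ne')]

end

/-- For `p, q, r ∈ (2,∞)` with `1/p + 1/q + 1/r = 1` and `r' = r/(r-1)`,
the square function `(Σ_n |S_n(f,g)|²)^{1/2}` maps `L^p × L^q` into `L^{r'}`. -/
theorem bilinear_littlewood_paley_Sn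
    (p q r : ℝ) (hp : 2 < p) (hq : 2 < q) (hr : 2 < r)
    (hpqr : 1 / p + 1 / q + 1 / r = 1) :
    ∃ C : ℝ, 0 < C ∧ ∀ f g : SchwartzMap ℝ ℂ,
      eLpNorm (fun x : ℝ => Real.sqrt (∑' n : ℤ, ‖S n (⇑f) (⇑g) x‖ ^ 2))
          (ENNReal.ofReal (r / (r - 1))) volume ≤
        ENNReal.ofReal C * eLpNorm (⇑f) (ENNReal.ofReal p) volume *
          eLpNorm (⇑g) (ENNReal.ofReal q) volume := by
  obtain ⟨K, hK, h⟩ := exists_lintegral_wrapSum_le hp hq hr hpqr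
  have hs : 0 < r / (r - 1) := div_pos (by linarith) (by linarith)
  set s := r / (r - 1)
  have hK' : K ^ (1 / s) ≠ ⊤ := ENNReal.rpow_ne_top_of_nonneg (by positivity) hK
  refine ⟨(K ^ (1 / s)).toReal + 1, by positivity, fun f g => ?_⟩
  obtain ⟨α, a, M, hα, ha, hap, hfa, hαf⟩ := exists_schwartz_normalized f (p := p) (by linarith)
  obtain ⟨β, b, -, hβ, -, hbq, hgb, hβg⟩ := exists_schwartz_normalized g (p := q) (by linarith)
  have key : eLpNorm (squareFun a b) (ENNReal.ofReal s) volume ≤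
      ENNReal.ofReal ((K ^ (1 / s)).toReal + 1) := by
    rw [eLpNorm_ofReal_eq _ hs]
    calc _ ≤ K ^ (1 / s) := ENNReal.rpow_le_rpow
          ((lintegral_mono fun x => enorm_squareFun_rpow_le ha hs x).trans (h a b M ha hap hbq))
          (by positivity)
      _ = ENNReal.ofReal (K ^ (1 / s)).toReal := (ENNReal.ofReal_toReal hK').symm
      _ ≤ _ := ENNReal.ofReal_le_ofReal (by linarith)
  change eLpNorm (squareFun f g) _ _ ≤ _
  rw [← hαf, ← hβg, hfa, hgb, squareFun_smul hα hβ, eLpNorm_const_smul, Real.enorm_of_nonneg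
    (by positivity), ENNReal.ofReal_mul hα, mul_right_comm,
    mul_assoc (ENNReal.ofReal ((K ^ (1 / s)).toReal + 1)), mul_comm _ (ENNReal.ofReal α * _)]
  rw [mul_right_comm]
  gcongr
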